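/- There exists a universal constant C > 0 such that for every n, every isotropic log-concave random vector X in ℝⁿ, every p ≥ 1, and every t ≥ C·log(n/σ_X(p)²), one has E[(t²·N_X(t))^p] ≤ (C·σ_X(p))^{2p}, where N_X(t) := ∑_{i=1}^n 𝟙{|X_i| ≥ t} is the number of coordinates of X of absolute value at least t. -/

import Mathlib

open MeasureTheory ProbabilityTheory Real
open scoped Pointwise ENNReal RealInnerProductSpace

noncomputable section

variable {Ω : Type*} [MeasurableSpace Ω]

/-- A random vector `X` in `ℝⁿ` is log-concave: for all nonempty compact sets `K, L` and
`a ∈ [0,1]`, `P(X ∈ aK + (1-a)L) ≥ P(X ∈ K)^a * P(X ∈ L)^(1-a)`. -/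
def IsLogConcave {n : ℕ} (μ : Measure Ω) (X : Ω → EuclideanSpace ℝ (Fin n)) : Prop :=
  ∀ K L : Set (EuclideanSpace ℝ (Fin n)), K.Nonempty → L.Nonempty →
    IsCompact K → IsCompact L → ∀ a : ℝ, 0 ≤ a → a ≤ 1 →
      (μ (X ⁻¹' K)).toReal ^ a * (μ (X ⁻¹' L)).toReal ^ (1 - a) ≤
        (μ (X ⁻¹' (a • K + (1 - a) • L))).toReal

/-- `X` is isotropic: centered with identity covariance matrix. -/
def IsIsotropic {n : ℕ} (μ : Measure Ω) (X : Ω → EuclideanSpace ℝ (Fin n)) : Prop :=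
  (∀ i, ∫ ω, X ω i ∂μ = 0) ∧
  ∀ i j, ∫ ω, X ω i * X ω j ∂μ = if i = j then (1 : ℝ) else 0

/-- `σ_X(p) = sup_{|t| = 1} (E|⟨t,X⟩|^p)^(1/p)`. -/
def sigmaX {n : ℕ} (μ : Measure Ω) (X : Ω → EuclideanSpace ℝ (Fin n)) (p : ℝ) : ℝ :=
  ⨆ t : {t : EuclideanSpace ℝ (Fin n) // ‖t‖ = 1},
    (∫ ω, |⟪t.1, X ω⟫| ^ p ∂μ) ^ (1 / p)

/-- Generalized inverse of `σ_X`. -/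
def sigmaXInv {n : ℕ} (μ : Measure Ω) (X : Ω → EuclideanSpace ℝ (Fin n)) (s : ℝ) : ℝ :=
  sSup {p : ℝ | 1 ≤ p ∧ sigmaX μ X p ≤ s}

/-- The log-concavity inequality for a measure, on all measurable sets. -/
def LogConcaveMeasure {E : Type*} [AddCommGroup E] [Module ℝ E] [MeasurableSpace E]
    (ν : Measure E) : Prop :=
  ∀ K L S : Set E, MeasurableSet K → MeasurableSet L → MeasurableSet S →
    ∀ a b : ℝ, 0 < a → 0 < b → a + b = 1 → (∀ x ∈ K, ∀ y ∈ L, a • x + b • y ∈ S) →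
      ν.real K ^ a * ν.real L ^ b ≤ ν.real S

lemma exists_seq_isCompact_tendsto {E : Type*} [TopologicalSpace E] [MeasurableSpace E]
    {ν : Measure E} [IsFiniteMeasure ν] [ν.InnerRegular] {K : Set E} (hK : MeasurableSet K)
    (hpos : 0 < ν.real K) :
    ∃ u : ℕ → Set E, (∀ k, u k ⊆ K ∧ IsCompact (u k) ∧ (u k).Nonempty) ∧
      Filter.Tendsto (fun k => ν.real (u k)) Filter.atTop (nhds (ν.real K)) := by
  have key : ∀ k : ℕ, ∃ C ⊆ K, IsCompact C ∧ C.Nonempty ∧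
      ν.real K - ν.real K * (1 / ((k : ℝ) + 1)) ≤ ν.real C := by
    intro k
    have hd : 0 < 1 / ((k : ℝ) + 1) := by positivity
    have h1 : 1 / ((k : ℝ) + 1) ≤ 1 := by
      rw [div_le_one (by positivity)]; linarith [(k.cast_nonneg : (0 : ℝ) ≤ k)]
    have hr : ENNReal.ofReal (ν.real K - ν.real K * (1 / ((k : ℝ) + 1))) < ν K := by
      rw [← ofReal_measureReal (measure_ne_top ν K)]
      rw [ENNReal.ofReal_lt_ofReal_iff hpos]
      nlinarith
    obtain ⟨C, hCK, hC, hlt⟩ := hK.exists_lt_isCompact hr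
    refine ⟨C, hCK, hC, ?_, ?_⟩
    · rw [Set.nonempty_iff_ne_empty]
      rintro rfl
      simp at hlt
    · rw [measureReal_def]
      exact (ENNReal.ofReal_le_iff_le_toReal (measure_ne_top _ _)).1 hlt.le
  choose u hu1 hu2 hu3 hu4 using key
  refine ⟨u, fun k => ⟨hu1 k, hu2 k, hu3 k⟩, ?_⟩
  have hlim : Filter.Tendsto (fun k : ℕ => ν.real K - ν.real K * (1 / ((k : ℝ) + 1)))
      Filter.atTop (nhds (ν.real K)) := by
    simpa using (tendsto_const_nhds (x := ν.real K)).sub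
      ((tendsto_const_nhds (x := ν.real K)).mul tendsto_one_div_add_atTop_nhds_zero_nat)
  exact tendsto_of_tendsto_of_tendsto_of_le_of_le hlim tendsto_const_nhds hu4
    fun k => measureReal_mono (hu1 k)

lemma IsLogConcave.logConcaveMeasure {Ω : Type*} [MeasurableSpace Ω] {μ : Measure Ω}
    [IsProbabilityMeasure μ] {n : ℕ} {X : Ω → EuclideanSpace ℝ (Fin n)} (hX : Measurable X)
    (h : IsLogConcave μ X) : LogConcaveMeasure (μ.map X) := by
  have : IsProbabilityMeasure (μ.map X) := Measure.isProbabilityMeasure_map hX.aemeasurable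
  intro K L S hK hL hS a b ha hb hab hKL
  rcases (measureReal_nonneg (μ := μ.map X) (s := K)).eq_or_lt with h0 | hKpos
  · rw [← h0, Real.zero_rpow ha.ne', zero_mul]; exact measureReal_nonneg
  rcases (measureReal_nonneg (μ := μ.map X) (s := L)).eq_or_lt with h0 | hLpos
  · rw [← h0, Real.zero_rpow hb.ne', mul_zero]; exact measureReal_nonneg
  obtain ⟨u, hu, hut⟩ := exists_seq_isCompact_tendsto hK hKpos
  obtain ⟨v, hv, hvt⟩ := exists_seq_isCompact_tendsto hL hLpos
  refine le_of_tendsto ((hut.rpow_const (Or.inl hKpos.ne')).mul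
    (hvt.rpow_const (Or.inl hLpos.ne'))) (Filter.Eventually.of_forall fun k => ?_)
  obtain ⟨hu1, hu2, hu3⟩ := hu k
  obtain ⟨hv1, hv2, hv3⟩ := hv k
  have hb' : b = 1 - a := by linarith
  have := h (u k) (v k) hu3 hv3 hu2 hv2 a ha.le (by linarith)
  rw [measureReal_def, measureReal_def, Measure.map_apply hX hu2.measurableSet,
    Measure.map_apply hX hv2.measurableSet, hb']
  refine this.trans ?_
  rw [← measureReal_def, map_measureReal_apply hX hS]
  refine measureReal_mono (Set.preimage_mono ?_)
  rintro _ ⟨_, ⟨x, hx, rfl⟩, _, ⟨y, hy, rfl⟩, rfl⟩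
  have := hKL x (hu1 hx) y (hv1 hy)
  rwa [hb'] at this

lemma LogConcaveMeasure.map {E F : Type*} [AddCommGroup E] [Module ℝ E] [MeasurableSpace E]
    [AddCommGroup F] [Module ℝ F] [MeasurableSpace F] {ν : Measure E}
    (h : LogConcaveMeasure ν) (T : E →ₗ[ℝ] F) (hT : Measurable T) :
    LogConcaveMeasure (ν.map T) := by
  intro K L S hK hL hS a b ha hb hab hKL
  rw [map_measureReal_apply hT hS, map_measureReal_apply hT hL, map_measureReal_apply hT hK]
  refine h _ _ _ (hT hK) (hT hL) (hT hS) a b ha hb hab fun x hx y hy => ?_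
  simpa using hKL _ hx _ hy

/-- Borell's lemma: exponential decay of the tails of a log-concave measure on the line. -/
lemma LogConcaveMeasure.tail_le {ν : Measure ℝ} [IsProbabilityMeasure ν]
    (h : LogConcaveMeasure ν) {p r : ℝ} (hp : 1 ≤ p)
    (hpr : ν.real {x | r ≤ |x|} ≤ exp (-2 * p)) {u : ℝ} (hu : 1 ≤ u) :
    ν.real {x | u * r ≤ |x|} ≤ exp (-(p * u / 2)) := by
  rcases hu.eq_or_lt with rfl | hu
  · rw [one_mul]; exact hpr.trans (exp_le_exp.2 (by linarith))
  have hm : ∀ c : ℝ, MeasurableSet {x : ℝ | c ≤ |x|} := fun c =>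
    measurableSet_le measurable_const continuous_abs.measurable
  have hm' : MeasurableSet {x : ℝ | |x| ≤ r} :=
    measurableSet_le continuous_abs.measurable measurable_const
  have hu1 : 0 < u + 1 := by linarith
  set P := ν.real {x | u * r ≤ |x|} with hP
  set Q := ν.real {x : ℝ | |x| ≤ r} with hQ
  have hP0 : 0 ≤ P := measureReal_nonneg
  have hQ1 : exp (-1) ≤ Q := by
    have h1 : 1 ≤ Q + ν.real {x | r ≤ |x|} := by
      have : (1 : ℝ) = ν.real Set.univ := by simp
      rw [this]
      refine (measureReal_mono (fun x _ => ?_)).trans (measureReal_union_le _ _)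
      rcases le_total |x| r with hx | hx
      · exact Or.inl hx
      · exact Or.inr hx
    have h2 : exp (-2 * p) ≤ exp (-1) * exp (-1) := by
      rw [← exp_add]; exact exp_le_exp.2 (by linarith)
    have h3 : exp (-1) * 2 ≤ 1 := by
      have := add_one_le_exp (1 : ℝ)
      rw [exp_neg, inv_mul_le_iff₀ (exp_pos _)]; linarith
    have h4 := exp_pos (-1 : ℝ)
    nlinarith
  have hQ0 : 0 < Q := (exp_pos _).trans_le hQ1
  have key := h {x | u * r ≤ |x|} {x | |x| ≤ r} {x | r ≤ |x|} (hm _) hm' (hm _)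
    (2 / (u + 1)) ((u - 1) / (u + 1)) (by positivity) (div_pos (by linarith) hu1)
    (by field_simp; ring) (by
      intro x hx y hy
      simp only [Set.mem_ofPred_eq, smul_eq_mul] at *
      have h1 : |2 / (u + 1) * x| = 2 / (u + 1) * |x| := by
        rw [abs_mul, abs_of_pos (by positivity)]
      have h2 : |(u - 1) / (u + 1) * y| = (u - 1) / (u + 1) * |y| := by
        rw [abs_mul, abs_of_pos (div_pos (by linarith) hu1)]
      have h3 := abs_sub_abs_le_abs_sub (2 / (u + 1) * x) (-((u - 1) / (u + 1) * y))
      rw [sub_neg_eq_add, abs_neg, h1, h2] at h3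
      refine le_trans ?_ h3
      have h4 : 2 / (u + 1) * (u * r) ≤ 2 / (u + 1) * |x| := by gcongr
      have h5 : (u - 1) / (u + 1) * |y| ≤ (u - 1) / (u + 1) * r :=
        mul_le_mul_of_nonneg_left hy (div_pos (by linarith) hu1).le
      have h6 : 2 / (u + 1) * (u * r) - (u - 1) / (u + 1) * r = r := by field_simp; ring
      linarith)
  rw [← hP, ← hQ] at key
  have key2 := Real.rpow_le_rpow (by positivity) (key.trans hpr)
    (show 0 ≤ (u + 1) / 2 by positivity)
  rw [Real.mul_rpow (by positivity) (by positivity), ← Real.rpow_mul hP0, ← Real.rpow_mul hQ0.le,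
    show 2 / (u + 1) * ((u + 1) / 2) = 1 by field_simp, Real.rpow_one,
    show (u - 1) / (u + 1) * ((u + 1) / 2) = (u - 1) / 2 by field_simp, ← Real.exp_mul] at key2
  have h7 : exp (-((u - 1) / 2)) ≤ Q ^ ((u - 1) / 2) := by
    have := Real.rpow_le_rpow (exp_pos _).le hQ1 (show 0 ≤ (u - 1) / 2 by linarith)
    rwa [← Real.exp_mul, neg_one_mul] at this
  have h8 : P * exp (-((u - 1) / 2)) ≤ exp (-2 * p * ((u + 1) / 2)) :=
    (mul_le_mul_of_nonneg_left h7 hP0).trans key2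
  have h9 : P = P * exp (-((u - 1) / 2)) * exp ((u - 1) / 2) := by
    rw [mul_assoc, ← exp_add]; simp
  rw [h9]
  refine (mul_le_mul_of_nonneg_right h8 (exp_pos _).le).trans ?_
  rw [← exp_add]
  refine exp_le_exp.2 ?_
  nlinarith

/-- `x^q ≤ (c q)^q e^{x/c}`-type bound. -/
lemma rpow_le_mul_exp {x c q : ℝ} (hx : 0 ≤ x) (hc : 0 < c) (hq : 0 < q) :
    x ^ q ≤ (c * q) ^ q * exp (x / c) := by
  have h1 : x = (c * q) * (x / (c * q)) := by field_simp
  have h2 : x / (c * q) ≤ exp (x / (c * q)) := by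
    linarith [add_one_le_exp (x / (c * q))]
  calc x ^ q = ((c * q) * (x / (c * q))) ^ q := by rw [← h1]
    _ = (c * q) ^ q * (x / (c * q)) ^ q := Real.mul_rpow (by positivity) (by positivity)
    _ ≤ (c * q) ^ q * (exp (x / (c * q))) ^ q := by gcongr
    _ = (c * q) ^ q * exp (x / c) := by
      rw [← Real.exp_mul]; congr 2; field_simp

lemma LogConcaveMeasure.lintegral_exp_le {ν : Measure ℝ} [IsProbabilityMeasure ν]
    (h : LogConcaveMeasure ν) {p r : ℝ} (hp : 1 ≤ p) (hr : 0 < r)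
    (hpr : ν.real {x | r ≤ |x|} ≤ exp (-2 * p)) :
    ∫⁻ x, ENNReal.ofReal (exp (|x| / (4 * r / p))) ∂ν ≤ ENNReal.ofReal (5 * exp (p / 4)) := by
  have hm : ∀ c : ℝ, MeasurableSet {x : ℝ | c ≤ |x|} := fun c =>
    measurableSet_le measurable_const continuous_abs.measurable
  have hp0 : 0 < p := by linarith
  set q := exp (-(p / 4)) with hq
  have hq1 : q ≤ 4 / 5 := by
    have h1 : q ≤ exp (-(1 / 4)) := exp_le_exp.2 (by linarith)
    have h2 := add_one_le_exp (1 / 4 : ℝ)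
    have h3 : exp (-(1 / 4 : ℝ)) ≤ 4 / 5 := by
      rw [exp_neg, inv_le_comm₀ (exp_pos _) (by norm_num)]; linarith
    linarith
  have hq0 : 0 < q := exp_pos _
  calc ∫⁻ x, ENNReal.ofReal (exp (|x| / (4 * r / p))) ∂ν
      ≤ ∫⁻ x, ∑' j : ℕ, Set.indicator {x : ℝ | (j : ℝ) * r ≤ |x|}
          (fun _ => ENNReal.ofReal (exp (p * (j + 1) / 4))) x ∂ν := by
        refine lintegral_mono fun x => ?_
        refine le_trans ?_ (ENNReal.le_tsum ⌊|x| / r⌋₊)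
        have h1 : (⌊|x| / r⌋₊ : ℝ) * r ≤ |x| := by
          have := Nat.floor_le (show 0 ≤ |x| / r by positivity)
          rwa [le_div_iff₀ hr] at this
        rw [Set.indicator_of_mem (by exact h1)]
        refine ENNReal.ofReal_le_ofReal (exp_le_exp.2 ?_)
        have h2 := (Nat.lt_floor_add_one (|x| / r)).le
        calc |x| / (4 * r / p) = p * (|x| / r) / 4 := by field_simp
          _ ≤ _ := by gcongr
    _ = ∑' j : ℕ, ENNReal.ofReal (exp (p * (j + 1) / 4)) * ν {x : ℝ | (j : ℝ) * r ≤ |x|} := by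
        rw [lintegral_tsum fun j => (measurable_const.indicator (hm _)).aemeasurable]
        congr 1; ext j
        rw [lintegral_indicator_const (hm _)]
    _ ≤ ∑' j : ℕ, ENNReal.ofReal (exp (p / 4) * q ^ j) := by
        refine ENNReal.tsum_le_tsum fun j => ?_
        have h1 : ν.real {x : ℝ | (j : ℝ) * r ≤ |x|} ≤ exp (-(p * j / 2)) := by
          rcases Nat.eq_zero_or_pos j with rfl | hj
          · simp
          · exact h.tail_le hp hpr (by exact_mod_cast hj)
        rw [← ofReal_measureReal (measure_ne_top ν _), ← ENNReal.ofReal_mul (exp_pos _).le]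
        refine ENNReal.ofReal_le_ofReal ?_
        refine (mul_le_mul_of_nonneg_left h1 (exp_pos _).le).trans (le_of_eq ?_)
        rw [hq, ← exp_nat_mul, ← exp_add, ← exp_add]
        congr 1; ring
    _ = ENNReal.ofReal (exp (p / 4) * (1 - q)⁻¹) := by
        have hs := (hasSum_geometric_of_lt_one hq0.le (by linarith)).mul_left (exp (p / 4))
        rw [← ENNReal.ofReal_tsum_of_nonneg (fun j => by positivity) hs.summable, hs.tsum_eq]
    _ ≤ ENNReal.ofReal (5 * exp (p / 4)) := by
        refine ENNReal.ofReal_le_ofReal ?_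
        rw [mul_comm]
        gcongr
        rw [inv_le_comm₀ (by linarith) (by norm_num)]; linarith

/-- Comparison of moments of a log-concave measure on the line. -/
lemma LogConcaveMeasure.integral_rpow_le {ν : Measure ℝ} [IsProbabilityMeasure ν]
    (h : LogConcaveMeasure ν) {p q : ℝ} (hp : 1 ≤ p) (hpq : p ≤ q)
    (hi : Integrable (fun x => |x| ^ p) ν) :
    Integrable (fun x => |x| ^ q) ν ∧
      ∫ x, |x| ^ q ∂ν ≤ (200 * (q / p)) ^ q * (∫ x, |x| ^ p ∂ν) ^ (q / p) := by
  have hp0 : 0 < p := by linarith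
  have hq0 : 0 < q := by linarith
  have hI0 : 0 ≤ ∫ x, |x| ^ p ∂ν := integral_nonneg fun x => by positivity
  rcases hI0.eq_or_lt with hI | hI
  · have h0 : (fun x : ℝ => |x| ^ p) =ᵐ[ν] 0 :=
      (integral_eq_zero_iff_of_nonneg (fun x => by positivity) hi).1 hI.symm
    have h1 : (fun x : ℝ => |x| ^ q) =ᵐ[ν] fun _ => 0 := by
      filter_upwards [h0] with x hx
      have : |x| = 0 := by
        simpa [Real.rpow_eq_zero (abs_nonneg x) hp0.ne'] using hx
      rw [this, Real.zero_rpow hq0.ne']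
    refine ⟨(integrable_congr h1).2 (integrable_const 0), ?_⟩
    rw [integral_congr_ae h1, integral_zero]
    positivity
  set m := (∫ x, |x| ^ p ∂ν) ^ (1 / p) with hm
  have hm0 : 0 < m := by positivity
  have hmp : m ^ p = ∫ x, |x| ^ p ∂ν := by
    rw [hm, ← Real.rpow_mul hI0]; simp [hp0.ne']
  have hmq : m ^ q = (∫ x, |x| ^ p ∂ν) ^ (q / p) := by
    rw [hm, ← Real.rpow_mul hI0]; congr 1; field_simp
  set r := exp 2 * m with hr
  have hr0 : 0 < r := by positivity
  have hpr : ν.real {x | r ≤ |x|} ≤ exp (-2 * p) := by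
    have h1 := mul_meas_ge_le_integral_of_nonneg (μ := ν)
      (Filter.Eventually.of_forall fun x : ℝ => (by positivity : (0 : ℝ) ≤ |x| ^ p)) hi (r ^ p)
    have h2 : {x : ℝ | r ^ p ≤ |x| ^ p} = {x | r ≤ |x|} := by
      ext x
      exact Real.rpow_le_rpow_iff hr0.le (abs_nonneg x) hp0
    rw [h2, ← hmp] at h1
    have h3 : r ^ p = exp (2 * p) * m ^ p := by
      rw [hr, Real.mul_rpow (exp_pos _).le hm0.le, ← Real.exp_mul]
    rw [h3] at h1
    have h4 : 0 < m ^ p := by positivity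
    have h5 : exp (2 * p) * ν.real {x | r ≤ |x|} ≤ 1 := by
      nlinarith
    rw [show -2 * p = -(2 * p) by ring, exp_neg, ← one_div, le_div_iff₀ (exp_pos _)]
    linarith
  have hexp := h.lintegral_exp_le hp hr0 hpr
  have hexpi : Integrable (fun x => exp (|x| / (4 * r / p))) ν := by
    refine ⟨by fun_prop, ?_⟩
    rw [hasFiniteIntegral_iff_ofReal (Filter.Eventually.of_forall fun x => (exp_pos _).le)]
    exact hexp.trans_lt ENNReal.ofReal_lt_top
  have hexp2 : ∫ x, exp (|x| / (4 * r / p)) ∂ν ≤ 5 * exp (p / 4) := by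
    rw [integral_eq_lintegral_of_nonneg_ae (Filter.Eventually.of_forall fun x => (exp_pos _).le)
      (by fun_prop)]
    exact ENNReal.toReal_le_of_le_ofReal (by positivity) hexp
  have hpt : ∀ x : ℝ, |x| ^ q ≤ (4 * r / p * q) ^ q * exp (|x| / (4 * r / p)) := fun x =>
    rpow_le_mul_exp (abs_nonneg x) (by positivity) hq0
  have hint : Integrable (fun x : ℝ => |x| ^ q) ν := by
    refine (hexpi.const_mul ((4 * r / p * q) ^ q)).mono' ?_ (Filter.Eventually.of_forall fun x => ?_)
    · exact (continuous_abs.rpow_const fun _ => Or.inr hq0.le).aestronglyMeasurable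
    · rw [Real.norm_of_nonneg (by positivity)]; exact hpt x
  refine ⟨hint, ?_⟩
  have he : exp (2 + 1 / 4) ≤ 10 := by
    have h1 := Real.exp_one_lt_d9
    have h2 : exp (2 + 1 / 4 : ℝ) ^ 4 = exp 1 ^ 9 := by
      rw [← exp_nat_mul, ← exp_nat_mul]; norm_num
    have h3 : exp 1 ^ 9 ≤ (2.7182818286 : ℝ) ^ 9 := by gcongr
    have h4 : exp (2 + 1 / 4 : ℝ) ^ 4 ≤ 10 ^ 4 := by rw [h2]; exact h3.trans (by norm_num)
    exact le_of_pow_le_pow_left₀ (by norm_num) (by norm_num) h4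
  calc ∫ x, |x| ^ q ∂ν ≤ ∫ x, (4 * r / p * q) ^ q * exp (|x| / (4 * r / p)) ∂ν :=
        integral_mono hint (hexpi.const_mul _) hpt
    _ = (4 * r / p * q) ^ q * ∫ x, exp (|x| / (4 * r / p)) ∂ν := integral_const_mul _ _
    _ ≤ (4 * r / p * q) ^ q * (5 * exp (p / 4)) := by gcongr
    _ ≤ (4 * r / p * q) ^ q * (5 ^ q * exp (1 / 4) ^ q) := by
        gcongr
        · calc (5 : ℝ) = 5 ^ (1 : ℝ) := by simp
            _ ≤ 5 ^ q := Real.rpow_le_rpow_of_exponent_le (by norm_num) (by linarith)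
        · rw [← Real.exp_mul]; exact exp_le_exp.2 (by linarith)
    _ = (20 * exp (2 + 1 / 4) * (q / p)) ^ q * m ^ q := by
        rw [← Real.mul_rpow (by positivity) (by positivity),
          ← Real.mul_rpow (by positivity) (by positivity),
          ← Real.mul_rpow (by positivity) (by positivity), hr, exp_add]
        congr 1; field_simp; ring
    _ ≤ (200 * (q / p)) ^ q * m ^ q := by
        gcongr; linarith
    _ = _ := by rw [hmq]

/-- The sign `±1` attached to a Boolean. -/
def boolSign (b : Bool) : ℝ := if b then 1 else -1

@[simp] lemma boolSign_true : boolSign true = 1 := rfl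

@[simp] lemma boolSign_false : boolSign false = -1 := rfl

lemma boolSign_not (b : Bool) : boolSign (!b) = -boolSign b := by cases b <;> simp

/-- The mean of a function over the discrete cube. -/
def cubeMean {ι : Type*} [Fintype ι] [DecidableEq ι] (f : (ι → Bool) → ℝ) : ℝ :=
  (∑ x, f x) / 2 ^ Fintype.card ι

section CubeMean

variable {ι κ : Type*} [Fintype ι] [DecidableEq ι] [Fintype κ] [DecidableEq κ]

lemma cubeMean_mono {f g : (ι → Bool) → ℝ} (h : ∀ x, f x ≤ g x) : cubeMean f ≤ cubeMean g := by
  unfold cubeMean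
  gcongr
  exact h _

lemma cubeMean_add (f g : (ι → Bool) → ℝ) :
    cubeMean (fun x => f x + g x) = cubeMean f + cubeMean g := by
  simp only [cubeMean, Finset.sum_add_distrib, add_div]

lemma cubeMean_const_mul (c : ℝ) (f : (ι → Bool) → ℝ) :
    cubeMean (fun x => c * f x) = c * cubeMean f := by
  simp only [cubeMean, ← Finset.mul_sum, mul_div_assoc]

lemma cubeMean_mul_const (c : ℝ) (f : (ι → Bool) → ℝ) :
    cubeMean (fun x => f x * c) = cubeMean f * c := by
  simp only [mul_comm _ c, cubeMean_const_mul]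

lemma cubeMean_div_const (c : ℝ) (f : (ι → Bool) → ℝ) :
    cubeMean (fun x => f x / c) = cubeMean f / c := by
  simp only [div_eq_mul_inv, cubeMean_mul_const]

lemma cubeMean_sum {β : Type*} (s : Finset β) (f : β → (ι → Bool) → ℝ) :
    cubeMean (fun x => ∑ b ∈ s, f b x) = ∑ b ∈ s, cubeMean (f b) := by
  simp only [cubeMean]
  rw [Finset.sum_comm, Finset.sum_div]

lemma cubeMean_const (c : ℝ) : cubeMean (fun _ : ι → Bool => c) = c := by
  simp [cubeMean]

lemma cubeMean_nonneg {f : (ι → Bool) → ℝ} (h : ∀ x, 0 ≤ f x) : 0 ≤ cubeMean f :=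
  (cubeMean_const (ι := ι) 0).symm.le.trans (cubeMean_mono h)

lemma exists_le_cubeMean (f : (ι → Bool) → ℝ) : ∃ x, f x ≤ cubeMean f := by
  by_contra! hcon
  have h1 : ∑ _x : ι → Bool, cubeMean f < ∑ x, f x :=
    Finset.sum_lt_sum_of_nonempty Finset.univ_nonempty fun x _ => hcon x
  have h2 : ∑ _x : ι → Bool, cubeMean f = ∑ x, f x := by
    simp [cubeMean]; field_simp
  linarith

lemma cubeMean_equiv (e : ι ≃ κ) (f : (ι → Bool) → ℝ) :
    cubeMean (fun x : κ → Bool => f (x ∘ e)) = cubeMean f := by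
  unfold cubeMean
  rw [Fintype.card_congr e]
  congr 1
  refine Fintype.sum_equiv (e.symm.arrowCongr (Equiv.refl Bool)) _ _ fun x => ?_
  congr 1

lemma cubeMean_not (f : (ι → Bool) → ℝ) :
    cubeMean (fun x => f (fun i => !(x i))) = cubeMean f := by
  unfold cubeMean
  congr 1
  refine Fintype.sum_equiv (Equiv.piCongrRight fun _ => Equiv.boolNot) _ _ fun x => ?_
  congr 1

lemma cubeMean_succ {N : ℕ} (f : (Fin (N + 1) → Bool) → ℝ) :
    cubeMean f = (cubeMean (fun x : Fin N → Bool => f (Fin.cons true x)) +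
      cubeMean (fun x : Fin N → Bool => f (Fin.cons false x))) / 2 := by
  have h : ∑ x, f x = ∑ b : Bool × (Fin N → Bool), f (Fin.cons b.1 b.2) :=
    (Fintype.sum_equiv (Fin.consEquiv fun _ => Bool) _ _ fun x => rfl).symm
  unfold cubeMean
  rw [h, Fintype.sum_prod_type, Fintype.sum_bool, Fintype.card_fin, Fintype.card_fin, pow_succ]
  field_simp

/-- Mean of a function of a Rademacher sum, reduced to sums indexed by `Fin N`. -/
lemma cubeMean_sum_reindex (φ : ℝ → ℝ) (a : ι → ℝ) (e : ι ≃ Fin (Fintype.card ι)) :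
    cubeMean (fun x : ι → Bool => φ (∑ i, a i * boolSign (x i))) =
      cubeMean (fun x : Fin (Fintype.card ι) → Bool =>
        φ (∑ i, a (e.symm i) * boolSign (x i))) := by
  rw [← cubeMean_equiv e]
  congr 1; ext x; congr 1
  refine Fintype.sum_equiv e _ _ fun i => ?_
  simp

lemma cubeMean_cosh_aux {N : ℕ} (a : Fin N → ℝ) :
    cubeMean (fun x : Fin N → Bool => exp (∑ i, a i * boolSign (x i))) ≤
      exp ((∑ i, a i ^ 2) / 2) := by
  induction N with
  | zero => simp [cubeMean]
  | succ N ih =>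
    rw [cubeMean_succ]
    simp only [Fin.sum_univ_succ, Fin.cons_zero, Fin.cons_succ, boolSign_true, boolSign_false,
      exp_add, cubeMean_const_mul]
    have h1 := ih fun i => a i.succ
    have h2 := Real.cosh_le_exp_half_sq (a 0)
    rw [Real.cosh_eq] at h2
    rw [add_div (a 0 ^ 2), exp_add]
    have h3 := mul_le_mul h2 h1 (cubeMean_nonneg fun x => (exp_pos _).le) (exp_pos _).le
    simp only [mul_one, mul_neg]
    linarith

lemma cubeMean_exp_le (a : ι → ℝ) :
    cubeMean (fun x : ι → Bool => exp (∑ i, a i * boolSign (x i))) ≤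
      exp ((∑ i, a i ^ 2) / 2) := by
  let e := Fintype.equivFin ι
  rw [cubeMean_sum_reindex exp a e]
  refine (cubeMean_cosh_aux _).trans (le_of_eq ?_)
  rw [Fintype.sum_equiv e.symm (fun i => a (e.symm i) ^ 2) (fun i => a i ^ 2) fun i => rfl]

lemma cubeMean_sq_aux {N : ℕ} (a : Fin N → ℝ) :
    cubeMean (fun x : Fin N → Bool => (∑ i, a i * boolSign (x i)) ^ 2) = ∑ i, a i ^ 2 := by
  induction N with
  | zero => simp [cubeMean]
  | succ N ih =>
    rw [cubeMean_succ, ← cubeMean_add, ← cubeMean_div_const]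
    simp only [Fin.sum_univ_succ, Fin.cons_zero, Fin.cons_succ, boolSign_true, boolSign_false]
    rw [← ih fun i => a i.succ, ← cubeMean_const (ι := Fin N) (a 0 ^ 2), ← cubeMean_add]
    congr 1; ext x; ring

lemma cubeMean_pow_four_aux {N : ℕ} (a : Fin N → ℝ) :
    cubeMean (fun x : Fin N → Bool => (∑ i, a i * boolSign (x i)) ^ 4) ≤
      3 * (∑ i, a i ^ 2) ^ 2 := by
  induction N with
  | zero => simp [cubeMean]
  | succ N ih =>
    have h1 := ih fun i => a i.succ
    have h2 := cubeMean_sq_aux fun i => a i.succ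
    rw [cubeMean_succ, ← cubeMean_add, ← cubeMean_div_const]
    simp only [Fin.sum_univ_succ, Fin.cons_zero, Fin.cons_succ, boolSign_true, boolSign_false]
    have h3 : cubeMean (fun x : Fin N → Bool =>
        ((a 0 * 1 + ∑ i, a (Fin.succ i) * boolSign (x i)) ^ 4 +
          (a 0 * -1 + ∑ i, a (Fin.succ i) * boolSign (x i)) ^ 4) / 2) =
        cubeMean (fun x : Fin N → Bool => (∑ i, a (Fin.succ i) * boolSign (x i)) ^ 4) +
        6 * a 0 ^ 2 * cubeMean (fun x : Fin N → Bool =>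
          (∑ i, a (Fin.succ i) * boolSign (x i)) ^ 2) + a 0 ^ 4 := by
      rw [← cubeMean_const_mul, ← cubeMean_const (ι := Fin N) (a 0 ^ 4), ← cubeMean_add,
        ← cubeMean_add]
      congr 1; ext x; ring
    rw [h3, h2]
    nlinarith [sq_nonneg (a 0 ^ 2)]

lemma cubeMean_sq (a : ι → ℝ) :
    cubeMean (fun x : ι → Bool => (∑ i, a i * boolSign (x i)) ^ 2) = ∑ i, a i ^ 2 := by
  let e := Fintype.equivFin ι
  rw [cubeMean_sum_reindex (· ^ 2) a e, cubeMean_sq_aux]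
  exact Fintype.sum_equiv e.symm (fun i => a (e.symm i) ^ 2) (fun i => a i ^ 2) fun i => rfl

lemma cubeMean_pow_four_le (a : ι → ℝ) :
    cubeMean (fun x : ι → Bool => (∑ i, a i * boolSign (x i)) ^ 4) ≤ 3 * (∑ i, a i ^ 2) ^ 2 := by
  let e := Fintype.equivFin ι
  rw [cubeMean_sum_reindex (· ^ 4) a e]
  refine (cubeMean_pow_four_aux _).trans (le_of_eq ?_)
  rw [Fintype.sum_equiv e.symm (fun i => a (e.symm i) ^ 2) (fun i => a i ^ 2) fun i => rfl]

/-- Khinchine's inequality, upper bound. -/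
lemma cubeMean_abs_pow_le (a : ι → ℝ) {A : ℝ} (hA : 0 ≤ A) (ha : ∑ i, a i ^ 2 ≤ A ^ 2) {q : ℕ}
    (hq : 1 ≤ q) :
    cubeMean (fun x : ι → Bool => |∑ i, a i * boolSign (x i)| ^ q) ≤ (4 * √q * A) ^ q := by
  have hq0 : (0 : ℝ) < q := by exact_mod_cast hq
  rcases hA.eq_or_lt with rfl | hA
  · have h0 : ∀ i, a i = 0 := by
      have h1 : ∑ i, a i ^ 2 = 0 := le_antisymm (by simpa using ha) (by positivity)
      intro i
      simpa using (Finset.sum_eq_zero_iff_of_nonneg fun i _ => sq_nonneg (a i)).1 h1 i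
    simp [h0, cubeMean_const, show q ≠ 0 by omega]
  set c := √q / A with hc
  have hc0 : 0 < c := by positivity
  have hcA : c * A = √q := by rw [hc]; field_simp
  have hsq : √(q : ℝ) * √q = q := Real.mul_self_sqrt hq0.le
  have hpt : ∀ v : ℝ, |v| ^ q ≤ (√q * A) ^ q * (exp (c * v) + exp (-(c * v))) := by
    intro v
    have h1 := rpow_le_mul_exp (abs_nonneg v) (inv_pos.2 hc0) hq0
    rw [Real.rpow_natCast, Real.rpow_natCast] at h1
    have h2 : c⁻¹ * q = √q * A := by
      rw [hc]; field_simp; rw [sq, hsq]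
    rw [h2] at h1
    refine h1.trans ?_
    gcongr
    rw [div_inv_eq_mul]
    rcases abs_cases v with ⟨h, _⟩ | ⟨h, _⟩ <;> rw [h]
    · rw [mul_comm]; linarith [exp_pos (-(c * v))]
    · rw [show -v * c = -(c * v) by ring]; linarith [exp_pos (c * v)]
  have hexp : ∀ c' : ℝ, c' ^ 2 = c ^ 2 →
      cubeMean (fun x : ι → Bool => exp (c' * ∑ i, a i * boolSign (x i))) ≤ exp (q / 2) := by
    intro c' hc'
    have := cubeMean_exp_le fun i => c' * a i
    simp only [mul_assoc, ← Finset.mul_sum, mul_pow] at this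
    refine this.trans (exp_le_exp.2 ?_)
    rw [hc']
    have : c ^ 2 * A ^ 2 = q := by rw [← mul_pow, hcA, sq, hsq]
    have h3 : c ^ 2 * ∑ i, a i ^ 2 ≤ c ^ 2 * A ^ 2 := by gcongr
    linarith
  have he : exp (1 / 2 : ℝ) ≤ 2 := by
    have h1 := Real.exp_one_lt_d9
    have h2 : exp (1 / 2 : ℝ) ^ 2 = exp 1 := by
      rw [← exp_nat_mul]; norm_num
    nlinarith [exp_pos (1 / 2 : ℝ)]
  calc cubeMean (fun x : ι → Bool => |∑ i, a i * boolSign (x i)| ^ q)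
      ≤ cubeMean (fun x : ι → Bool => (√q * A) ^ q *
          (exp (c * ∑ i, a i * boolSign (x i)) + exp (-c * ∑ i, a i * boolSign (x i)))) := by
        refine cubeMean_mono fun x => ?_
        rw [neg_mul]; exact hpt _
    _ ≤ (√q * A) ^ q * (exp (q / 2) + exp (q / 2)) := by
        rw [cubeMean_const_mul, cubeMean_add]
        gcongr
        · exact hexp c rfl
        · exact hexp (-c) (by ring)
    _ = (√q * A) ^ q * (2 * exp (1 / 2) ^ q) := by
        rw [← exp_nat_mul]; ring_nf
    _ ≤ (√q * A) ^ q * (2 ^ q * 2 ^ q) := by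
        gcongr
        calc (2 : ℝ) = 2 ^ 1 := by simp
          _ ≤ 2 ^ q := pow_le_pow_right₀ (by norm_num) hq
    _ = (4 * √q * A) ^ q := by
        rw [← mul_pow, ← mul_pow]; congr 1; ring

end CubeMean

section CubeConcentration

variable {ι κ : Type*} [Fintype ι] [DecidableEq ι] [Fintype κ] [DecidableEq κ]

open Classical in
/-- A Paley-Zygmund bound for Rademacher sums. -/
lemma le_cubeMean_half_le (a : ι → ℝ) {A : ℝ} (hA : 0 < A) (ha : A ^ 2 = ∑ i, a i ^ 2) :
    3 / 32 ≤ cubeMean (fun x : ι → Bool =>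
      if A / 2 ≤ ∑ i, a i * boolSign (x i) then (1 : ℝ) else 0) := by
  set V : (ι → Bool) → ℝ := fun x => ∑ i, a i * boolSign (x i) with hV
  set g : (ι → Bool) → ℝ := fun x => if A / 2 ≤ V x then (1 : ℝ) else 0 with hg
  have hVneg : ∀ x, V (fun i => !(x i)) = -V x := by
    intro x; simp [hV, boolSign_not]
  have hpt : ∀ x, V x ^ 2 ≤ A ^ 2 / 4 + V x ^ 4 * (1 / (8 * A ^ 2)) +
      (2 * A ^ 2) * (g x + g (fun i => !(x i))) := by
    intro x
    have hA2 : 0 < A ^ 2 := by positivity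
    have hg0 : ∀ x, 0 ≤ g x := fun x => by simp only [hg]; split_ifs <;> norm_num
    by_cases hB : A / 2 ≤ |V x|
    · have h1 : 1 ≤ g x + g (fun i => !(x i)) := by
        rcases le_abs.1 hB with h | h
        · have : g x = 1 := by simp only [hg]; rw [if_pos h]
          linarith [hg0 (fun i => !(x i))]
        · have : g (fun i => !(x i)) = 1 := by simp only [hg]; rw [hVneg, if_pos h]
          linarith [hg0 x]
      have h2 : V x ^ 2 ≤ V x ^ 4 * (1 / (8 * A ^ 2)) + 2 * A ^ 2 := by
        have h3 : V x ^ 4 * (1 / (8 * A ^ 2)) + 2 * A ^ 2 - V x ^ 2 =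
            (V x ^ 2 - 4 * A ^ 2) ^ 2 / (8 * A ^ 2) := by field_simp; ring
        have : 0 ≤ (V x ^ 2 - 4 * A ^ 2) ^ 2 / (8 * A ^ 2) := by positivity
        linarith
      nlinarith
    · push Not at hB
      have h1 : V x ^ 2 ≤ A ^ 2 / 4 := by
        rw [← sq_abs]; nlinarith [abs_nonneg (V x)]
      have h2 : 0 ≤ V x ^ 4 * (1 / (8 * A ^ 2)) := by positivity
      have h3 : 0 ≤ (2 * A ^ 2) * (g x + g (fun i => !(x i))) :=
        mul_nonneg (by positivity) (add_nonneg (hg0 _) (hg0 _))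
      linarith
  have hmean := cubeMean_mono hpt
  rw [cubeMean_sq, cubeMean_add, cubeMean_add, cubeMean_const, cubeMean_mul_const,
    cubeMean_const_mul, cubeMean_add, cubeMean_not g] at hmean
  have h4 := cubeMean_pow_four_le a
  rw [← ha] at h4 hmean
  have h5 : cubeMean (fun x => V x ^ 4) * (1 / (8 * A ^ 2)) ≤
      3 * (A ^ 2) ^ 2 * (1 / (8 * A ^ 2)) := by gcongr
  have h6 : 3 * (A ^ 2) ^ 2 * (1 / (8 * A ^ 2)) = 3 / 8 * A ^ 2 := by field_simp
  have hA2 : 0 < A ^ 2 := by positivity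
  have h7 : 3 / 8 * A ^ 2 ≤ 4 * cubeMean g * A ^ 2 := by linarith
  have := le_of_mul_le_mul_right h7 hA2
  linarith

/-- Khinchine's inequality, lower bound, for Rademacher sums with repeated coefficients. -/
lemma le_cubeMean_abs_pow (a : ι → ℝ) {A : ℝ} (hA : 0 ≤ A) (ha : A ^ 2 = ∑ i, a i ^ 2) {q : ℕ}
    (hq : 1 ≤ q) :
    (3 / 64 * q * A) ^ q ≤ cubeMean (fun x : Fin q × ι → Bool =>
      |∑ k, a k.2 * boolSign (x k)| ^ q) := by
  classical
  rcases hA.eq_or_lt with rfl | hA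
  · rw [mul_zero, zero_pow (by omega)]
    exact cubeMean_nonneg fun x => by positivity
  set G : Finset (ι → Bool) := Finset.univ.filter fun x => A / 2 ≤ ∑ i, a i * boolSign (x i)
  have hG : (3 / 32 : ℝ) ≤ G.card / 2 ^ Fintype.card ι := by
    have := le_cubeMean_half_le a hA ha
    simpa [cubeMean, G, Finset.sum_boole] using this
  have hsum : ∑ x : Fin q × ι → Bool, |∑ k, a k.2 * boolSign (x k)| ^ q =
      ∑ y : Fin q → ι → Bool, |∑ j, ∑ i, a i * boolSign (y j i)| ^ q := by
    refine Fintype.sum_equiv (Equiv.curry _ _ _) _ _ fun x => ?_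
    rw [Fintype.sum_prod_type]; rfl
  have hlow : (G.card : ℝ) ^ q * (q * (A / 2)) ^ q ≤
      ∑ y : Fin q → ι → Bool, |∑ j, ∑ i, a i * boolSign (y j i)| ^ q := by
    calc (G.card : ℝ) ^ q * (q * (A / 2)) ^ q
        = ∑ y ∈ Fintype.piFinset (fun _ : Fin q => G), (q * (A / 2)) ^ q := by
          rw [Finset.sum_const, Fintype.card_piFinset]; simp
      _ ≤ ∑ y ∈ Fintype.piFinset (fun _ : Fin q => G),
            |∑ j, ∑ i, a i * boolSign (y j i)| ^ q := by
          refine Finset.sum_le_sum fun y hy => ?_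
          have hy' : ∀ j, A / 2 ≤ ∑ i, a i * boolSign (y j i) := fun j => by
            have := Fintype.mem_piFinset.1 hy j
            simpa [G] using this
          refine pow_le_pow_left₀ (by positivity) (le_trans ?_ (le_abs_self _)) _
          have := Finset.sum_le_sum (s := Finset.univ) fun j _ => hy' j
          simpa using this
      _ ≤ _ := Finset.sum_le_sum_of_subset_of_nonneg (Finset.subset_univ _)
          fun _ _ _ => by positivity
  unfold cubeMean
  rw [hsum, le_div_iff₀ (by positivity)]
  refine le_trans ?_ hlow
  rw [Fintype.card_prod, Fintype.card_fin, mul_comm q, pow_mul, ← mul_pow, ← mul_pow]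
  refine pow_le_pow_left₀ (by positivity) ?_ _
  rw [le_div_iff₀ (by positivity)] at hG
  have : 0 ≤ (q : ℝ) * A := by positivity
  nlinarith

lemma exp_mul_rpow_le {ρ : ℝ} (h1 : 1 / 2 ≤ ρ) (h2 : ρ ≤ 1) :
    exp ((2 * (1 - ρ)) ^ 2 / 16) * ρ ^ (-(1 - 2 * (1 - ρ))) ≤ 2 - ρ := by
  obtain ⟨x, rfl⟩ : ∃ x, ρ = 1 - x := ⟨1 - ρ, by ring⟩
  have hx0 : 0 ≤ x := by linarith
  have hx1 : x ≤ 1 / 2 := by linarith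
  have hρ : 0 < 1 - x := by linarith
  have hlog1 : -log (1 - x) ≤ x + x ^ 2 := by
    rw [← Real.log_inv, Real.log_le_iff_le_exp (by positivity)]
    have h3 := Real.quadratic_le_exp_of_nonneg (show 0 ≤ x + x ^ 2 by positivity)
    refine le_trans ?_ h3
    rw [inv_le_iff_one_le_mul₀ hρ]
    have : 0 ≤ x ^ 2 * (1 - x) := by positivity
    have : 0 ≤ x ^ 3 := by positivity
    have : 0 ≤ x ^ 4 * (1 - x) := by positivity
    have : 0 ≤ x ^ 2 * (1 / 2 - x) := mul_nonneg (by positivity) (by linarith)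
    nlinarith
  have hlog2 : x - x ^ 2 / 2 ≤ log (1 + x) := by
    refine le_trans ?_ (Real.le_log_one_add_of_nonneg hx0)
    rw [le_div_iff₀ (by linarith)]
    have : 0 ≤ x ^ 3 := by positivity
    nlinarith
  have h5 : (1 - 2 * x) * (-log (1 - x)) ≤ (1 - 2 * x) * (x + x ^ 2) :=
    mul_le_mul_of_nonneg_left hlog1 (by linarith)
  have hx3 : 0 ≤ x ^ 3 := by positivity
  rw [Real.rpow_def_of_pos hρ, ← exp_add]
  calc exp ((2 * (1 - (1 - x))) ^ 2 / 16 + log (1 - x) * -(1 - 2 * (1 - (1 - x))))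
      ≤ exp (log (1 + x)) := by
        refine exp_le_exp.2 ?_
        have h6 : log (1 - x) * -(1 - 2 * (1 - (1 - x))) = (1 - 2 * x) * (-log (1 - x)) := by ring
        rw [h6]
        nlinarith
    _ = 2 - (1 - x) := by rw [exp_log (by linarith)]; ring

/-- Weighted Hölder inequality on the cube, in normalized form. -/
lemma cubeMean_exp_interpolate {f g : (ι → Bool) → ℝ} {F G l : ℝ} (hF : 0 < F) (hG : 0 < G)
    (hl0 : 0 ≤ l) (hl1 : l ≤ 1) (hf : cubeMean (fun x => exp (f x)) ≤ F)
    (hg : cubeMean (fun x => exp (g x)) ≤ G) :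
    cubeMean (fun x => exp ((1 - l) * f x + l * g x)) ≤ F ^ (1 - l) * G ^ l := by
  have hpt : ∀ x, exp ((1 - l) * f x + l * g x) ≤
      (F ^ (1 - l) * G ^ l) * ((1 - l) / F * exp (f x) + l / G * exp (g x)) := by
    intro x
    have h1 := Real.geom_mean_le_arith_mean2_weighted (sub_nonneg.2 hl1) hl0
      (div_nonneg (exp_pos (f x)).le hF.le) (div_nonneg (exp_pos (g x)).le hG.le) (by ring)
    rw [Real.div_rpow (exp_pos _).le hF.le, Real.div_rpow (exp_pos _).le hG.le, ← Real.exp_mul,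
      ← Real.exp_mul, div_mul_div_comm, ← exp_add, div_le_iff₀ (by positivity)] at h1
    calc exp ((1 - l) * f x + l * g x) = exp (f x * (1 - l) + g x * l) := by ring_nf
      _ ≤ _ := h1
      _ = _ := by ring
  refine (cubeMean_mono hpt).trans ?_
  rw [cubeMean_const_mul, cubeMean_add, cubeMean_const_mul, cubeMean_const_mul]
  have h2 : (1 - l) / F * cubeMean (fun x => exp (f x)) ≤ (1 - l) / F * F :=
    mul_le_mul_of_nonneg_left hf (div_nonneg (by linarith) hF.le)
  have h3 : l / G * cubeMean (fun x => exp (g x)) ≤ l / G * G :=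
    mul_le_mul_of_nonneg_left hg (div_nonneg hl0 hG.le)
  have h4 : (1 - l) / F * F + l / G * G = 1 := by field_simp; ring
  have h5 : 0 ≤ F ^ (1 - l) * G ^ l := by positivity
  nlinarith

end CubeConcentration

/-- The proportion of vertices of the cube `{-1, 1}^ι` lying in a set. -/
def cubeProb {ι : Type*} [Fintype ι] [DecidableEq ι] (A : Set (ι → ℝ)) : ℝ :=
  cubeMean fun x : ι → Bool => A.indicator (fun _ => (1 : ℝ)) fun i => boolSign (x i)

lemma cubeProb_nonneg {ι : Type*} [Fintype ι] [DecidableEq ι] (A : Set (ι → ℝ)) :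
    0 ≤ cubeProb A :=
  cubeMean_nonneg fun _ => Set.indicator_nonneg (fun _ _ => zero_le_one) _

lemma nonempty_of_cubeProb_pos {ι : Type*} [Fintype ι] [DecidableEq ι] {A : Set (ι → ℝ)}
    (h : 0 < cubeProb A) : A.Nonempty := by
  by_contra hA
  rw [Set.not_nonempty_iff_eq_empty] at hA
  simp [cubeProb, hA, cubeMean] at h

lemma cubeMean_succ_bool {N : ℕ} (f : (Fin (N + 1) → Bool) → ℝ) (b : Bool) :
    cubeMean f = (cubeMean (fun x : Fin N → Bool => f (Fin.cons b x)) +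
      cubeMean (fun x : Fin N → Bool => f (Fin.cons (!b) x))) / 2 := by
  rw [cubeMean_succ]
  cases b
  · simp [add_comm]
  · simp

lemma sq_boolSign_sub (b : Bool) : (boolSign (!b) - boolSign b) ^ 2 = 4 := by
  cases b <;> norm_num

lemma cubeProb_succ {N : ℕ} (A : Set (Fin (N + 1) → ℝ)) (b : Bool) :
    cubeProb A = (cubeProb {y : Fin N → ℝ | (Fin.cons (boolSign b) y : Fin (N + 1) → ℝ) ∈ A} +
      cubeProb {y : Fin N → ℝ | (Fin.cons (boolSign (!b)) y : Fin (N + 1) → ℝ) ∈ A}) / 2 := by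
  have key : ∀ (c : Bool) (x : Fin N → Bool),
      (fun i => boolSign ((Fin.cons c x : Fin (N + 1) → Bool) i)) =
        (Fin.cons (boolSign c) (fun i => boolSign (x i)) : Fin (N + 1) → ℝ) := by
    intro c x
    ext i
    refine Fin.cases ?_ (fun j => ?_) i <;> simp
  unfold cubeProb
  rw [cubeMean_succ_bool _ b]
  simp only [key]
  rfl

lemma convex_cons_section {N : ℕ} {A : Set (Fin (N + 1) → ℝ)} (hA : Convex ℝ A) (s : ℝ) :
    Convex ℝ {y : Fin N → ℝ | (Fin.cons s y : Fin (N + 1) → ℝ) ∈ A} := by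
  intro y hy z hz a c ha hc hac
  have h := hA hy hz ha hc hac
  have e : (Fin.cons s (a • y + c • z) : Fin (N + 1) → ℝ) =
      a • (Fin.cons s y : Fin (N + 1) → ℝ) + c • (Fin.cons s z : Fin (N + 1) → ℝ) := by
    ext i
    refine Fin.cases ?_ (fun j => ?_) i
    · simp [← add_mul, hac]
    · simp
  change (Fin.cons s (a • y + c • z) : Fin (N + 1) → ℝ) ∈ A
  rwa [e]

lemma sum_sq_sub_convex_le {N : ℕ} (x y z : Fin N → ℝ) {l : ℝ} (h0 : 0 ≤ l) (h1 : l ≤ 1) :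
    ∑ i, (x i - ((1 - l) * y i + l * z i)) ^ 2 ≤
      (1 - l) * ∑ i, (x i - y i) ^ 2 + l * ∑ i, (x i - z i) ^ 2 := by
  rw [Finset.mul_sum, Finset.mul_sum, ← Finset.sum_add_distrib]
  refine Finset.sum_le_sum fun i _ => ?_
  nlinarith [mul_nonneg (mul_nonneg h0 (sub_nonneg.2 h1)) (sq_nonneg (y i - z i))]

lemma talagrand_fin {N : ℕ} {A : Set (Fin N → ℝ)} (hA : Convex ℝ A) (D : (Fin N → Bool) → ℝ)
    (hD : ∀ x, ∀ y ∈ A, D x ≤ ∑ i, (boolSign (x i) - y i) ^ 2) :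
    cubeMean (fun x => exp (D x / 64)) * cubeProb A ≤ 1 := by
  induction N with
  | zero =>
    have hm : ∀ f : (Fin 0 → Bool) → ℝ, cubeMean f = f default := fun f => by
      simp only [cubeMean, Finset.univ_unique, Finset.sum_singleton, Fintype.card_fin, pow_zero,
        div_one]
      exact congrArg f (Subsingleton.elim _ _)
    rw [cubeProb, hm, hm]
    by_cases h : (fun i : Fin 0 => boolSign ((default : Fin 0 → Bool) i)) ∈ A
    · have h2 := hD default _ h
      rw [Finset.univ_eq_empty, Finset.sum_empty] at h2
      rw [Set.indicator_of_mem h, mul_one, exp_le_one_iff]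
      linarith
    · rw [Set.indicator_of_notMem h, mul_zero]
      exact zero_le_one
  | succ N ih =>
    set P : Bool → Set (Fin N → ℝ) :=
      fun c => {y : Fin N → ℝ | (Fin.cons (boolSign c) y : Fin (N + 1) → ℝ) ∈ A} with hP
    set E : Bool → (Fin N → Bool) → ℝ := fun c x => ⨅ y : P c, ∑ i, (boolSign (x i) - y.1 i) ^ 2
      with hE
    have hEle : ∀ c x, ∀ y ∈ P c, E c x ≤ ∑ i, (boolSign (x i) - y i) ^ 2 := fun c x y hy =>
      ciInf_le (f := fun y : P c => ∑ i, (boolSign (x i) - y.1 i) ^ 2)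
        ⟨0, by rintro _ ⟨z, rfl⟩; positivity⟩ ⟨y, hy⟩
    have hind : ∀ c, cubeMean (fun x => exp (E c x / 64)) * cubeProb (P c) ≤ 1 := fun c =>
      ih (convex_cons_section hA _) _ (hEle c)
    obtain ⟨b, hb⟩ : ∃ b, cubeProb (P (!b)) ≤ cubeProb (P b) := by
      rcases le_total (cubeProb (P true)) (cubeProb (P false)) with h | h
      · exact ⟨false, h⟩
      · exact ⟨true, h⟩
    have hpA : cubeProb A = (cubeProb (P b) + cubeProb (P (!b))) / 2 := cubeProb_succ A b
    rcases (cubeProb_nonneg (P b)).eq_or_lt with h0 | h0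
    · have : cubeProb A = 0 := by
        have := cubeProb_nonneg (P (!b))
        linarith
      rw [this, mul_zero]; exact zero_le_one
    have : Nonempty (P b) := (nonempty_of_cubeProb_pos h0).to_subtype
    set p := cubeProb (P b) with hp
    set ρ := cubeProb (P (!b)) / p with hρ
    have hρp : cubeProb (P (!b)) = ρ * p := by rw [hρ]; field_simp
    have hρ1 : ρ ≤ 1 := by rw [hρ, div_le_one h0]; exact hb
    have hρ0 : 0 ≤ ρ := div_nonneg (cubeProb_nonneg _) h0.le
    have hGb : cubeMean (fun x => exp (E b x / 64)) ≤ 1 / p := by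
      rw [le_div_iff₀ h0]; exact hind b
    have hsame : ∀ x, D (Fin.cons b x) ≤ E b x := fun x => le_ciInf fun y => by
      refine (hD _ _ y.2).trans (le_of_eq ?_)
      simp [Fin.sum_univ_succ]
    have h1 : cubeMean (fun x => exp (D (Fin.cons b x) / 64)) ≤ 1 / p :=
      (cubeMean_mono fun x => exp_le_exp.2 (by have := hsame x; linarith)).trans hGb
    suffices h2 : cubeMean (fun x => exp (D (Fin.cons (!b) x) / 64)) ≤ 1 / p * (2 - ρ) by
      rw [cubeMean_succ_bool _ b, hpA, hρp]
      calc _ ≤ ((1 / p + 1 / p * (2 - ρ)) / 2) * ((p + ρ * p) / 2) := by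
            gcongr
        _ = (3 - ρ) * (1 + ρ) / 4 := by field_simp; ring
        _ ≤ 1 := by nlinarith [sq_nonneg (1 - ρ)]
    rcases le_or_gt (1 / 2) ρ with hh | hh
    · have hq0 : 0 < cubeProb (P (!b)) := by rw [hρp]; positivity
      have : Nonempty (P (!b)) := (nonempty_of_cubeProb_pos hq0).to_subtype
      set l := 2 * (1 - ρ) with hl
      have hl0 : 0 ≤ l := by linarith
      have hl1 : l ≤ 1 := by linarith
      have hother : ∀ x, D (Fin.cons (!b) x) ≤ (1 - l) * E (!b) x + l * E b x + 4 * l ^ 2 := by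
        intro x
        have hyz : ∀ (y : P (!b)) (z : P b), D (Fin.cons (!b) x) - 4 * l ^ 2 ≤
            (1 - l) * ∑ i, (boolSign (x i) - y.1 i) ^ 2 +
              l * ∑ i, (boolSign (x i) - z.1 i) ^ 2 := by
          intro y z
          have hm := hA y.2 z.2 (sub_nonneg.2 hl1) hl0 (by ring)
          have h := hD (Fin.cons (!b) x) _ hm
          rw [Fin.sum_univ_succ] at h
          simp only [Fin.cons_zero, Fin.cons_succ, Pi.add_apply, Pi.smul_apply, smul_eq_mul] at h
          have h' := sum_sq_sub_convex_le (fun i => boolSign (x i)) y.1 z.1 hl0 hl1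
          have e : (boolSign (!b) - ((1 - l) * boolSign (!b) + l * boolSign b)) ^ 2 =
              l ^ 2 * (boolSign (!b) - boolSign b) ^ 2 := by ring
          rw [e, sq_boolSign_sub] at h
          linarith
        have e1 : ∀ z : P b, D (Fin.cons (!b) x) - 4 * l ^ 2 ≤
            (1 - l) * E (!b) x + l * ∑ i, (boolSign (x i) - z.1 i) ^ 2 := by
          intro z
          change _ ≤ (1 - l) * (⨅ y : P (!b), ∑ i, (boolSign (x i) - y.1 i) ^ 2) + _
          rw [Real.mul_iInf_of_nonneg (sub_nonneg.2 hl1)]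
          rw [← sub_le_iff_le_add]
          exact le_ciInf fun y => by linarith [hyz y z]
        have e2 : D (Fin.cons (!b) x) - 4 * l ^ 2 ≤ (1 - l) * E (!b) x + l * E b x := by
          change _ ≤ _ + l * (⨅ y : P b, ∑ i, (boolSign (x i) - y.1 i) ^ 2)
          rw [Real.mul_iInf_of_nonneg hl0, ← sub_le_iff_le_add']
          exact le_ciInf fun z => by linarith [e1 z]
        linarith
      have hGo : cubeMean (fun x => exp (E (!b) x / 64)) ≤ 1 / (ρ * p) := by
        rw [le_div_iff₀ (by rw [← hρp]; exact hq0), ← hρp]; exact hind _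
      have hρ0' : 0 < ρ := by linarith
      have hint := cubeMean_exp_interpolate (f := fun x => E (!b) x / 64)
        (g := fun x => E b x / 64) (by positivity) (by positivity) hl0 hl1 hGo hGb
      calc _ ≤ cubeMean (fun x => exp (l ^ 2 / 16) *
              exp ((1 - l) * (E (!b) x / 64) + l * (E b x / 64))) := by
            refine cubeMean_mono fun x => ?_
            rw [← exp_add, exp_le_exp]
            linarith [hother x]
        _ = exp (l ^ 2 / 16) * _ := cubeMean_const_mul _ _
        _ ≤ exp (l ^ 2 / 16) * ((1 / (ρ * p)) ^ (1 - l) * (1 / p) ^ l) := by gcongr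
        _ = 1 / p * (exp (l ^ 2 / 16) * ρ ^ (-(1 - l))) := by
            have : (1 / (ρ * p)) ^ (1 - l) = ρ ^ (-(1 - l)) * (1 / p) ^ (1 - l) := by
              rw [one_div, mul_inv, ← one_div p, Real.mul_rpow (by positivity)
                (by positivity), Real.rpow_neg hρ0, Real.inv_rpow hρ0]
            rw [this, mul_assoc, ← Real.rpow_add (by positivity)]
            simp; ring
        _ ≤ _ := by
            gcongr
            exact exp_mul_rpow_le hh hρ1
    · have hother : ∀ x, D (Fin.cons (!b) x) ≤ E b x + 4 := fun x => by
        rw [← sub_le_iff_le_add]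
        refine le_ciInf fun y => ?_
        have h := hD (Fin.cons (!b) x) _ y.2
        simp only [Fin.sum_univ_succ, Fin.cons_zero, Fin.cons_succ, sq_boolSign_sub] at h
        linarith
      have he : exp (1 / 16) ≤ 3 / 2 := by
        have h := Real.exp_bound_div_one_sub_of_interval (x := 1 / 16) (by norm_num) (by norm_num)
        norm_num at h ⊢
        linarith
      calc _ ≤ cubeMean (fun x => exp (1 / 16) * exp (E b x / 64)) := by
            refine cubeMean_mono fun x => ?_
            rw [← exp_add, exp_le_exp]
            linarith [hother x]
        _ = exp (1 / 16) * _ := cubeMean_const_mul _ _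
        _ ≤ 3 / 2 * (1 / p) :=
            mul_le_mul he hGb (cubeMean_nonneg fun _ => (exp_pos _).le) (by norm_num)
        _ ≤ _ := by
            rw [mul_comm]
            gcongr
            linarith

/-- Talagrand's convex distance inequality on the discrete cube. -/
lemma talagrand_cube {ι : Type*} [Fintype ι] [DecidableEq ι] {A : Set (ι → ℝ)}
    (hA : Convex ℝ A) (D : (ι → Bool) → ℝ)
    (hD : ∀ x, ∀ y ∈ A, D x ≤ ∑ i, (boolSign (x i) - y i) ^ 2) :
    cubeMean (fun x => exp (D x / 64)) * cubeProb A ≤ 1 := by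
  let e := Fintype.equivFin ι
  have h := talagrand_fin (A := (fun y : Fin (Fintype.card ι) → ℝ => y ∘ e) ⁻¹' A)
    (hA.is_linear_preimage ⟨fun _ _ => rfl, fun _ _ => rfl⟩)
    (fun x => D (x ∘ e)) (fun x y hy => by
      refine (hD _ _ hy).trans (le_of_eq ?_)
      exact Fintype.sum_equiv e _ _ fun i => rfl)
  rw [cubeMean_equiv e (fun x => exp (D x / 64))] at h
  have e2 : cubeProb ((fun y : Fin (Fintype.card ι) → ℝ => y ∘ e) ⁻¹' A) = cubeProb A := by
    unfold cubeProb
    rw [← cubeMean_equiv e]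
    rfl
  rwa [e2] at h

/-- A convex Lipschitz function on the cube with large `q`-th moment is rarely small. -/
lemma cubeProb_le_of_convexOn {ι : Type*} [Fintype ι] [DecidableEq ι] {F : (ι → ℝ) → ℝ}
    (hF : ConvexOn ℝ Set.univ F) (h0 : ∀ x, 0 ≤ F x) {S D : ℝ} (hS : 0 < S)
    (hL : ∀ x y, F x ≤ F y + S * √(∑ i, (x i - y i) ^ 2)) {q : ℕ} (hq : 1 ≤ q)
    (hD : 126 * √q * S ≤ D)
    (hm : D ^ q ≤ cubeMean (fun x : ι → Bool => F (fun i => boolSign (x i)) ^ q)) :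
    cubeProb {y | F y ≤ D / 4} ≤ exp (-(16 * q)) := by
  have hq0 : (0 : ℝ) < q := by exact_mod_cast hq
  have hsq : 0 < √(q : ℝ) := by positivity
  have hD0 : 0 < D := lt_of_lt_of_le (by positivity) hD
  set α := cubeProb {y | F y ≤ D / 4} with hα
  rcases (cubeProb_nonneg {y | F y ≤ D / 4}).eq_or_lt with hα0 | hα0
  · rw [hα, ← hα0]; positivity
  set d : (ι → Bool) → ℝ := fun x => max 0 ((F (fun i => boolSign (x i)) - D / 4) / S) with hd
  have hd0 : ∀ x, 0 ≤ d x := fun x => le_max_left _ _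
  have hconv : Convex ℝ {y | F y ≤ D / 4} := by
    have := hF.convex_le (D / 4)
    simpa using this
  have htal := talagrand_cube hconv (fun x => d x ^ 2) (fun x y hy => by
    have h1 : d x ≤ √(∑ i, (boolSign (x i) - y i) ^ 2) := by
      refine max_le (by positivity) ?_
      rw [div_le_iff₀ hS]
      have h2 := hL (fun i => boolSign (x i)) y
      have h3 : F y ≤ D / 4 := hy
      linarith
    calc d x ^ 2 ≤ (√(∑ i, (boolSign (x i) - y i) ^ 2)) ^ 2 := by
          gcongr
      _ = _ := Real.sq_sqrt (by positivity))
  rw [← le_div_iff₀ hα0] at htal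
  have hint := cubeMean_exp_interpolate (f := fun x => d x ^ 2 / 64)
    (g := fun _ => 0) (l := 15 / 16) (F := 1 / α) (G := 1) (by positivity) one_pos (by norm_num)
    (by norm_num) htal (by simp [cubeMean_const])
  have hFd : ∀ x, F (fun i => boolSign (x i)) ^ q ≤
      D ^ q / 2 + (2 * S * √(512 * q)) ^ q / 2 *
        exp ((1 - 15 / 16) * (d x ^ 2 / 64) + 15 / 16 * 0) := by
    intro x
    have h1 : F (fun i => boolSign (x i)) ≤ D / 4 + S * d x := by
      have h2 : (F (fun i => boolSign (x i)) - D / 4) / S ≤ d x := le_max_right _ _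
      rw [div_le_iff₀ hS] at h2
      linarith
    have h3 : d x ^ q ≤ √(512 * q) ^ q * exp (d x ^ 2 / 1024) := by
      have h4 := rpow_le_mul_exp (x := d x ^ 2) (c := 1024) (q := q / 2) (by positivity)
        (by norm_num) (by positivity)
      have e1 : (d x ^ 2) ^ ((q : ℝ) / 2) = d x ^ q := by
        rw [← Real.rpow_natCast (d x) 2, ← Real.rpow_mul (hd0 x), ← Real.rpow_natCast]
        congr 1; push_cast; ring
      have e2 : (1024 * ((q : ℝ) / 2)) ^ ((q : ℝ) / 2) = √(512 * q) ^ q := by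
        rw [Real.sqrt_eq_rpow, ← Real.rpow_natCast, ← Real.rpow_mul (by positivity)]
        congr 1 <;> ring
      rwa [e1, e2] at h4
    have h5 : (D / 4 + S * d x) ^ q ≤ 2 ^ (q - 1) * ((D / 4) ^ q + (S * d x) ^ q) :=
      add_pow_le (by positivity) (mul_nonneg hS.le (hd0 x)) q
    have h6 : (2 : ℝ) ^ (q - 1) = 2 ^ q / 2 := by
      obtain ⟨k, rfl⟩ : ∃ k, q = k + 1 := ⟨q - 1, by omega⟩
      simp [pow_succ]
    calc F (fun i => boolSign (x i)) ^ q ≤ (D / 4 + S * d x) ^ q := by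
          gcongr
          exact h0 _
      _ ≤ 2 ^ q / 2 * ((D / 4) ^ q + (S * d x) ^ q) := by rw [← h6]; exact h5
      _ = (D / 2) ^ q / 2 + (2 * S) ^ q / 2 * d x ^ q := by
          rw [mul_pow S, mul_pow 2 S, show D / 2 = 2 * (D / 4) by ring, mul_pow 2 (D / 4)]; ring
      _ ≤ D ^ q / 2 + (2 * S) ^ q / 2 * (√(512 * q) ^ q * exp (d x ^ 2 / 1024)) := by
          gcongr
          linarith
      _ = _ := by
          rw [mul_pow (2 * S)]
          have : (1 - 15 / 16) * (d x ^ 2 / 64) + 15 / 16 * 0 = d x ^ 2 / 1024 := by ring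
          rw [this]; ring
  have hmain := hm.trans (cubeMean_mono hFd)
  rw [cubeMean_add, cubeMean_const, cubeMean_const_mul] at hmain
  have h7 : D ^ q ≤ (2 * S * √(512 * q)) ^ q * (1 / α) ^ ((1 : ℝ) / 16) := by
    have h8 := mul_le_mul_of_nonneg_left hint
      (show 0 ≤ (2 * S * √(512 * q)) ^ q / 2 by positivity)
    rw [Real.one_rpow, mul_one] at h8
    have : (1 : ℝ) - 15 / 16 = 1 / 16 := by norm_num
    rw [this] at h8 hmain
    linarith
  have h9 : 2 * S * √(512 * q) ≤ D * exp (-1) := by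
    have e3 : √(512 * q) ≤ 22.63 * √q := by
      rw [Real.sqrt_mul (by norm_num)]
      gcongr
      rw [Real.sqrt_le_left (by norm_num)]
      norm_num
    have e4 : (0.36 : ℝ) ≤ exp (-1) := by
      rw [Real.exp_neg, le_inv_comm₀ (by norm_num) (exp_pos _)]
      have := Real.exp_one_lt_d9
      norm_num at this ⊢
      linarith
    calc 2 * S * √(512 * q) ≤ 2 * S * (22.63 * √q) := by gcongr
      _ ≤ (126 * √q * S) * 0.36 := by nlinarith [mul_pos hS hsq]
      _ ≤ D * exp (-1) := by gcongr
  have h10 : D ^ q ≤ D ^ q * (exp (-q) * (1 / α) ^ ((1 : ℝ) / 16)) := by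
    refine h7.trans ?_
    rw [← mul_assoc]
    have : D ^ q * exp (-q) = (D * exp (-1)) ^ q := by
      rw [mul_pow, ← Real.exp_nat_mul]; simp
    rw [this]
    gcongr
  have h11 : 1 ≤ exp (-q) * (1 / α) ^ ((1 : ℝ) / 16) :=
    le_of_mul_le_mul_left (by linarith) (show 0 < D ^ q by positivity)
  have h12 : α ^ ((1 : ℝ) / 16) ≤ exp (-q) := by
    rw [Real.div_rpow zero_le_one hα0.le, Real.one_rpow, mul_one_div, le_div_iff₀ (by positivity)]
      at h11
    linarith
  calc α = (α ^ ((1 : ℝ) / 16)) ^ 16 := by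
        rw [← Real.rpow_natCast, ← Real.rpow_mul hα0.le]
        norm_num [hα]
    _ ≤ exp (-q) ^ 16 := by gcongr
    _ = exp (-(16 * q)) := by rw [← Real.exp_nat_mul]; congr 1; push_cast; ring

/-- Packing bound: a set all of whose points carry `r`-balls of measure at least `m` has a
`2 * r`-net with at most `M / m` points. -/
lemma exists_finset_net {X : Type*} [MetricSpace X] [MeasurableSpace X] [BorelSpace X]
    (μ : Measure X) {A U : Set X} {r m M : ℝ} (hm : 0 < m)
    (h1 : ∀ x ∈ A, m ≤ μ.real (Metric.closedBall x r))
    (h2 : ∀ x ∈ A, Metric.closedBall x r ⊆ U) (hU : μ U ≠ ∞) (hM : μ.real U ≤ M) :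
    ∃ s : Finset X, ↑s ⊆ A ∧ s.card * m ≤ M ∧ ∀ x ∈ A, ∃ y ∈ s, dist x y ≤ 2 * r := by
  classical
  let good : Finset X → Prop := fun s => ↑s ⊆ A ∧ (s : Set X).Pairwise fun x y => 2 * r < dist x y
  have hcard : ∀ s, good s → s.card * m ≤ M := by
    intro s hs
    have hdis : (s : Set X).PairwiseDisjoint fun x => Metric.closedBall x r := by
      intro x hx y hy hxy
      refine Set.disjoint_left.2 fun z hzx hzy => ?_
      have := hs.2 hx hy hxy
      have := dist_triangle_left x y z
      rw [Metric.mem_closedBall] at hzx hzy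
      linarith
    calc s.card * m = ∑ _x ∈ s, m := by simp
      _ ≤ ∑ x ∈ s, μ.real (Metric.closedBall x r) := Finset.sum_le_sum fun x hx => h1 x (hs.1 hx)
      _ = μ.real (⋃ x ∈ s, Metric.closedBall x r) :=
          (measureReal_biUnion_finset hdis (fun _ _ => measurableSet_closedBall)
            (fun x hx => ne_top_of_le_ne_top hU (measure_mono (h2 x (hs.1 hx))))).symm
      _ ≤ μ.real U := measureReal_mono (Set.iUnion₂_subset fun x hx => h2 x (hs.1 hx)) hU
      _ ≤ M := hM
  have hbdd : BddAbove {k : ℕ | ∃ s, good s ∧ s.card = k} := by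
    refine ⟨⌊M / m⌋₊, ?_⟩
    rintro k ⟨s, hs, rfl⟩
    exact Nat.le_floor ((le_div_iff₀ hm).2 (hcard s hs))
  have hne : {k : ℕ | ∃ s, good s ∧ s.card = k}.Nonempty := ⟨0, ∅, by simp [good], rfl⟩
  obtain ⟨s, hs, hsk⟩ := Nat.sSup_mem hne hbdd
  refine ⟨s, hs.1, hcard s hs, fun x hx => ?_⟩
  by_contra! hcon
  have hxs : x ∉ s := fun h => by
    have h3 := hcon x h
    have h4 := h1 x hx
    rw [dist_self] at h3
    have : Metric.closedBall x r = ∅ := Metric.closedBall_eq_empty.2 (by linarith)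
    rw [this] at h4
    simp at h4
    linarith
  have hg : good (insert x s) := by
    refine ⟨?_, ?_⟩
    · rw [Finset.coe_insert]
      exact Set.insert_subset hx hs.1
    · rw [Finset.coe_insert]
      exact Set.pairwise_insert.2
        ⟨hs.2, fun y hy _ => ⟨hcon y hy, by rw [dist_comm]; exact hcon y hy⟩⟩
  have := le_csSup hbdd ⟨_, hg, rfl⟩
  rw [Finset.card_insert_of_notMem hxs, ← hsk] at this
  omega

lemma volume_real_closedBall {k : ℕ} (x : EuclideanSpace ℝ (Fin k)) {r : ℝ} (hr : 0 ≤ r) :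
    (volume : Measure (EuclideanSpace ℝ (Fin k))).real (Metric.closedBall x r) =
      r ^ k * (volume : Measure (EuclideanSpace ℝ (Fin k))).real (Metric.ball 0 1) := by
  rw [Measure.real, Measure.addHaar_closedBall _ _ hr, ENNReal.toReal_mul,
    ENNReal.toReal_ofReal (by positivity)]
  simp [Measure.real]

lemma exists_sphere_net {k : ℕ} {η : ℝ} (hη : 0 < η) :
    ∃ s : Finset (EuclideanSpace ℝ (Fin k)), (∀ x ∈ s, ‖x‖ = 1) ∧
      (s.card : ℝ) ≤ (1 + 2 / η) ^ k ∧
      ∀ x : EuclideanSpace ℝ (Fin k), ‖x‖ = 1 → ∃ y ∈ s, ‖x - y‖ ≤ η := by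
  set V := (volume : Measure (EuclideanSpace ℝ (Fin k))).real (Metric.ball 0 1) with hV
  have hV0 : 0 < V := ENNReal.toReal_pos (Metric.measure_ball_pos _ _ one_pos).ne'
    measure_ball_lt_top.ne
  have hvol : ∀ (x : EuclideanSpace ℝ (Fin k)) {r : ℝ}, 0 ≤ r →
      (volume : Measure (EuclideanSpace ℝ (Fin k))).real (Metric.closedBall x r) = r ^ k * V :=
    fun x _ hr => volume_real_closedBall x hr
  obtain ⟨s, h1, h2, h3⟩ := exists_finset_net (A := Metric.sphere 0 1)
    (U := Metric.closedBall 0 (1 + η / 2)) (r := η / 2) (m := (η / 2) ^ k * V)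
    (M := (1 + η / 2) ^ k * V) (volume : Measure (EuclideanSpace ℝ (Fin k))) (by positivity)
    (fun x _ => (hvol x (by positivity)).ge)
    (fun x hx => Metric.closedBall_subset_closedBall' (by
      rw [Metric.mem_sphere.1 hx]; linarith))
    measure_closedBall_lt_top.ne (hvol 0 (by positivity)).le
  refine ⟨s, fun x hx => by simpa using h1 hx, ?_, fun x hx => ?_⟩
  · rw [← mul_assoc] at h2
    have h4 := le_of_mul_le_mul_right h2 hV0
    have e : (1 + 2 / η) ^ k = (1 + η / 2) ^ k / (η / 2) ^ k := by
      rw [← div_pow]; congr 1; field_simp; ring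
    rw [e, le_div_iff₀ (by positivity)]
    exact h4
  · obtain ⟨y, hy, hxy⟩ := h3 x (by simpa using hx)
    exact ⟨y, hy, by rw [← dist_eq_norm]; linarith⟩

/-- The `L^q` norm of the linear functional `⟪v, ·⟫`. -/
def marginalNorm {E : Type*} [NormedAddCommGroup E] [InnerProductSpace ℝ E] [MeasurableSpace E]
    (ν : Measure E) (q : ℕ) (v : E) : ℝ :=
  (eLpNorm (fun w => ⟪v, w⟫) q ν).toReal

section MarginalNorm

variable {E : Type*} [NormedAddCommGroup E] [InnerProductSpace ℝ E] [MeasurableSpace E]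
  {ν : Measure E} {q : ℕ}

lemma marginalNorm_nonneg (v : E) : 0 ≤ marginalNorm ν q v := ENNReal.toReal_nonneg

lemma marginalNorm_smul (c : ℝ) (v : E) : marginalNorm ν q (c • v) = |c| * marginalNorm ν q v := by
  unfold marginalNorm
  simp only [real_inner_smul_left]
  have := eLpNorm_const_smul c (fun w => ⟪v, w⟫) q ν
  simp only [Pi.smul_def, smul_eq_mul] at this
  rw [this]
  simp

variable [BorelSpace E] [SecondCountableTopology E]

lemma integrable_abs_inner_pow (hi : Integrable (fun w => ‖w‖ ^ q) ν) (v : E) :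
    Integrable (fun w => |⟪v, w⟫| ^ q) ν := by
  refine (hi.const_mul (‖v‖ ^ q)).mono' (by fun_prop) (.of_forall fun w => ?_)
  rw [Real.norm_of_nonneg (by positivity), ← mul_pow]
  gcongr
  exact abs_real_inner_le_norm v w

lemma memLp_inner (hq : 1 ≤ q) (hi : Integrable (fun w => ‖w‖ ^ q) ν) (v : E) :
    MemLp (fun w => ⟪v, w⟫) q ν := by
  rw [← integrable_norm_rpow_iff (by fun_prop) (by simp; omega) (by simp)]
  simpa using integrable_abs_inner_pow hi v

lemma marginalNorm_pow (hq : 1 ≤ q) (hi : Integrable (fun w => ‖w‖ ^ q) ν) (v : E) :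
    marginalNorm ν q v ^ q = ∫ w, |⟪v, w⟫| ^ q ∂ν := by
  have hq0 : (q : ℝ) ≠ 0 := by positivity
  unfold marginalNorm
  rw [(memLp_inner hq hi v).eLpNorm_eq_integral_rpow_norm (by simp; omega) (by simp),
    ENNReal.toReal_ofReal (by positivity), ← Real.rpow_natCast, ← Real.rpow_mul (by positivity)]
  simp [hq0]

lemma marginalNorm_add_le (hq : 1 ≤ q) (hi : Integrable (fun w => ‖w‖ ^ q) ν) (u v : E) :
    marginalNorm ν q (u + v) ≤ marginalNorm ν q u + marginalNorm ν q v := by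
  unfold marginalNorm
  rw [← ENNReal.toReal_add (memLp_inner hq hi u).eLpNorm_ne_top
    (memLp_inner hq hi v).eLpNorm_ne_top]
  refine ENNReal.toReal_mono (ENNReal.add_ne_top.2 ⟨(memLp_inner hq hi u).eLpNorm_ne_top,
    (memLp_inner hq hi v).eLpNorm_ne_top⟩) ?_
  simp only [inner_add_left]
  exact eLpNorm_add_le (by fun_prop) (by fun_prop) (by exact_mod_cast hq)

lemma marginalNorm_le (hq : 1 ≤ q) (hi : Integrable (fun w => ‖w‖ ^ q) ν) {S : ℝ} (hS : 0 ≤ S)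
    (h : ∀ v, ∫ w, |⟪v, w⟫| ^ q ∂ν ≤ (S * ‖v‖) ^ q) (v : E) :
    marginalNorm ν q v ≤ S * ‖v‖ := by
  refine le_of_pow_le_pow_left₀ (n := q) (by omega) (by positivity) ?_
  rw [marginalNorm_pow hq hi]
  exact h v

end MarginalNorm

/-- A subadditive homogeneous function bounded on a `1/2`-net of the sphere is bounded on the
sphere. -/
lemma le_of_le_on_half_net {E : Type*} [NormedAddCommGroup E] [NormedSpace ℝ E] {g : E → ℝ}
    (hadd : ∀ x y, g (x + y) ≤ g x + g y) (hsmul : ∀ (c : ℝ) x, g (c • x) = |c| * g x)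
    {B : ℝ} (hB : ∀ x, g x ≤ B * ‖x‖) {s : Finset E} {a : ℝ} (ha : ∀ y ∈ s, g y ≤ a)
    (hs : ∀ x : E, ‖x‖ = 1 → ∃ y ∈ s, ‖x - y‖ ≤ 1 / 2) (hg : ∀ x, 0 ≤ g x) (x : E) :
    g x ≤ 2 * a * ‖x‖ := by
  rcases eq_or_ne x 0 with rfl | hx
  · have := hsmul 0 0
    simp at this
    simp [this]
  set M := sSup (g '' Metric.sphere 0 1) with hM
  have hbdd : BddAbove (g '' Metric.sphere 0 1) := by
    refine ⟨B, ?_⟩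
    rintro _ ⟨y, hy, rfl⟩
    have := hB y
    rwa [mem_sphere_zero_iff_norm.1 hy, mul_one] at this
  have hnorm : ∀ y : E, y ≠ 0 → g y = ‖y‖ * g (‖y‖⁻¹ • y) ∧ ‖‖y‖⁻¹ • y‖ = 1 := by
    intro y hy
    have hy' : ‖y‖ ≠ 0 := norm_ne_zero_iff.2 hy
    constructor
    · rw [hsmul, abs_of_nonneg (by positivity), ← mul_assoc, mul_inv_cancel₀ hy', one_mul]
    · rw [norm_smul]; simp [hy']
  have hle : ∀ y, g y ≤ M * ‖y‖ := by
    intro y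
    rcases eq_or_ne y 0 with rfl | hy
    · have := hsmul 0 0
      simp at this
      simp [this]
    · obtain ⟨h1, h2⟩ := hnorm y hy
      rw [h1, mul_comm]
      gcongr
      exact le_csSup hbdd ⟨_, mem_sphere_zero_iff_norm.2 h2, rfl⟩
  have hM2 : M ≤ a + M / 2 := by
    refine csSup_le ⟨_, _, mem_sphere_zero_iff_norm.2 (hnorm x hx).2, rfl⟩ ?_
    rintro _ ⟨z, hz, rfl⟩
    obtain ⟨y, hy, hzy⟩ := hs z (mem_sphere_zero_iff_norm.1 hz)
    have h1 := hadd y (z - y)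
    rw [add_sub_cancel] at h1
    have h2 := hle (z - y)
    have hM0 : 0 ≤ M := (hg z).trans (le_csSup hbdd ⟨z, hz, rfl⟩)
    nlinarith [ha y hy]
  refine (hle x).trans ?_
  gcongr
  linarith

lemma cubeMean_integral {ι : Type*} [Fintype ι] [DecidableEq ι] {E : Type*} [MeasurableSpace E]
    {ν : Measure E} {f : (ι → Bool) → E → ℝ} (hf : ∀ x, Integrable (f x) ν) :
    cubeMean (fun x => ∫ w, f x w ∂ν) = ∫ w, cubeMean (fun x => f x w) ∂ν := by
  simp only [cubeMean]
  rw [integral_div, integral_finsetSum _ fun x _ => hf x]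

section RandomMatrix

variable {n q : ℕ}

/-- The `q × n` matrix with entries `∑ j, x (j, a, i) / √q`, as a linear map. -/
def blockMatrix (x : Fin q × Fin q × Fin n → ℝ) :
    EuclideanSpace ℝ (Fin n) →ₗ[ℝ] EuclideanSpace ℝ (Fin q) where
  toFun w := WithLp.toLp 2 fun a => ∑ k, (if k.2.1 = a then w k.2.2 / √q else 0) * x k
  map_add' v w := by
    ext a
    simp only [PiLp.add_apply, ← Finset.sum_add_distrib]
    refine Finset.sum_congr rfl fun k _ => ?_
    split_ifs <;> ring
  map_smul' c w := by
    ext a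
    simp only [PiLp.smul_apply, smul_eq_mul, RingHom.id_apply, Finset.mul_sum]
    refine Finset.sum_congr rfl fun k _ => ?_
    split_ifs <;> ring

lemma blockMatrix_apply (x : Fin q × Fin q × Fin n → ℝ) (w : EuclideanSpace ℝ (Fin n))
    (a : Fin q) :
    blockMatrix x w a = ∑ k, (if k.2.1 = a then w k.2.2 / √q else 0) * x k := rfl

lemma inner_blockMatrix (x : Fin q × Fin q × Fin n → ℝ) (w : EuclideanSpace ℝ (Fin n))
    (θ : EuclideanSpace ℝ (Fin q)) :
    ⟪θ, blockMatrix x w⟫ = ∑ k : Fin q × Fin q × Fin n, θ k.2.1 * w k.2.2 / √q * x k := by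
  simp only [PiLp.inner_apply, blockMatrix_apply, RCLike.inner_apply, conj_trivial,
    Finset.sum_mul]
  rw [Finset.sum_comm]
  refine Finset.sum_congr rfl fun k _ => ?_
  rw [Finset.sum_eq_single k.2.1]
  · simp; ring
  · intro b _ hb
    simp [hb.symm]
  · simp

lemma blockMatrix_add (x y : Fin q × Fin q × Fin n → ℝ) :
    blockMatrix (x + y) = blockMatrix x + blockMatrix y := by
  ext w a
  simp [blockMatrix_apply, mul_add, Finset.sum_add_distrib]

lemma blockMatrix_smul (c : ℝ) (x : Fin q × Fin q × Fin n → ℝ) :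
    blockMatrix (c • x) = c • blockMatrix x := by
  ext w a
  simp only [blockMatrix_apply, LinearMap.smul_apply, PiLp.smul_apply, Pi.smul_apply, smul_eq_mul,
    Finset.mul_sum]
  refine Finset.sum_congr rfl fun k _ => ?_
  ring

lemma sum_sq_blockMatrix_coeff (hq : 1 ≤ q) (θ : EuclideanSpace ℝ (Fin q))
    (w : EuclideanSpace ℝ (Fin n)) :
    ∑ k : Fin q × Fin q × Fin n, (θ k.2.1 * w k.2.2 / √q) ^ 2 = (‖θ‖ * ‖w‖) ^ 2 := by
  have hq0 : (0 : ℝ) < q := by exact_mod_cast hq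
  rw [mul_pow, EuclideanSpace.norm_sq_eq, EuclideanSpace.norm_sq_eq]
  simp only [Fintype.sum_prod_type, div_pow, mul_pow, Real.sq_sqrt hq0.le, Real.norm_eq_abs, sq_abs,
    Finset.sum_mul_sum, ← Finset.sum_div]
  simp
  field_simp

/-- The transpose of `blockMatrix x`. -/
def blockAdjoint (x : Fin q × Fin q × Fin n → ℝ) (θ : EuclideanSpace ℝ (Fin q)) :
    EuclideanSpace ℝ (Fin n) := LinearMap.adjoint (blockMatrix x) θ

lemma inner_blockAdjoint (x : Fin q × Fin q × Fin n → ℝ) (w : EuclideanSpace ℝ (Fin n))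
    (θ : EuclideanSpace ℝ (Fin q)) :
    ⟪blockAdjoint x θ, w⟫ = ⟪θ, blockMatrix x w⟫ :=
  LinearMap.adjoint_inner_left _ _ _

lemma norm_blockAdjoint_le (hq : 1 ≤ q) (x : Fin q × Fin q × Fin n → ℝ)
    (θ : EuclideanSpace ℝ (Fin q)) :
    ‖blockAdjoint x θ‖ ≤ ‖θ‖ * √(∑ k, x k ^ 2) := by
  have h := inner_blockAdjoint x (blockAdjoint x θ) θ
  rw [real_inner_self_eq_norm_sq, inner_blockMatrix] at h
  have h2 := Real.sum_mul_le_sqrt_mul_sqrt Finset.univ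
    (fun k : Fin q × Fin q × Fin n => θ k.2.1 * blockAdjoint x θ k.2.2 / √q) x
  rw [sum_sq_blockMatrix_coeff hq, Real.sqrt_sq (by positivity), ← h] at h2
  rcases (norm_nonneg (blockAdjoint x θ)).eq_or_lt with h0 | h0
  · rw [← h0]; positivity
  · nlinarith

lemma blockAdjoint_add_left (x y : Fin q × Fin q × Fin n → ℝ) (θ : EuclideanSpace ℝ (Fin q)) :
    blockAdjoint (x + y) θ = blockAdjoint x θ + blockAdjoint y θ := by
  simp [blockAdjoint, blockMatrix_add]

lemma blockAdjoint_smul_left (c : ℝ) (x : Fin q × Fin q × Fin n → ℝ)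
    (θ : EuclideanSpace ℝ (Fin q)) :
    blockAdjoint (c • x) θ = c • blockAdjoint x θ := by
  simp [blockAdjoint, blockMatrix_smul]

lemma cubeMean_norm_sq_blockMatrix (hq : 1 ≤ q) (w : EuclideanSpace ℝ (Fin n)) :
    cubeMean (fun x => ‖blockMatrix (q := q) (fun k => boolSign (x k)) w‖ ^ 2) = q * ‖w‖ ^ 2 := by
  have hq0 : (0 : ℝ) < q := by exact_mod_cast hq
  simp only [EuclideanSpace.norm_sq_eq, Real.norm_eq_abs, sq_abs, blockMatrix_apply]
  rw [cubeMean_sum]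
  simp only [cubeMean_sq]
  rw [Finset.sum_comm]
  have : ∀ k : Fin q × Fin q × Fin n,
      ∑ a : Fin q, (if k.2.1 = a then w k.2.2 / √q else 0) ^ 2 = w k.2.2 ^ 2 / q := by
    intro k
    rw [Finset.sum_eq_single k.2.1]
    · simp [div_pow, Real.sq_sqrt hq0.le]
    · intro b _ hb
      simp [hb.symm]
    · simp
  simp only [this, Fintype.sum_prod_type, ← Finset.sum_div]
  simp
  field_simp

lemma cubeMean_inner_blockMatrix_bounds (hq : 1 ≤ q) (w : EuclideanSpace ℝ (Fin n))
    {θ : EuclideanSpace ℝ (Fin q)} (hθ : ‖θ‖ = 1) :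
    (3 / 64 * √q * ‖w‖) ^ q ≤
      cubeMean (fun x => |⟪θ, blockMatrix (fun k => boolSign (x k)) w⟫| ^ q) ∧
    cubeMean (fun x => |⟪θ, blockMatrix (fun k => boolSign (x k)) w⟫| ^ q) ≤
      (4 * √q * ‖w‖) ^ q := by
  have hq0 : (0 : ℝ) < q := by exact_mod_cast hq
  simp only [inner_blockMatrix]
  have hsum := sum_sq_blockMatrix_coeff hq θ w
  rw [hθ, one_mul] at hsum
  refine ⟨?_, cubeMean_abs_pow_le _ (norm_nonneg w) hsum.le hq⟩
  have h := le_cubeMean_abs_pow (fun k : Fin q × Fin n => θ k.1 * w k.2 / √q)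
    (A := ‖w‖ / √q) (by positivity) (q := q) (by
      rw [Fintype.sum_prod_type] at hsum
      simp only [Finset.sum_const, Finset.card_univ, Fintype.card_fin, nsmul_eq_mul] at hsum
      rw [div_pow, ← hsum, Real.sq_sqrt hq0.le]
      field_simp) hq
  refine le_trans (le_of_eq ?_) h
  congr 1
  field_simp
  rw [Real.sq_sqrt hq0.le, mul_comm]

end RandomMatrix

lemma exp_neg_sixteen_lt : (120001 : ℝ) * exp (-16) ≤ 1 / 8 := by
  rw [Real.exp_neg, ← div_eq_mul_inv, div_le_iff₀ (exp_pos _)]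
  have h : (2.7 : ℝ) ≤ exp 1 := by
    have := Real.exp_one_gt_d9
    norm_num at this ⊢
    linarith
  have e : exp 16 = exp 1 ^ 16 := by rw [← Real.exp_nat_mul]; norm_num
  rw [e]
  have : (2.7 : ℝ) ^ 16 ≤ exp 1 ^ 16 := by gcongr
  norm_num at this ⊢
  linarith

/-- Dvoretzky-type step: some sign matrix makes all marginals of the image of `ν` large. -/
lemma exists_linearMap_marginal_ge {n q : ℕ} (hq : 1 ≤ q)
    {ν : Measure (EuclideanSpace ℝ (Fin n))} [IsProbabilityMeasure ν]
    (hm : ∀ r : ℕ, Integrable (fun w => ‖w‖ ^ r) ν) {S T R : ℝ} (hS : 0 < S) (hT : 0 < T)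
    (hR : 3000 * S ≤ R) (hRq : R ^ q = ∫ w, ‖w‖ ^ q ∂ν) (hT2 : ∫ w, ‖w‖ ^ 2 ∂ν ≤ T ^ 2)
    (hSq : ∀ v, ∫ w, |⟪v, w⟫| ^ q ∂ν ≤ (S * ‖v‖) ^ q) :
    ∃ A : EuclideanSpace ℝ (Fin n) →ₗ[ℝ] EuclideanSpace ℝ (Fin q),
      (∀ θ, ‖θ‖ = 1 → (3 / 512 * √q * R) ^ q ≤ ∫ w, |⟪θ, A w⟫| ^ q ∂ν) ∧
      ∫ w, ‖A w‖ ^ 2 ∂ν ≤ 4 * q * T ^ 2 := by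
  have hq0 : (0 : ℝ) < q := by exact_mod_cast hq
  have hsq : 0 < √(q : ℝ) := by positivity
  have hR0 : 0 < R := by linarith
  let sg : (Fin q × Fin q × Fin n → Bool) → (Fin q × Fin q × Fin n → ℝ) :=
    fun x k => boolSign (x k)
  set F : EuclideanSpace ℝ (Fin q) → (Fin q × Fin q × Fin n → ℝ) → ℝ :=
    fun θ y => marginalNorm ν q (blockAdjoint y θ) with hF
  have hF0 : ∀ θ y, 0 ≤ F θ y := fun θ y => marginalNorm_nonneg _
  have hFpow : ∀ θ y, F θ y ^ q = ∫ w, |⟪θ, blockMatrix y w⟫| ^ q ∂ν := fun θ y => by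
    rw [hF]
    simp only
    rw [marginalNorm_pow hq (hm q)]
    simp only [inner_blockAdjoint]
  have hFint : ∀ (θ : EuclideanSpace ℝ (Fin q)) (y : Fin q × Fin q × Fin n → ℝ),
      Integrable (fun w => |⟪θ, blockMatrix y w⟫| ^ q) ν := fun θ y => by
    simp only [← inner_blockAdjoint]
    exact integrable_abs_inner_pow (hm q) _
  have hFle : ∀ θ y, F θ y ≤ S * (‖θ‖ * √(∑ k, y k ^ 2)) := fun θ y =>
    (marginalNorm_le hq (hm q) hS.le hSq _).trans
      (by gcongr; exact norm_blockAdjoint_le hq _ _)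
  have hFaddr : ∀ θ x y, F θ (x + y) ≤ F θ x + F θ y := fun θ x y => by
    simp only [hF, blockAdjoint_add_left]
    exact marginalNorm_add_le hq (hm q) _ _
  have hFsmulr : ∀ θ (c : ℝ) y, F θ (c • y) = |c| * F θ y := fun θ c y => by
    simp only [hF, blockAdjoint_smul_left]
    exact marginalNorm_smul _ _
  have hFaddl : ∀ y θ θ', F (θ + θ') y ≤ F θ y + F θ' y := fun y θ θ' => by
    simp only [hF, blockAdjoint, map_add]
    exact marginalNorm_add_le hq (hm q) _ _
  have hFsmull : ∀ y (c : ℝ) θ, F (c • θ) y = |c| * F θ y := fun y c θ => by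
    simp only [hF, blockAdjoint, map_smul]
    exact marginalNorm_smul _ _
  have hmean : ∀ θ, ‖θ‖ = 1 → (3 / 64 * √q * R) ^ q ≤ cubeMean (fun x => F θ (sg x) ^ q) ∧
      cubeMean (fun x => F θ (sg x) ^ q) ≤ (4 * √q * R) ^ q := by
    intro θ hθ
    have hb := fun w => cubeMean_inner_blockMatrix_bounds hq w hθ (n := n)
    have hi : Integrable (fun w => cubeMean fun x =>
        |⟪θ, blockMatrix (n := n) (fun k => boolSign (x k)) w⟫| ^ q) ν := by
      simp only [cubeMean]
      exact (integrable_finsetSum _ fun x _ => hFint θ _).div_const _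
    simp only [hFpow]
    rw [cubeMean_integral fun x => hFint θ _, mul_pow _ R, mul_pow _ R, hRq,
      ← integral_const_mul, ← integral_const_mul]
    constructor
    · refine integral_mono ((hm q).const_mul _) hi fun w => ?_
      simpa only [mul_pow] using (hb w).1
    · refine integral_mono hi ((hm q).const_mul _) fun w => ?_
      simpa only [mul_pow] using (hb w).2
  set D := 3 / 64 * √q * R with hD
  have hdev : ∀ θ, ‖θ‖ = 1 → cubeProb {y | F θ y ≤ D / 4} ≤ exp (-(16 * q)) := by
    intro θ hθ
    refine cubeProb_le_of_convexOn (F := F θ) (S := S) ?_ (hF0 θ) hS ?_ hq ?_ (hmean θ hθ).1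
    · refine ⟨convex_univ, fun x _ y _ a b ha hb _ => ?_⟩
      refine (hFaddr θ _ _).trans (le_of_eq ?_)
      rw [hFsmulr, hFsmulr, abs_of_nonneg ha, abs_of_nonneg hb, smul_eq_mul, smul_eq_mul]
    · intro x y
      have h1 := hFaddr θ y (x - y)
      have h2 := hFle θ (x - y)
      rw [add_sub_cancel] at h1
      rw [hθ, one_mul] at h2
      simp only [Pi.sub_apply] at h2
      linarith
    · rw [hD]
      nlinarith [mul_le_mul_of_nonneg_left hR hsq.le, mul_pos hsq hS]
  obtain ⟨s1, hs1n, hs1c, hs1⟩ := exists_sphere_net (k := q) (η := 1 / 2) (by norm_num)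
  obtain ⟨s2, hs2n, hs2c, hs2⟩ := exists_sphere_net (k := q) (η := 1 / 60000) (by norm_num)
  have hQint : ∀ y : Fin q × Fin q × Fin n → ℝ, Integrable (fun w => ‖blockMatrix y w‖ ^ 2) ν := by
    intro y
    let L := LinearMap.toContinuousLinearMap (blockMatrix y)
    refine ((hm 2).const_mul (‖L‖ ^ 2)).mono' ?_ (.of_forall fun w => ?_)
    · exact (L.continuous.norm.pow 2).aestronglyMeasurable
    · rw [Real.norm_of_nonneg (by positivity), ← mul_pow]
      gcongr
      exact L.le_opNorm w
  let P1 : (Fin q × Fin q × Fin n → Bool) → ℝ :=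
    fun x => ∑ θ ∈ s1, F θ (sg x) ^ q / (160 * √q * R) ^ q
  let P2 : (Fin q × Fin q × Fin n → Bool) → ℝ :=
    fun x => ∑ θ ∈ s2, {y | F θ y ≤ D / 4}.indicator (fun _ => (1 : ℝ)) (sg x)
  let P3 : (Fin q × Fin q × Fin n → Bool) → ℝ :=
    fun x => (∫ w, ‖blockMatrix (sg x) w‖ ^ 2 ∂ν) / (4 * q * T ^ 2)
  have hP1n : ∀ x, 0 ≤ P1 x := fun x => Finset.sum_nonneg fun θ _ =>
    div_nonneg (pow_nonneg (hF0 _ _) _) (by positivity)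
  have hP2n : ∀ x, 0 ≤ P2 x := fun x => Finset.sum_nonneg fun θ _ =>
    Set.indicator_nonneg (fun _ _ => zero_le_one) _
  have hP3n : ∀ x, 0 ≤ P3 x := fun x => by positivity
  have heighth : ((1 : ℝ) / 8) ^ q ≤ 1 / 8 :=
    pow_le_of_le_one (by norm_num) (by norm_num) (by omega)
  have hP1 : cubeMean P1 ≤ 1 / 8 := by
    calc cubeMean P1 = ∑ θ ∈ s1, cubeMean (fun x => F θ (sg x) ^ q) / (160 * √q * R) ^ q := by
          rw [cubeMean_sum]
          simp only [cubeMean_div_const]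
      _ ≤ ∑ θ ∈ s1, (4 * √q * R) ^ q / (160 * √q * R) ^ q := by
          refine Finset.sum_le_sum fun θ hθ => ?_
          gcongr
          exact (hmean θ (hs1n θ hθ)).2
      _ = s1.card * (1 / 40) ^ q := by
          rw [Finset.sum_const, nsmul_eq_mul, ← div_pow]
          congr 2
          field_simp
          norm_num
      _ ≤ (1 + 2 / (1 / 2)) ^ q * (1 / 40) ^ q := by gcongr
      _ = (1 / 8) ^ q := by rw [← mul_pow]; norm_num
      _ ≤ 1 / 8 := heighth
  have hP2 : cubeMean P2 ≤ 1 / 8 := by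
    calc cubeMean P2 = ∑ θ ∈ s2, cubeProb {y | F θ y ≤ D / 4} := cubeMean_sum _ _
      _ ≤ ∑ θ ∈ s2, exp (-(16 * q)) := Finset.sum_le_sum fun θ hθ => hdev θ (hs2n θ hθ)
      _ = s2.card * exp (-16) ^ q := by
          rw [Finset.sum_const, nsmul_eq_mul, ← Real.exp_nat_mul]
          congr 2; ring
      _ ≤ (1 + 2 / (1 / 60000)) ^ q * exp (-16) ^ q := by gcongr
      _ = (120001 * exp (-16)) ^ q := by rw [← mul_pow]; norm_num
      _ ≤ (1 / 8) ^ q := by gcongr; exact exp_neg_sixteen_lt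
      _ ≤ 1 / 8 := heighth
  have hP3 : cubeMean P3 ≤ 1 / 4 := by
    rw [cubeMean_div_const, cubeMean_integral fun x => hQint _, div_le_iff₀ (by positivity)]
    simp only [sg, cubeMean_norm_sq_blockMatrix hq]
    rw [integral_const_mul]
    nlinarith [mul_le_mul_of_nonneg_left hT2 hq0.le]
  obtain ⟨x, hx⟩ := exists_le_cubeMean fun x => P1 x + P2 x + P3 x
  have hx' : P1 x + P2 x + P3 x < 1 := by
    rw [cubeMean_add, cubeMean_add] at hx
    linarith
  have hA1 : ∀ θ ∈ s1, F θ (sg x) ≤ 160 * √q * R := by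
    intro θ hθ
    have h1 : F θ (sg x) ^ q / (160 * √q * R) ^ q ≤ P1 x :=
      Finset.single_le_sum (f := fun θ => F θ (sg x) ^ q / (160 * √q * R) ^ q)
        (fun θ _ => div_nonneg (pow_nonneg (hF0 _ _) _) (by positivity)) hθ
    have h2 : F θ (sg x) ^ q / (160 * √q * R) ^ q ≤ 1 := by
      linarith [hP2n x, hP3n x]
    rw [div_le_one (by positivity)] at h2
    exact le_of_pow_le_pow_left₀ (by omega) (by positivity) h2
  have hA2 : ∀ θ ∈ s2, D / 4 < F θ (sg x) := by
    intro θ hθ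
    by_contra! hcon
    have h1 : {y | F θ y ≤ D / 4}.indicator (fun _ => (1 : ℝ)) (sg x) ≤ P2 x :=
      Finset.single_le_sum
        (f := fun θ => {y | F θ y ≤ D / 4}.indicator (fun _ => (1 : ℝ)) (sg x))
        (fun θ _ => Set.indicator_nonneg (fun _ _ => zero_le_one) _) hθ
    rw [Set.indicator_of_mem (by exact hcon)] at h1
    linarith [hP1n x, hP3n x]
  have hup := le_of_le_on_half_net (hFaddl (sg x)) (hFsmull (sg x))
    (B := S * √(∑ k, sg x k ^ 2)) (fun θ => (hFle θ _).trans (le_of_eq (by ring))) hA1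
    hs1 (fun θ => hF0 θ _)
  refine ⟨blockMatrix (sg x), fun θ hθ => ?_, ?_⟩
  · rw [← hFpow]
    refine pow_le_pow_left₀ (by positivity) ?_ _
    obtain ⟨y, hy, hyθ⟩ := hs2 θ hθ
    have h1 := hFaddl (sg x) θ (y - θ)
    rw [add_sub_cancel] at h1
    have h2 := hup (y - θ)
    rw [norm_sub_rev] at hyθ
    have h3 := hA2 y hy
    have h4 : 2 * (160 * √q * R) * ‖y - θ‖ ≤ 2 * (160 * √q * R) * (1 / 60000) := by gcongr
    have h5 : 0 < √q * R := by positivity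
    rw [hD] at h3
    nlinarith
  · have h1 : P3 x ≤ 1 := by linarith [hP1n x, hP2n x]
    exact (div_le_one (by positivity)).1 h1

section BallAverage

variable {E : Type*} [NormedAddCommGroup E] [NormedSpace ℝ E] [FiniteDimensional ℝ E]
  [MeasurableSpace E] [BorelSpace E] (μ ν : Measure E) [μ.IsAddHaarMeasure] [IsFiniteMeasure ν]

lemma measurable_measure_closedBall {E : Type*} [NormedAddCommGroup E]
    [SecondCountableTopology E] [MeasurableSpace E] [BorelSpace E] (ν : Measure E)
    [IsFiniteMeasure ν] (r : ℝ) :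
    Measurable fun x => ν (Metric.closedBall x r) :=
  measurable_measure_prodMk_left (ν := ν) (s := {p : E × E | dist p.2 p.1 ≤ r})
    (measurableSet_le (by fun_prop) (by fun_prop))

lemma lintegral_mul_measure_closedBall {φ : E → ℝ≥0∞} (hφ : Measurable φ) (r : ℝ) :
    ∫⁻ x, φ x * ν (Metric.closedBall x r) ∂μ =
      ∫⁻ w, ∫⁻ u in Metric.closedBall 0 r, φ (w + u) ∂μ ∂ν := by
  have h1 : ∀ x, φ x * ν (Metric.closedBall x r) =
      ∫⁻ w, {p : E × E | dist p.2 p.1 ≤ r}.indicator (fun p => φ p.1) (x, w) ∂ν := by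
    intro x
    have : ∀ w, {p : E × E | dist p.2 p.1 ≤ r}.indicator (fun p => φ p.1) (x, w) =
        (Metric.closedBall x r).indicator (fun _ => φ x) w := fun w => rfl
    simp only [this]
    rw [lintegral_indicator_const measurableSet_closedBall]
  have h2 : ∀ w, ∫⁻ x, {p : E × E | dist p.2 p.1 ≤ r}.indicator (fun p => φ p.1) (x, w) ∂μ =
      ∫⁻ u in Metric.closedBall 0 r, φ (w + u) ∂μ := by
    intro w
    rw [← lintegral_indicator measurableSet_closedBall,
      ← lintegral_add_left_eq_self _ w]
    congr 1
    ext u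
    simp [Set.indicator, dist_eq_norm]
  simp only [h1]
  rw [lintegral_lintegral_swap]
  · simp only [h2]
  · refine Measurable.aemeasurable ?_
    exact (hφ.comp measurable_fst).indicator (measurableSet_le (by fun_prop) (by fun_prop))

lemma mul_measure_closedBall_le_lintegral {φ : E → ℝ≥0∞} (hφ : Measurable φ) {w : E}
    (h : ∀ u, 2 * φ w ≤ φ (w + u) + φ (w - u)) (r : ℝ) :
    φ w * μ (Metric.closedBall 0 r) ≤ ∫⁻ u in Metric.closedBall 0 r, φ (w + u) ∂μ := by
  have hneg : ∫⁻ u in Metric.closedBall 0 r, φ (w - u) ∂μ =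
      ∫⁻ u in Metric.closedBall 0 r, φ (w + u) ∂μ := by
    rw [← lintegral_indicator measurableSet_closedBall,
      ← lintegral_indicator measurableSet_closedBall, ← lintegral_neg_eq_self]
    congr 1
    ext u
    simp [Set.indicator]
  have h2 : 2 * (φ w * μ (Metric.closedBall 0 r)) ≤
      2 * ∫⁻ u in Metric.closedBall 0 r, φ (w + u) ∂μ := by
    calc 2 * (φ w * μ (Metric.closedBall 0 r))
        = ∫⁻ _u in Metric.closedBall 0 r, 2 * φ w ∂μ := by
          rw [setLIntegral_const, mul_assoc]
      _ ≤ ∫⁻ u in Metric.closedBall 0 r, (φ (w + u) + φ (w - u)) ∂μ :=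
          lintegral_mono fun u => h u
      _ = _ := by
          rw [lintegral_add_left (by fun_prop), hneg, two_mul]
  exact (ENNReal.mul_le_mul_iff_right (by norm_num) (by norm_num)).1 h2

lemma lintegral_comp_half {f : E → ℝ≥0∞} (hf : Measurable f) :
    ∫⁻ x, f ((2 : ℝ)⁻¹ • x) ∂μ = 2 ^ Module.finrank ℝ E * ∫⁻ x, f x ∂μ := by
  rw [← lintegral_map hf (by fun_prop), Measure.map_addHaar_smul _ (by norm_num),
    lintegral_smul_measure]
  congr 1
  rw [inv_pow, inv_inv, abs_of_nonneg (by positivity), ENNReal.ofReal_pow (by norm_num)]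
  norm_num

end BallAverage

lemma closedBall_subset_closure_sub {E : Type*} [NormedAddCommGroup E] [InnerProductSpace ℝ E]
    [CompleteSpace E] {K : Set E} (hK : Convex ℝ K) (h0 : (0 : E) ∈ K) {c : ℝ}
    (h : ∀ θ : E, ‖θ‖ = 1 → ∃ x ∈ K, c ≤ |⟪θ, x⟫|) :
    Metric.closedBall 0 c ⊆ closure (K - K) := by
  intro z hz
  by_contra hzL
  have hz : ‖z‖ ≤ c := by simpa using hz
  obtain ⟨f, u, hf, hu⟩ := geometric_hahn_banach_closed_point (hK.sub hK).closure
    isClosed_closure hzL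
  set v := (InnerProductSpace.toDual ℝ E).symm f with hv
  have hfv : ∀ x, f x = ⟪v, x⟫ := fun x => by rw [hv, InnerProductSpace.toDual_symm_apply]
  have hmem : ∀ x ∈ K, |⟪v, x⟫| < u := by
    intro x hx
    have h1 := hf _ (subset_closure (Set.sub_mem_sub hx h0))
    have h2 := hf _ (subset_closure (Set.sub_mem_sub h0 hx))
    rw [sub_zero, hfv] at h1
    rw [zero_sub, hfv, inner_neg_right] at h2
    exact abs_lt.2 ⟨by linarith, h1⟩
  have h1 : f z ≤ ‖v‖ * c := by
    rw [hfv]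
    exact (real_inner_le_norm _ _).trans (by gcongr)
  have hv0 : 0 < ‖v‖ := by
    rw [norm_pos_iff]
    intro hv0
    have := hmem 0 h0
    rw [hv0, norm_zero, zero_mul] at h1
    simp at this
    linarith
  obtain ⟨x, hx, hcx⟩ := h (‖v‖⁻¹ • v) (by simp [norm_smul, hv0.ne'])
  have := hmem x hx
  rw [real_inner_smul_left, abs_mul, abs_of_pos (inv_pos.2 hv0), ← div_eq_inv_mul,
    le_div_iff₀ hv0] at hcx
  linarith

lemma width_pow_le {k : ℕ} {ν : Measure (EuclideanSpace ℝ (Fin k))} [IsProbabilityMeasure ν]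
    {K : Set (EuclideanSpace ℝ (Fin k))} (hK : Convex ℝ K) (h0 : 0 ∈ K) {c δ ρ : ℝ} (hc : 0 ≤ c)
    (hδ : 0 < δ) (hρ : 0 ≤ ρ) (hν : ∀ x ∈ K, δ ≤ ν.real (Metric.closedBall x ρ))
    (h : ∀ θ : EuclideanSpace ℝ (Fin k), ‖θ‖ = 1 → ∃ x ∈ K, c ≤ |⟪θ, x⟫|) :
    c ^ k * δ ^ 2 ≤ (4 * ρ) ^ k := by
  classical
  obtain ⟨s, -, hs2, hs3⟩ := exists_finset_net (A := K) (U := Set.univ) (r := ρ) (M := 1) ν hδ hν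
    (fun _ _ => Set.subset_univ _) (measure_ne_top _ _) (by simp)
  set V := (volume : Measure (EuclideanSpace ℝ (Fin k))).real (Metric.ball 0 1) with hV
  have hV0 : 0 < V := ENNReal.toReal_pos (Metric.measure_ball_pos _ _ one_pos).ne'
    measure_ball_lt_top.ne
  have hcover : Metric.closedBall 0 c ⊆
      ⋃ p ∈ s ×ˢ s, Metric.closedBall (p.1 - p.2 : EuclideanSpace ℝ (Fin k)) (4 * ρ) := by
    refine (closedBall_subset_closure_sub hK h0 h).trans (closure_minimal ?_ ?_)
    · rintro _ ⟨x, hx, y, hy, rfl⟩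
      obtain ⟨a, ha, hxa⟩ := hs3 x hx
      obtain ⟨b, hb, hyb⟩ := hs3 y hy
      simp only [Set.mem_iUnion]
      refine ⟨(a, b), Finset.mk_mem_product ha hb, ?_⟩
      rw [Metric.mem_closedBall]
      exact (dist_sub_sub_le x y a b).trans (by linarith)
    · exact (Finset.finite_toSet _).isClosed_biUnion fun _ _ => Metric.isClosed_closedBall
  have h1 : c ^ k * V ≤ (s.card * s.card : ℕ) * ((4 * ρ) ^ k * V) := by
    rw [← volume_real_closedBall 0 hc]
    refine (measureReal_mono hcover ?_).trans ((measureReal_biUnion_finset_le _ _).trans ?_)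
    · exact ((measure_biUnion_lt_top (Finset.finite_toSet _)
        fun _ _ => measure_closedBall_lt_top)).ne
    · rw [Finset.sum_congr rfl fun p _ => volume_real_closedBall _ (by positivity),
        Finset.sum_const, Finset.card_product, nsmul_eq_mul]
  have h2 : c ^ k ≤ (s.card * s.card : ℕ) * (4 * ρ) ^ k := by
    rw [← mul_assoc] at h1
    exact le_of_mul_le_mul_right h1 hV0
  have h3 : (s.card * δ) ^ 2 ≤ 1 := pow_le_one₀ (by positivity) hs2
  calc c ^ k * δ ^ 2 ≤ (s.card * s.card : ℕ) * (4 * ρ) ^ k * δ ^ 2 := by gcongr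
    _ = (s.card * δ) ^ 2 * (4 * ρ) ^ k := by push_cast; ring
    _ ≤ 1 * (4 * ρ) ^ k := by gcongr
    _ = _ := one_mul _

lemma LogConcaveMeasure.closedBall_le {E : Type*} [NormedAddCommGroup E] [NormedSpace ℝ E]
    [MeasurableSpace E] [BorelSpace E] {ν : Measure E} (h : LogConcaveMeasure ν) {ρ a b : ℝ}
    (ha : 0 < a) (hb : 0 < b) (hab : a + b = 1) (x y : E) :
    ν.real (Metric.closedBall x ρ) ^ a * ν.real (Metric.closedBall y ρ) ^ b ≤
      ν.real (Metric.closedBall (a • x + b • y) ρ) := by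
  refine h _ _ _ measurableSet_closedBall measurableSet_closedBall measurableSet_closedBall a b
    ha hb hab fun z hz w hw => ?_
  rw [mem_closedBall_iff_norm] at *
  calc ‖a • z + b • w - (a • x + b • y)‖ = ‖a • (z - x) + b • (w - y)‖ := by
        congr 1; simp only [smul_sub]; abel
    _ ≤ a * ‖z - x‖ + b * ‖w - y‖ := by
        refine (norm_add_le _ _).trans ?_
        rw [norm_smul, norm_smul, Real.norm_of_nonneg ha.le, Real.norm_of_nonneg hb.le]
    _ ≤ a * ρ + b * ρ := by gcongr
    _ = ρ := by rw [← add_mul, hab, one_mul]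

lemma LogConcaveMeasure.measureReal_closedBall_le_half {E : Type*} [NormedAddCommGroup E]
    [NormedSpace ℝ E] [MeasurableSpace E] [BorelSpace E] {ν : Measure E}
    (h : LogConcaveMeasure ν) {ρ η : ℝ} (hη : 0 ≤ η)
    (h0 : 1 / 2 ≤ ν.real (Metric.closedBall 0 ρ)) {x : E}
    (hx : ν.real (Metric.closedBall x ρ) ≤ η ^ 2 / 2) :
    ν.real (Metric.closedBall x ρ) ≤ η * ν.real (Metric.closedBall ((2 : ℝ)⁻¹ • x) ρ) := by
  have h1 := h.closedBall_le (ρ := ρ) (a := 2⁻¹) (b := 2⁻¹) (by norm_num) (by norm_num)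
    (by norm_num) x 0
  rw [smul_zero, add_zero] at h1
  set g := ν.real (Metric.closedBall x ρ)
  set g0 := ν.real (Metric.closedBall 0 ρ)
  set g2 := ν.real (Metric.closedBall ((2 : ℝ)⁻¹ • x) ρ)
  have hg : 0 ≤ g := measureReal_nonneg
  have hg0 : 0 ≤ g0 := measureReal_nonneg
  have hg2 : 0 ≤ g2 := measureReal_nonneg
  have e : ∀ y : ℝ, 0 ≤ y → (y ^ (2⁻¹ : ℝ)) ^ 2 = y := fun y hy => by
    rw [← Real.rpow_natCast, ← Real.rpow_mul hy]; norm_num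
  have h2 : g * g0 ≤ g2 ^ 2 := by
    have := pow_le_pow_left₀ (by positivity) h1 2
    rwa [mul_pow, e g hg, e g0 hg0] at this
  have h3 : g / 2 ≤ g2 ^ 2 := by nlinarith
  refine abs_le_of_sq_le_sq' ?_ (by positivity) |>.2
  rw [mul_pow]
  calc g ^ 2 = g * g := sq g
    _ ≤ (η ^ 2 / 2) * (2 * g2 ^ 2) := by gcongr; linarith
    _ = _ := by ring

lemma two_mul_abs_pow_le {k : ℕ} (hk : 1 ≤ k) (a b : ℝ) :
    2 * |a| ^ k ≤ |a + b| ^ k + |a - b| ^ k := by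
  obtain ⟨k, rfl⟩ := Nat.exists_eq_add_of_le' hk
  have h1 : 2 * |a| ≤ |a + b| + |a - b| := by
    have : 2 * |a| = |2 * a| := by rw [abs_mul, abs_two]
    rw [this]
    refine le_trans (le_of_eq ?_) (abs_add_le _ _)
    congr 1; ring
  have h2 := (pow_le_pow_left₀ (by positivity) h1 (k + 1)).trans
    (add_pow_le (abs_nonneg _) (abs_nonneg _) (k + 1))
  rw [mul_pow, Nat.add_sub_cancel, pow_succ, mul_assoc] at h2
  exact le_of_mul_le_mul_left h2 (by positivity)

section Volume

variable {k : ℕ} {ν : Measure (EuclideanSpace ℝ (Fin k))} [IsProbabilityMeasure ν]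

lemma lintegral_abs_inner_pow_mul_lt_top
    (hm : ∀ r : ℕ, Integrable (fun w => ‖w‖ ^ r) ν) {θ : EuclideanSpace ℝ (Fin k)}
    (hθ : ‖θ‖ = 1) {ρ : ℝ} (hρ : 0 ≤ ρ) :
    ∫⁻ x, ENNReal.ofReal (|⟪θ, x⟫| ^ k) * ν (Metric.closedBall x ρ) < ∞ := by
  rw [lintegral_mul_measure_closedBall volume ν (by fun_prop) ρ]
  have hb : ∀ w, ∫⁻ u in Metric.closedBall 0 ρ, ENNReal.ofReal (|⟪θ, w + u⟫| ^ k) ≤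
      ENNReal.ofReal (2 ^ (k - 1) * (‖w‖ ^ k + ρ ^ k)) *
        volume (Metric.closedBall (0 : EuclideanSpace ℝ (Fin k)) ρ) := by
    intro w
    rw [← setLIntegral_const]
    refine setLIntegral_mono measurable_const fun u hu => ENNReal.ofReal_le_ofReal ?_
    rw [mem_closedBall_zero_iff] at hu
    have h1 : |⟪θ, w + u⟫| ≤ ‖w‖ + ρ := by
      refine (abs_real_inner_le_norm _ _).trans ?_
      rw [hθ, one_mul]
      exact (norm_add_le _ _).trans (by gcongr)
    exact (pow_le_pow_left₀ (abs_nonneg _) h1 k).trans (add_pow_le (norm_nonneg _) hρ k)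
  refine (lintegral_mono hb).trans_lt ?_
  rw [lintegral_mul_const _ (by fun_prop)]
  refine ENNReal.mul_lt_top ?_ measure_closedBall_lt_top
  exact (((hm k).add (integrable_const _)).const_mul _).lintegral_lt_top

lemma ofReal_pow_mul_le_lintegral (hk : 1 ≤ k)
    (hm : ∀ r : ℕ, Integrable (fun w => ‖w‖ ^ r) ν) {θ : EuclideanSpace ℝ (Fin k)} {ρ H : ℝ}
    (hH : H ^ k ≤ ∫ w, |⟪θ, w⟫| ^ k ∂ν) :
    ENNReal.ofReal (H ^ k) * volume (Metric.closedBall (0 : EuclideanSpace ℝ (Fin k)) ρ) ≤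
      ∫⁻ x, ENNReal.ofReal (|⟪θ, x⟫| ^ k) * ν (Metric.closedBall x ρ) := by
  rw [lintegral_mul_measure_closedBall volume ν (by fun_prop) ρ]
  refine le_trans ?_ (lintegral_mono fun w => mul_measure_closedBall_le_lintegral volume
    (φ := fun x => ENNReal.ofReal (|⟪θ, x⟫| ^ k)) (w := w) (by fun_prop) (fun u => ?_) ρ)
  · rw [lintegral_mul_const _ (by fun_prop)]
    gcongr
    rw [← ofReal_integral_eq_lintegral_ofReal (integrable_abs_inner_pow (hm k) θ)
      (Filter.Eventually.of_forall fun _ => by positivity)]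
    exact ENNReal.ofReal_le_ofReal hH
  · have e : 2 * ENNReal.ofReal (|⟪θ, w⟫| ^ k) = ENNReal.ofReal (2 * |⟪θ, w⟫| ^ k) := by
      rw [ENNReal.ofReal_mul (by norm_num), ENNReal.ofReal_ofNat]
    rw [← ENNReal.ofReal_add (by positivity) (by positivity), e, inner_add_right, inner_sub_right]
    exact ENNReal.ofReal_le_ofReal (two_mul_abs_pow_le hk _ _)

/-- A log-concave measure whose mass sits near the origin has a one-dimensional marginal whose
`k`-th moment, in dimension `k`, is small. -/
lemma LogConcaveMeasure.exists_mem_lt_abs_inner (h : LogConcaveMeasure ν) (hk : 1 ≤ k)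
    (hm : ∀ r : ℕ, Integrable (fun w => ‖w‖ ^ r) ν) {θ : EuclideanSpace ℝ (Fin k)}
    (hθ : ‖θ‖ = 1) {ρ H : ℝ} (hρ : 0 < ρ) (hH0 : 0 < H)
    (hH : H ^ k ≤ ∫ w, |⟪θ, w⟫| ^ k ∂ν) (h0 : 1 / 2 ≤ ν.real (Metric.closedBall 0 ρ)) :
    ∃ x, (4⁻¹ ^ k / 2) ^ 2 / 2 ≤ ν.real (Metric.closedBall x ρ) ∧ H / 3 ≤ |⟪θ, x⟫| := by
  by_contra! hcon
  set η : ℝ := 4⁻¹ ^ k / 2 with hη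
  have hη0 : 0 < η := by positivity
  set φ : EuclideanSpace ℝ (Fin k) → ℝ≥0∞ := fun x => ENNReal.ofReal (|⟪θ, x⟫| ^ k) with hφ
  have hφm : Measurable φ := by fun_prop
  set G : EuclideanSpace ℝ (Fin k) → ℝ≥0∞ := fun x => ν (Metric.closedBall x ρ) with hG
  have hGm : Measurable G := measurable_measure_closedBall ν ρ
  set V := volume (Metric.closedBall (0 : EuclideanSpace ℝ (Fin k)) ρ) with hV
  have hV0 : V ≠ 0 := (Metric.measure_closedBall_pos _ _ hρ).ne'
  have hVt : V ≠ ∞ := measure_closedBall_lt_top.ne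
  set I := ∫⁻ x, φ x * G x with hI
  have hIt : I ≠ ∞ := (lintegral_abs_inner_pow_mul_lt_top hm hθ hρ.le).ne
  have hIge : ENNReal.ofReal (H ^ k) * V ≤ I := ofReal_pow_mul_le_lintegral hk hm hH
  have hint : ∫⁻ x, G x = V := by
    have := lintegral_mul_measure_closedBall (volume : Measure (EuclideanSpace ℝ (Fin k))) ν
      (φ := fun _ => 1) measurable_const ρ
    simpa using this
  have hpt : ∀ x, φ x * G x ≤ ENNReal.ofReal ((H / 3) ^ k) * G x +
      ENNReal.ofReal (η * 2 ^ k) * (φ ((2 : ℝ)⁻¹ • x) * G ((2 : ℝ)⁻¹ • x)) := by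
    intro x
    by_cases hx : η ^ 2 / 2 ≤ ν.real (Metric.closedBall x ρ)
    · refine le_add_right ?_
      gcongr
      exact ENNReal.ofReal_le_ofReal (pow_le_pow_left₀ (abs_nonneg _) (hcon x hx).le k)
    · refine le_add_left ?_
      have h1 := h.measureReal_closedBall_le_half hη0.le h0 (not_le.1 hx).le
      have h2 : G x ≤ ENNReal.ofReal η * G ((2 : ℝ)⁻¹ • x) := by
        simp only [hG]
        rw [← ofReal_measureReal (measure_ne_top ν (Metric.closedBall x ρ)),
          ← ofReal_measureReal (measure_ne_top ν (Metric.closedBall ((2 : ℝ)⁻¹ • x) ρ)),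
          ← ENNReal.ofReal_mul hη0.le]
        exact ENNReal.ofReal_le_ofReal h1
      have h3 : φ x = ENNReal.ofReal (2 ^ k) * φ ((2 : ℝ)⁻¹ • x) := by
        simp only [hφ]
        rw [← ENNReal.ofReal_mul (by positivity), real_inner_smul_right, abs_mul, ← mul_pow,
          abs_of_pos (by norm_num : (0 : ℝ) < 2⁻¹), mul_inv_cancel_left₀ two_ne_zero]
      calc φ x * G x ≤ (ENNReal.ofReal (2 ^ k) * φ ((2 : ℝ)⁻¹ • x)) *
            (ENNReal.ofReal η * G ((2 : ℝ)⁻¹ • x)) := by rw [h3]; gcongr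
        _ = _ := by rw [ENNReal.ofReal_mul hη0.le]; ring
  have hle : I ≤ ENNReal.ofReal ((H / 3) ^ k) * V + ENNReal.ofReal (1 / 2) * I := by
    calc I ≤ _ := lintegral_mono hpt
      _ = ENNReal.ofReal ((H / 3) ^ k) * V +
          ENNReal.ofReal (η * 2 ^ k) * (2 ^ k * I) := by
        rw [lintegral_add_left (by fun_prop), lintegral_const_mul _ hGm, hint,
          lintegral_const_mul _ (by fun_prop),
          lintegral_comp_half volume (f := fun x => φ x * G x) (by fun_prop)]
        simp [hI]
      _ = _ := by
        rw [← mul_assoc]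
        congr 2
        rw [← ENNReal.ofReal_ofNat 2, ← ENNReal.ofReal_pow (by norm_num),
          ← ENNReal.ofReal_mul (by positivity)]
        congr 1
        rw [hη, mul_assoc, ← mul_pow, div_mul_eq_mul_div, ← mul_pow]
        norm_num
  have hle' := ENNReal.toReal_mono (by finiteness) hle
  have hIge' := ENNReal.toReal_mono hIt hIge
  rw [ENNReal.toReal_add (by finiteness) (by finiteness), ENNReal.toReal_mul, ENNReal.toReal_mul,
    ENNReal.toReal_ofReal (by positivity), ENNReal.toReal_ofReal (by positivity)] at hle'
  rw [ENNReal.toReal_mul, ENNReal.toReal_ofReal (by positivity)] at hIge'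
  have hVp : 0 < V.toReal := ENNReal.toReal_pos hV0 hVt
  have h3 : (H / 3) ^ k ≤ H ^ k / 3 := by
    rw [div_pow]
    gcongr
    calc (3 : ℝ) = 3 ^ 1 := by norm_num
      _ ≤ 3 ^ k := pow_le_pow_right₀ (by norm_num) hk
  have h4 : 0 < H ^ k * V.toReal := by positivity
  nlinarith

/-- Comparison of a uniform lower bound on the marginals with the second moment. -/
lemma LogConcaveMeasure.le_of_marginal_ge (h : LogConcaveMeasure ν) (hk : 1 ≤ k)
    (hm : ∀ r : ℕ, Integrable (fun w => ‖w‖ ^ r) ν) {ρ H : ℝ} (hρ : 0 < ρ) (hH0 : 0 < H)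
    (hH : ∀ θ : EuclideanSpace ℝ (Fin k), ‖θ‖ = 1 → H ^ k ≤ ∫ w, |⟪θ, w⟫| ^ k ∂ν)
    (h2 : ∫ w, ‖w‖ ^ 2 ∂ν ≤ ρ ^ 2 / 2) : H ≤ 196608 * ρ := by
  have h0 : 1 / 2 ≤ ν.real (Metric.closedBall 0 ρ) := by
    have h1 := mul_meas_ge_le_integral_of_nonneg (μ := ν) (f := fun w => ‖w‖ ^ 2)
      (Filter.Eventually.of_forall fun _ => by positivity) (hm 2) (ρ ^ 2)
    have h3 : ν.real {w | ρ ^ 2 ≤ ‖w‖ ^ 2} ≤ 1 / 2 := by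
      have := h1.trans h2
      rw [show ρ ^ 2 / 2 = ρ ^ 2 * (1 / 2) by ring] at this
      exact le_of_mul_le_mul_left this (by positivity)
    have h4 : 1 ≤ ν.real (Metric.closedBall 0 ρ) + ν.real {w | ρ ^ 2 ≤ ‖w‖ ^ 2} := by
      have : (1 : ℝ) = ν.real Set.univ := by simp
      rw [this]
      refine (measureReal_mono (fun w _ => ?_)).trans (measureReal_union_le _ _)
      rcases le_total ‖w‖ ρ with hw | hw
      · exact Or.inl (by simpa using hw)
      · exact Or.inr (pow_le_pow_left₀ hρ.le hw 2)
    linarith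
  set δ : ℝ := (4⁻¹ ^ k / 2) ^ 2 / 2 with hδ
  have hδ0 : 0 < δ := by positivity
  have hδ8 : δ = 16⁻¹ ^ k / 8 := by
    rw [hδ, div_pow, ← pow_mul, mul_comm k 2, pow_mul]; norm_num; ring
  have hpow1 : (16⁻¹ : ℝ) ^ k ≤ 1 := pow_le_one₀ (by norm_num) (by norm_num)
  have hconv : Convex ℝ {x | δ ≤ ν.real (Metric.closedBall x ρ)} := by
    rw [convex_iff_forall_pos]
    intro x hx y hy a b ha hb hab
    rw [Set.mem_ofPred_eq] at *
    refine le_trans ?_ (h.closedBall_le ha hb hab x y)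
    calc δ = δ ^ a * δ ^ b := by rw [← Real.rpow_add hδ0, hab, Real.rpow_one]
      _ ≤ _ := by gcongr
  have key := width_pow_le (ν := ν) (c := H / 3) hconv
    (by rw [Set.mem_ofPred_eq]; linarith) (by positivity) hδ0 hρ.le (fun x hx => hx)
    fun θ hθ => h.exists_mem_lt_abs_inner hk hm hθ hρ hH0 (hH θ hθ) h0
  have h8 : (128⁻¹ : ℝ) ^ k ≤ δ := by
    rw [hδ8, show (128⁻¹ : ℝ) = 16⁻¹ * 8⁻¹ by norm_num, mul_pow, div_eq_mul_inv]
    gcongr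
    exact pow_le_of_le_one (by norm_num) (by norm_num) (by omega)
  have h9 : (H / 3 * (128⁻¹) ^ 2) ^ k ≤ (4 * ρ) ^ k := by
    rw [mul_pow, ← pow_mul, mul_comm 2 k, pow_mul]
    refine le_trans ?_ key
    gcongr
  have := le_of_pow_le_pow_left₀ (by omega) (by positivity) h9
  norm_num at this
  linarith

end Volume

/-- Paouris' inequality: a high moment of the norm of a log-concave vector is controlled by its
second moment and by the moment of the same order of its one-dimensional marginals. -/
theorem LogConcaveMeasure.paouris {n q : ℕ} (hq : 1 ≤ q) {ν : Measure (EuclideanSpace ℝ (Fin n))}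
    [IsProbabilityMeasure ν] (h : LogConcaveMeasure ν)
    (hm : ∀ r : ℕ, Integrable (fun w => ‖w‖ ^ r) ν) {S T : ℝ} (hS : 0 < S) (hT : 0 < T)
    (hT2 : ∫ w, ‖w‖ ^ 2 ∂ν ≤ T ^ 2) (hSq : ∀ v, ∫ w, |⟪v, w⟫| ^ q ∂ν ≤ (S * ‖v‖) ^ q) :
    ∫ w, ‖w‖ ^ q ∂ν ≤ (100663296 * (T + S)) ^ q := by
  have hint0 : 0 ≤ ∫ w, ‖w‖ ^ q ∂ν := integral_nonneg fun _ => by positivity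
  set R := (∫ w, ‖w‖ ^ q ∂ν) ^ ((q : ℝ)⁻¹) with hR
  have hR0 : 0 ≤ R := Real.rpow_nonneg hint0 _
  have hRq : R ^ q = ∫ w, ‖w‖ ^ q ∂ν := Real.rpow_inv_natCast_pow hint0 (by omega)
  rw [← hRq]
  refine pow_le_pow_left₀ hR0 ?_ q
  rcases le_total R (3000 * S) with hRS | hRS
  · linarith
  obtain ⟨A, hA1, hA2⟩ := exists_linearMap_marginal_ge hq hm hS hT hRS hRq hT2 hSq
  have hAc : Continuous A := A.continuous_of_finiteDimensional
  have hAm : Measurable A := hAc.measurable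
  have : IsProbabilityMeasure (ν.map A) := Measure.isProbabilityMeasure_map hAm.aemeasurable
  have hmA : ∀ r : ℕ, Integrable (fun w => ‖w‖ ^ r) (ν.map A) := by
    intro r
    rw [integrable_map_measure (by fun_prop) hAm.aemeasurable]
    refine ((hm r).const_mul (‖LinearMap.toContinuousLinearMap A‖ ^ r)).mono'
      (by fun_prop) (.of_forall fun w => ?_)
    rw [Function.comp_apply, Real.norm_of_nonneg (by positivity), ← mul_pow]
    gcongr
    exact (LinearMap.toContinuousLinearMap A).le_opNorm w
  have hq0 : (0 : ℝ) < q := by exact_mod_cast hq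
  have hsq : 0 < √(q : ℝ) := Real.sqrt_pos.2 hq0
  have hρ2 : (3 * √q * T) ^ 2 = 9 * q * T ^ 2 := by
    rw [mul_pow, mul_pow, Real.sq_sqrt hq0.le]; norm_num
  have key := (h.map A hAm).le_of_marginal_ge hq hmA (ρ := 3 * √q * T)
    (H := 3 / 512 * √q * R) (by positivity) (by nlinarith [mul_pos hsq hS]) (fun θ hθ => by
      rw [integral_map hAm.aemeasurable (by fun_prop)]
      exact hA1 θ hθ) (by
      rw [integral_map hAm.aemeasurable (by fun_prop), hρ2]
      refine hA2.trans ?_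
      have : 0 < q * T ^ 2 := by positivity
      linarith)
  have : √q * R ≤ √q * (100663296 * T) := by linarith
  have := le_of_mul_le_mul_left this hsq
  linarith

/-- The linear map multiplying the `i`-th coordinate by `w i`. -/
def coordScale {n : ℕ} (w : Fin n → ℝ) :
    EuclideanSpace ℝ (Fin n) →ₗ[ℝ] EuclideanSpace ℝ (Fin n) :=
  Matrix.toEuclideanLin (Matrix.diagonal w)

section CoordScale

variable {n : ℕ} (w : Fin n → ℝ)

lemma coordScale_apply (x : EuclideanSpace ℝ (Fin n)) (i : Fin n) :
    coordScale w x i = w i * x i := by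
  simp [coordScale, Matrix.toLpLin_apply, Matrix.mulVec_diagonal]

lemma measurable_coordScale : Measurable (coordScale w) :=
  (coordScale w).continuous_of_finiteDimensional.measurable

lemma inner_coordScale (v x : EuclideanSpace ℝ (Fin n)) :
    ⟪v, coordScale w x⟫ = ⟪coordScale w v, x⟫ := by
  simp only [PiLp.inner_apply, coordScale_apply, RCLike.inner_apply, conj_trivial]
  exact Finset.sum_congr rfl fun i _ => by ring

lemma norm_coordScale_sq (x : EuclideanSpace ℝ (Fin n)) :
    ‖coordScale w x‖ ^ 2 = ∑ i, w i ^ 2 * x i ^ 2 := by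
  simp only [EuclideanSpace.real_norm_sq_eq, coordScale_apply, mul_pow]

lemma norm_coordScale_le {W : ℝ} (hW : 0 ≤ W) (hw : ∀ i, |w i| ≤ W)
    (x : EuclideanSpace ℝ (Fin n)) : ‖coordScale w x‖ ≤ W * ‖x‖ := by
  refine abs_le_of_sq_le_sq' ?_ (by positivity) |>.2
  rw [norm_coordScale_sq, mul_pow, EuclideanSpace.real_norm_sq_eq, Finset.mul_sum]
  refine Finset.sum_le_sum fun i _ => mul_le_mul_of_nonneg_right ?_ (sq_nonneg _)
  rw [← sq_abs]
  exact pow_le_pow_left₀ (abs_nonneg _) (hw i) 2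

end CoordScale

lemma integrable_coord_sq {n : ℕ} {ν : Measure (EuclideanSpace ℝ (Fin n))}
    (hm : Integrable (fun w => ‖w‖ ^ 2) ν) (i : Fin n) : Integrable (fun x => x i ^ 2) ν := by
  refine hm.mono' (by fun_prop) (.of_forall fun x => ?_)
  rw [Real.norm_of_nonneg (by positivity), ← sq_abs, ← Real.norm_eq_abs]
  gcongr
  exact PiLp.norm_apply_le x i

lemma sq_le_add_pow {x M : ℝ} (hx : 0 ≤ x) (hM : 0 < M) {q : ℕ} (hq : 2 ≤ q) :
    x ^ 2 ≤ M ^ 2 + M ^ 2 * (x ^ q / M ^ q) := by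
  rcases le_total x M with h | h
  · have : x ^ 2 ≤ M ^ 2 := by gcongr
    have : 0 ≤ M ^ 2 * (x ^ q / M ^ q) := by positivity
    linarith
  · have h1 : (x / M) ^ 2 ≤ (x / M) ^ q := pow_le_pow_right₀ ((one_le_div hM).2 h) hq
    have h2 : x ^ 2 = M ^ 2 * (x / M) ^ 2 := by field_simp
    rw [h2, ← div_pow]
    have : M ^ 2 * (x / M) ^ 2 ≤ M ^ 2 * (x / M) ^ q := by gcongr
    have : 0 ≤ M ^ 2 := by positivity
    linarith

/-- On an event of probability at least `e^{-q}`, the weighted second moments are controlled by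
Paouris' inequality. -/
lemma LogConcaveMeasure.sum_setIntegral_le {n q : ℕ} (hq : 2 ≤ q)
    {ν : Measure (EuclideanSpace ℝ (Fin n))} [IsProbabilityMeasure ν] (h : LogConcaveMeasure ν)
    (hm : ∀ r : ℕ, Integrable (fun w => ‖w‖ ^ r) ν) (h2 : ∀ i, ∫ x, x i ^ 2 ∂ν = 1)
    {w : Fin n → ℝ} {W L T : ℝ} (hW : 0 < W) (hw : ∀ i, |w i| ≤ W) (hL : 0 < L) (hT : 0 < T)
    (hLq : ∀ v, ∫ x, |⟪v, x⟫| ^ q ∂ν ≤ (L * ‖v‖) ^ q) (hwT : ∑ i, w i ^ 2 ≤ T ^ 2)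
    {A : Set (EuclideanSpace ℝ (Fin n))} (hA : exp (-q) ≤ ν.real A) :
    ∑ i, w i ^ 2 * ∫ x in A, x i ^ 2 ∂ν ≤
      2 * (exp 1 * (100663296 * (T + L * W))) ^ 2 * ν.real A := by
  set D := coordScale w with hD
  have hDm : Measurable D := measurable_coordScale w
  have hDn : ∀ x, ‖D x‖ ≤ W * ‖x‖ := norm_coordScale_le w hW.le hw
  have hDi : ∀ r : ℕ, Integrable (fun x => ‖D x‖ ^ r) ν := by
    intro r
    refine ((hm r).const_mul (W ^ r)).mono' (by fun_prop) (.of_forall fun x => ?_)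
    rw [Real.norm_of_nonneg (by positivity), ← mul_pow]
    gcongr
    exact hDn x
  have hxi : ∀ i, Integrable (fun x => x i ^ 2) ν := integrable_coord_sq (hm 2)
  have : IsProbabilityMeasure (ν.map D) := Measure.isProbabilityMeasure_map hDm.aemeasurable
  have hP := (h.map D hDm).paouris (q := q) (by omega) (fun r => by
      rw [integrable_map_measure (by fun_prop) hDm.aemeasurable]
      exact hDi r) (S := L * W) (T := T) (by positivity) hT (by
      rw [integral_map hDm.aemeasurable (by fun_prop)]
      simp only [hD, norm_coordScale_sq]
      rw [integral_finsetSum _ fun i _ => (hxi i).const_mul _]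
      simp only [integral_const_mul, h2, mul_one]
      exact hwT) (fun v => by
      rw [integral_map hDm.aemeasurable (by fun_prop)]
      simp only [hD, inner_coordScale]
      refine (hLq _).trans ?_
      rw [mul_assoc]
      gcongr
      exact hDn v)
  rw [integral_map hDm.aemeasurable (by fun_prop)] at hP
  set B := 100663296 * (T + L * W) with hB
  have hB0 : 0 < B := by positivity
  set M := exp 1 * B with hM
  have hM0 : 0 < M := by positivity
  calc ∑ i, w i ^ 2 * ∫ x in A, x i ^ 2 ∂ν = ∫ x in A, ‖D x‖ ^ 2 ∂ν := by
        simp only [hD, norm_coordScale_sq]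
        rw [integral_finsetSum _ fun i _ => ((hxi i).const_mul _).integrableOn]
        simp only [integral_const_mul]
    _ ≤ ∫ x in A, (M ^ 2 + M ^ 2 * (‖D x‖ ^ q / M ^ q)) ∂ν := by
        refine integral_mono (hDi 2).integrableOn ?_ fun x => sq_le_add_pow (norm_nonneg _) hM0 hq
        exact (integrable_const _).add ((((hDi q).integrableOn).div_const _).const_mul _)
    _ = M ^ 2 * ν.real A + M ^ 2 * ((∫ x in A, ‖D x‖ ^ q ∂ν) / M ^ q) := by
        rw [integral_add (integrable_const _)
          ((((hDi q).integrableOn).div_const _).const_mul _), integral_const_mul, integral_div]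
        simp [mul_comm]
    _ ≤ M ^ 2 * ν.real A + M ^ 2 * (B ^ q / M ^ q) := by
        gcongr
        refine (setIntegral_le_integral (hDi q) (.of_forall fun _ => by positivity)).trans hP
    _ ≤ M ^ 2 * ν.real A + M ^ 2 * ν.real A := by
        gcongr
        refine le_trans (le_of_eq ?_) hA
        rw [hM, mul_pow (exp 1), ← Real.exp_nat_mul, mul_one, Real.exp_neg]
        field_simp
    _ = _ := by ring

/-- If `A` is convex and meets the half-space `x_i ≥ t` with conditional probability at least
`e^{-u}`, then `x_i²` has conditional mean at least of order `t²/u²` on `A`. -/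
lemma LogConcaveMeasure.setIntegral_coord_sq_ge {n : ℕ} {ν : Measure (EuclideanSpace ℝ (Fin n))}
    [IsProbabilityMeasure ν] (h : LogConcaveMeasure ν) {A : Set (EuclideanSpace ℝ (Fin n))}
    (hA : Convex ℝ A) (hAm : MeasurableSet A) (i : Fin n)
    (hi : Integrable (fun x => x i ^ 2) ν) {t u : ℝ} (ht : 0 < t) (hu : 2 ≤ u)
    (hau : exp (-u) * ν.real A ≤ ν.real (A ∩ {x | t ≤ x i})) :
    t ^ 2 / (24 * u ^ 2) * ν.real A ≤ ∫ x in A, x i ^ 2 ∂ν := by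
  have hu0 : 0 < u := by linarith
  have hmi : ∀ c : ℝ, MeasurableSet {x : EuclideanSpace ℝ (Fin n) | c ≤ x i} := fun c =>
    measurableSet_le measurable_const (by fun_prop)
  have hma : MeasurableSet {x : EuclideanSpace ℝ (Fin n) | t / (2 * u) ≤ |x i|} :=
    measurableSet_le measurable_const (by fun_prop)
  have hα0 : 0 ≤ ν.real A := measureReal_nonneg
  have key : ν.real A / 6 ≤ ν.real (A ∩ {x | t / (2 * u) ≤ |x i|}) := by
    by_contra! hcon
    have hα : 0 < ν.real A := by
      have : 0 ≤ ν.real (A ∩ {x | t / (2 * u) ≤ |x i|}) := measureReal_nonneg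
      linarith
    have h1 : ν.real A / 2 ≤ ν.real (A ∩ {x | -(t / (2 * u)) ≤ x i}) := by
      have : ν.real A ≤ ν.real (A ∩ {x | -(t / (2 * u)) ≤ x i}) +
          ν.real (A ∩ {x | t / (2 * u) ≤ |x i|}) := by
        refine (measureReal_mono (fun x hx => ?_)).trans (measureReal_union_le _ _)
        rcases le_total (-(t / (2 * u))) (x i) with h1 | h1
        · exact Or.inl ⟨hx, h1⟩
        · exact Or.inr ⟨hx, (by linarith : t / (2 * u) ≤ -x i).trans (neg_le_abs _)⟩
      linarith
    have hl1 : 1 / u < 1 := by rw [div_lt_one hu0]; linarith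
    have h2 := h _ _ (A ∩ {x | t / (2 * u) ≤ |x i|}) (hAm.inter (hmi t))
      (hAm.inter (hmi (-(t / (2 * u))))) (hAm.inter hma) (1 / u) (1 - 1 / u) (by positivity)
      (by linarith) (by ring) (by
        rintro x ⟨hxA, hx⟩ y ⟨hyA, hy⟩
        refine ⟨hA hxA hyA (by positivity) (by linarith) (by ring), ?_⟩
        rw [Set.mem_ofPred_eq] at *
        refine le_trans ?_ (le_abs_self _)
        rw [PiLp.add_apply, PiLp.smul_apply, PiLp.smul_apply, smul_eq_mul, smul_eq_mul]
        have h3 : 1 / u * t ≤ 1 / u * x i := by gcongr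
        have h4 : (1 - 1 / u) * -(t / (2 * u)) ≤ (1 - 1 / u) * y i :=
          mul_le_mul_of_nonneg_left hy (by linarith)
        have h5 : 0 ≤ 1 / u * (t / (2 * u)) := by positivity
        have h6 : 1 / u * t = 2 * (t / (2 * u)) := by field_simp
        linarith)
    have h3 : (exp (-u) * ν.real A) ^ (1 / u) * (ν.real A / 2) ^ (1 - 1 / u) ≤
        ν.real (A ∩ {x | t / (2 * u) ≤ |x i|}) := by
      refine le_trans ?_ h2
      have : 0 ≤ 1 - 1 / u := by linarith
      gcongr
    have h4 : exp (-1) * (1 / 2) * ν.real A ≤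
        (exp (-u) * ν.real A) ^ (1 / u) * (ν.real A / 2) ^ (1 - 1 / u) := by
      rw [div_eq_mul_one_div (ν.real A) 2, Real.mul_rpow (exp_pos _).le hα0,
        Real.mul_rpow hα0 (by norm_num), ← Real.exp_mul]
      have e1 : -u * (1 / u) = -1 := by field_simp
      have e2 : ν.real A ^ (1 / u) * ν.real A ^ (1 - 1 / u) = ν.real A := by
        rw [← Real.rpow_add hα]; simp
      have e3 : (1 / 2 : ℝ) ≤ (1 / 2) ^ (1 - 1 / u) := by
        have : 0 < 1 / u := by positivity
        exact Real.self_le_rpow_of_le_one (by norm_num) (by norm_num) (by linarith)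
      rw [e1]
      calc exp (-1) * (1 / 2) * ν.real A ≤ exp (-1) * (1 / 2) ^ (1 - 1 / u) * ν.real A := by
            gcongr
        _ = exp (-1) * (1 / 2) ^ (1 - 1 / u) *
            (ν.real A ^ (1 / u) * ν.real A ^ (1 - 1 / u)) := by rw [e2]
        _ = _ := by ring
    have h5 : 1 / 3 ≤ exp (-1) := by
      rw [exp_neg, ← one_div]
      exact one_div_le_one_div_of_le (exp_pos _) (by linarith [exp_one_lt_d9])
    nlinarith
  have h7 : (t / (2 * u)) ^ 2 * ν.real (A ∩ {x | t / (2 * u) ≤ |x i|}) ≤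
      ∫ x in A, x i ^ 2 ∂ν := by
    calc _ = ∫ x in A ∩ {x | t / (2 * u) ≤ |x i|}, (t / (2 * u)) ^ 2 ∂ν := by
          simp [mul_comm]
      _ ≤ ∫ x in A ∩ {x | t / (2 * u) ≤ |x i|}, x i ^ 2 ∂ν := by
          refine setIntegral_mono_on (integrable_const _) hi.integrableOn (hAm.inter hma)
            fun x hx => ?_
          rw [← sq_abs (x i)]
          exact pow_le_pow_left₀ (by positivity) hx.2 2
      _ ≤ _ := setIntegral_mono_set hi.integrableOn (.of_forall fun _ => by positivity)
          Set.inter_subset_left.eventuallyLE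
  refine le_trans ?_ h7
  calc t ^ 2 / (24 * u ^ 2) * ν.real A = (t / (2 * u)) ^ 2 * (ν.real A / 6) := by
        field_simp; ring
    _ ≤ _ := by gcongr

lemma sq_max_one_le {y : ℝ} (hy : 0 ≤ y) : max 1 y ^ 2 ≤ 32 * exp (y / 4) := by
  have h1 : 1 ≤ exp (y / 4) := Real.one_le_exp (by positivity)
  rcases max_cases 1 y with ⟨h, -⟩ | ⟨h, -⟩
  · rw [h]; linarith
  · rw [h]
    have := Real.quadratic_le_exp_of_nonneg (show 0 ≤ y / 4 by positivity)
    nlinarith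

lemma mul_exp_neg_div_four_le (u : ℝ) : u * exp (-(u / 4)) ≤ 4 := by
  rw [exp_neg, ← div_eq_mul_inv, div_le_iff₀ (exp_pos _)]
  linarith [add_one_le_exp (u / 4)]

/-- The core of the counting estimate: the sum of `e^{-u_i/2}` over coordinates that are large with
conditional probability at least `e^{-u_i}`. -/
lemma LogConcaveMeasure.sum_exp_neg_le {n q : ℕ} (hq : 2 ≤ q)
    {ν : Measure (EuclideanSpace ℝ (Fin n))} [IsProbabilityMeasure ν] (h : LogConcaveMeasure ν)
    (hm : ∀ r : ℕ, Integrable (fun w => ‖w‖ ^ r) ν) (h2 : ∀ i, ∫ x, x i ^ 2 ∂ν = 1)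
    {L t : ℝ} (hL : 0 < L) (ht : 0 < t)
    (hLq : ∀ v, ∫ x, |⟪v, x⟫| ^ q ∂ν ≤ (L * ‖v‖) ^ q)
    {A : Set (EuclideanSpace ℝ (Fin n))} (hAc : Convex ℝ A) (hAm : MeasurableSet A)
    (hA : exp (-q) ≤ ν.real A) {u : Fin n → ℝ} {I : Finset (Fin n)}
    (hu2 : ∀ i, 2 ≤ u i) (hut : ∀ i ∈ I, u i ≤ t / (42 * 100663296))
    (hau : ∀ i ∈ I, exp (-u i) * ν.real A ≤ ν.real (A ∩ {x | t ≤ x i})) :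
    t ^ 2 * ∑ i ∈ I, exp (-(u i / 2)) ≤ 6912 * 100663296 ^ 2 * (4 * L) ^ 2 := by
  classical
  have hα : 0 < ν.real A := (exp_pos _).trans_le hA
  have hu0 : ∀ i, 0 < u i := fun i => by linarith [hu2 i]
  set w : Fin n → ℝ := fun i => if i ∈ I then u i * exp (-(u i / 4)) else 0 with hw
  have hw2 : ∀ i ∈ I, w i ^ 2 = u i ^ 2 * exp (-(u i / 2)) := by
    intro i hi
    simp only [hw, if_pos hi]
    rw [mul_pow, ← Real.exp_nat_mul]
    congr 2; push_cast; ring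
  have hw4 : ∀ i, |w i| ≤ 4 := by
    intro i
    by_cases hi : i ∈ I
    · simp only [hw, if_pos hi]
      rw [abs_of_pos (mul_pos (hu0 i) (exp_pos _))]
      exact mul_exp_neg_div_four_le _
    · simp [hw, hi]
  set W2 := ∑ i, w i ^ 2 with hW2
  have hW20 : 0 ≤ W2 := Finset.sum_nonneg fun i _ => sq_nonneg _
  have hW2I : W2 = ∑ i ∈ I, u i ^ 2 * exp (-(u i / 2)) := by
    rw [hW2, ← Finset.sum_congr rfl hw2]
    symm
    refine Finset.sum_subset (Finset.subset_univ _) fun i _ hi => ?_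
    simp [hw, hi]
  have hsq := Real.sq_sqrt hW20
  have hs0 := Real.sqrt_nonneg W2
  have key := h.sum_setIntegral_le hq hm h2 (w := w) (W := 4) (L := L) (T := √W2 + 4 * L)
    (by norm_num) hw4 hL (by positivity) hLq (by nlinarith) hA
  have hlow : ∑ i ∈ I, exp (-(u i / 2)) * (t ^ 2 / 24 * ν.real A) ≤
      ∑ i, w i ^ 2 * ∫ x in A, x i ^ 2 ∂ν := by
    refine le_trans (Finset.sum_le_sum (g := fun i => w i ^ 2 * ∫ x in A, x i ^ 2 ∂ν)
      fun i hi => ?_) (Finset.sum_le_sum_of_subset_of_nonneg (Finset.subset_univ _)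
        fun i _ _ => mul_nonneg (sq_nonneg _) (integral_nonneg fun _ => sq_nonneg _))
    have h3 := h.setIntegral_coord_sq_ge hAc hAm i (integrable_coord_sq (hm 2) i) ht (hu2 i)
      (hau i hi)
    rw [hw2 i hi]
    calc exp (-(u i / 2)) * (t ^ 2 / 24 * ν.real A) =
          u i ^ 2 * exp (-(u i / 2)) * (t ^ 2 / (24 * u i ^ 2) * ν.real A) := by
          have := hu0 i
          field_simp
      _ ≤ _ := by gcongr
  rw [← Finset.sum_mul] at hlow
  set B := ∑ i ∈ I, exp (-(u i / 2)) with hB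
  have h4 : B * (t ^ 2 / 24) ≤ 2 * (exp 1 * (100663296 * (√W2 + 4 * L + L * 4))) ^ 2 := by
    have := hlow.trans key
    rw [← mul_assoc] at this
    exact le_of_mul_le_mul_right this hα
  have h5 : (exp 1 * (100663296 * (√W2 + 4 * L + L * 4))) ^ 2 ≤
      9 * 100663296 ^ 2 * (2 * W2 + 8 * (4 * L) ^ 2) := by
    rw [mul_pow, mul_pow, mul_assoc]
    have e1 : exp 1 ^ 2 ≤ 9 := by
      have := exp_one_lt_d9
      have := exp_pos (1 : ℝ)
      nlinarith
    have e2 : (√W2 + 4 * L + L * 4) ^ 2 ≤ 2 * W2 + 8 * (4 * L) ^ 2 := by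
      nlinarith [sq_nonneg (√W2 - 8 * L)]
    gcongr
  have h6 : W2 ≤ t ^ 2 / (42 * 100663296) ^ 2 * B := by
    rw [hW2I, hB, Finset.mul_sum]
    refine Finset.sum_le_sum fun i hi => ?_
    gcongr
    rw [← div_pow]
    have := hu0 i
    exact pow_le_pow_left₀ this.le (hut i hi) 2
  have hB0 : 0 ≤ B := Finset.sum_nonneg fun i _ => (exp_pos _).le
  have h7 : 0 ≤ t ^ 2 * B := by positivity
  have h8 : t ^ 2 / (42 * 100663296) ^ 2 * B = (t ^ 2 * B) / (42 * 100663296) ^ 2 := by ring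
  rw [h8] at h6
  norm_num at h4 h5 h6 ⊢
  nlinarith

/-- On a convex event `A`, the events `x_i ≥ t` cannot be large for many `i` at once. -/
lemma LogConcaveMeasure.sum_sqrt_le {n : ℕ} {ν : Measure (EuclideanSpace ℝ (Fin n))}
    [IsProbabilityMeasure ν] (h : LogConcaveMeasure ν)
    (hm : ∀ r : ℕ, Integrable (fun w => ‖w‖ ^ r) ν) (h2 : ∀ i, ∫ x, x i ^ 2 ∂ν = 1)
    {p σ t : ℝ} (hp : 1 ≤ p) (hσ0 : 0 < σ) (ht : 0 < t)
    (hσ : ∀ q : ℕ, p ≤ q → ∀ v, ∫ x, |⟪v, x⟫| ^ q ∂ν ≤ (200 * (q / p) * σ * ‖v‖) ^ q)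
    (hn : n * t ^ 2 ≤ σ ^ 2 * exp (t / (84 * 100663296)))
    {A : Set (EuclideanSpace ℝ (Fin n))} (hAc : Convex ℝ A) (hAm : MeasurableSet A)
    (hA : 0 < ν.real A) :
    ∑ i, √(ν.real (A ∩ {x | t ≤ x i})) ≤
      10 ^ 29 * (σ ^ 2 / t ^ 2) * (√(ν.real A) * ν.real A ^ (-(1 / (4 * p)))) := by
  classical
  set α := ν.real A with hαdef
  set s := -Real.log α with hs
  have hα1 : α ≤ 1 := measureReal_le_one
  have hs0 : 0 ≤ s := by rw [hs]; linarith [Real.log_nonpos hA.le hα1]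
  have hαs : exp (-s) = α := by rw [hs, neg_neg, Real.exp_log hA]
  set r := max 1 (s / p) with hr
  have hr1 : 1 ≤ r := le_max_left _ _
  have hsr : s ≤ r * p := by
    rw [← div_le_iff₀ (by linarith)]; exact le_max_right _ _
  have hpr : p ≤ r * p := by nlinarith
  set q := ⌈r * p⌉₊ + 1 with hq
  have hq1 : r * p ≤ q := by
    rw [hq]; push_cast; linarith [Nat.le_ceil (r * p)]
  have hq2 : 2 ≤ q := by
    have : 0 < ⌈r * p⌉₊ := Nat.ceil_pos.2 (by linarith)
    omega
  have hq3 : q / p ≤ 3 * r := by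
    rw [div_le_iff₀ (by linarith), hq]
    push_cast
    linarith [Nat.ceil_lt_add_one (show 0 ≤ r * p by linarith)]
  have hq0 : (0 : ℝ) < q := by positivity
  set a : Fin n → ℝ := fun i => ν.real (A ∩ {x | t ≤ x i}) / α with ha
  have ha0 : ∀ i, 0 ≤ a i := fun i => by positivity
  have ha1 : ∀ i, a i ≤ 1 := fun i =>
    div_le_one_of_le₀ (measureReal_mono Set.inter_subset_left) hA.le
  set u : Fin n → ℝ := fun i => max 2 (-Real.log (a i)) with hu
  have hu2 : ∀ i, 2 ≤ u i := fun i => le_max_left _ _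
  have hub : ∀ i, √(a i) ≤ 3 * exp (-(u i / 2)) ∨ a i = 0 := by
    intro i
    rcases (ha0 i).eq_or_lt with h0 | h0
    · exact Or.inr h0.symm
    left
    rcases max_cases 2 (-Real.log (a i)) with ⟨h1, h1'⟩ | ⟨h1, -⟩
    · simp only [hu, h1]
      have e1 : 1 ≤ 3 * exp (-(2 / 2) : ℝ) := by
        rw [div_self two_ne_zero, exp_neg, ← div_eq_mul_inv, le_div_iff₀ (exp_pos _)]
        linarith [exp_one_lt_d9]
      exact (Real.sqrt_le_one.2 (ha1 i)).trans e1
    · simp only [hu, h1]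
      have e1 : √(a i) = exp (-(-Real.log (a i) / 2)) := by
        rw [Real.sqrt_eq_iff_mul_self_eq h0.le (exp_pos _).le, ← Real.exp_add]
        conv_lhs => rw [← Real.exp_log h0]
        congr 1; ring
      rw [← e1]
      linarith [Real.sqrt_nonneg (a i)]
  set I : Finset (Fin n) := {i | a i ≠ 0 ∧ u i ≤ t / (42 * 100663296)} with hI
  have hL0 : 0 < 200 * (q / p) * σ := by positivity
  have hcore := h.sum_exp_neg_le hq2 hm h2 hL0 ht (hσ q (hpr.trans hq1)) hAc hAm (u := u) (I := I)
    (by rw [← hαdef, ← hαs]; exact exp_le_exp.2 (by linarith)) hu2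
    (fun i hi => (Finset.mem_filter.1 hi).2.2) (fun i hi => by
      have h0 : 0 < a i := (ha0 i).lt_of_ne' (Finset.mem_filter.1 hi).2.1
      have h1 : exp (-u i) ≤ a i := by
        rw [← Real.le_log_iff_exp_le h0]
        linarith [le_max_right 2 (-Real.log (a i))]
      rw [← le_div_iff₀ hA]
      exact h1)
  have hn' : n * exp (-(t / (84 * 100663296))) ≤ σ ^ 2 / t ^ 2 := by
    rw [exp_neg, ← div_eq_mul_inv, div_le_div_iff₀ (exp_pos _) (by positivity)]
    exact hn
  have hsum : ∑ i, √(a i) ≤ 3 * ∑ i ∈ I, exp (-(u i / 2)) + 3 * (σ ^ 2 / t ^ 2) := by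
    rw [← Finset.sum_filter_add_sum_filter_not Finset.univ (· ∈ I)]
    refine add_le_add ?_ ?_
    · rw [Finset.filter_univ_mem, Finset.mul_sum]
      exact Finset.sum_le_sum fun i hi =>
        (hub i).resolve_right (Finset.mem_filter.1 hi).2.1
    · refine le_trans (Finset.sum_le_card_nsmul _ _ (3 * exp (-(t / (84 * 100663296)))) ?_) ?_
      · intro i hi
        by_cases h0 : a i = 0
        · rw [h0, Real.sqrt_zero]; positivity
        refine ((hub i).resolve_right h0).trans ?_
        simp only [hI, Finset.mem_filter, Finset.mem_univ, true_and, not_and, not_le] at hi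
        have := hi h0
        have e : t / (84 * 100663296) = t / (42 * 100663296) / 2 := by ring
        have := exp_le_exp.2 (show -(u i / 2) ≤ -(t / (84 * 100663296)) by rw [e]; linarith)
        linarith
      · rw [nsmul_eq_mul]
        have : ((Finset.univ.filter fun i => i ∉ I).card : ℝ) ≤ n := by
          exact_mod_cast (Finset.card_le_univ _).trans (by simp)
        calc _ ≤ n * (3 * exp (-(t / (84 * 100663296)))) := by gcongr
          _ ≤ _ := by linarith
  have hM0 : 0 < σ ^ 2 / t ^ 2 := by positivity
  have hr2 : r ^ 2 ≤ 32 * α ^ (-(1 / (4 * p))) := by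
    refine (sq_max_one_le (by positivity)).trans (le_of_eq ?_)
    rw [← hαs, ← Real.exp_mul]
    congr 2
    field_simp
  have hI2 : ∑ i ∈ I, exp (-(u i / 2)) ≤ 39813120000 * 100663296 ^ 2 * r ^ 2 * (σ ^ 2 / t ^ 2) := by
    have h3 : (4 * (200 * (q / p) * σ)) ^ 2 ≤ 5760000 * r ^ 2 * σ ^ 2 := by
      calc (4 * (200 * (q / p) * σ)) ^ 2 ≤ (4 * (200 * (3 * r) * σ)) ^ 2 := by gcongr
        _ = _ := by ring
    rw [← mul_div_assoc, le_div_iff₀ (by positivity), mul_comm]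
    refine hcore.trans ?_
    calc _ ≤ 6912 * 100663296 ^ 2 * (5760000 * r ^ 2 * σ ^ 2) := by gcongr
      _ = _ := by ring
  have hfin : ∑ i, √(a i) ≤ 10 ^ 29 * (σ ^ 2 / t ^ 2) * α ^ (-(1 / (4 * p))) := by
    have h1r : 1 ≤ r ^ 2 := one_le_pow₀ hr1
    set M := σ ^ 2 / t ^ 2
    have h4 : M ≤ r ^ 2 * M := le_mul_of_one_le_left hM0.le h1r
    have h5 : r ^ 2 * M ≤ 32 * α ^ (-(1 / (4 * p))) * M := by gcongr
    have h6 : 0 ≤ r ^ 2 * M := by positivity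
    norm_num at hI2 h5 ⊢
    linarith
  calc ∑ i, √(ν.real (A ∩ {x | t ≤ x i})) = √α * ∑ i, √(a i) := by
        rw [Finset.mul_sum]
        refine Finset.sum_congr rfl fun i _ => ?_
        rw [← Real.sqrt_mul hA.le]
        congr 1
        simp only [ha]; field_simp
    _ ≤ √α * (10 ^ 29 * (σ ^ 2 / t ^ 2) * α ^ (-(1 / (4 * p)))) := by gcongr
    _ = _ := by ring

/-- The number of coordinates that are at least `t`. -/
def upperCount {n : ℕ} (t : ℝ) (x : EuclideanSpace ℝ (Fin n)) : ℝ :=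
  ∑ i, if t ≤ x i then 1 else 0

section UpperCount

variable {n : ℕ} {t : ℝ}

lemma measurable_upperCount : Measurable (upperCount (n := n) t) :=
  Finset.measurable_sum _ fun _ _ =>
    Measurable.ite (measurableSet_le measurable_const (by fun_prop)) measurable_const
      measurable_const

lemma upperCount_nonneg (x : EuclideanSpace ℝ (Fin n)) : 0 ≤ upperCount t x :=
  Finset.sum_nonneg fun _ _ => by split_ifs <;> norm_num

lemma upperCount_le (x : EuclideanSpace ℝ (Fin n)) : upperCount t x ≤ n := by
  refine (Finset.sum_le_card_nsmul _ _ 1 fun _ _ => by split_ifs <;> norm_num).trans ?_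
  simp

variable {ν : Measure (EuclideanSpace ℝ (Fin n))} [IsProbabilityMeasure ν]

lemma integrable_upperCount_pow (k : ℕ) : Integrable (fun x => upperCount t x ^ k) ν := by
  refine Integrable.of_bound (measurable_upperCount.pow_const k).aestronglyMeasurable
    ((n : ℝ) ^ k) (.of_forall fun x => ?_)
  rw [Real.norm_of_nonneg (pow_nonneg (upperCount_nonneg x) k)]
  exact pow_le_pow_left₀ (upperCount_nonneg x) (upperCount_le x) k

lemma integrable_upperCount_rpow {p : ℝ} (hp : 0 ≤ p) :
    Integrable (fun x => upperCount t x ^ p) ν := by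
  refine Integrable.of_bound (measurable_upperCount.pow_const p).aestronglyMeasurable
    ((n : ℝ) ^ p) (.of_forall fun x => ?_)
  rw [Real.norm_of_nonneg (Real.rpow_nonneg (upperCount_nonneg x) p)]
  exact Real.rpow_le_rpow (upperCount_nonneg x) (upperCount_le x) hp

lemma setIntegral_upperCount_pow_succ (k : ℕ) {A : Set (EuclideanSpace ℝ (Fin n))} :
    ∫ x in A, upperCount t x ^ (k + 1) ∂ν =
      ∑ i, ∫ x in A ∩ {x | t ≤ x i}, upperCount t x ^ k ∂ν := by
  have hH : ∀ i, MeasurableSet {x : EuclideanSpace ℝ (Fin n) | t ≤ x i} := fun i =>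
    measurableSet_le measurable_const (by fun_prop)
  have h1 : ∀ x : EuclideanSpace ℝ (Fin n), upperCount t x ^ (k + 1) =
      ∑ i, {x : EuclideanSpace ℝ (Fin n) | t ≤ x i}.indicator (fun x => upperCount t x ^ k) x := by
    intro x
    rw [pow_succ]
    nth_rewrite 2 [upperCount]
    rw [Finset.mul_sum]
    refine Finset.sum_congr rfl fun i _ => ?_
    simp [Set.indicator]
  simp only [h1]
  rw [integral_finsetSum _ fun i _ =>
    ((integrable_upperCount_pow k).indicator (hH i)).integrableOn]
  refine Finset.sum_congr rfl fun i _ => ?_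
  rw [integral_indicator (hH i), Measure.restrict_restrict (hH i), Set.inter_comm]

/-- Moments of the number of large coordinates, restricted to a convex event. -/
lemma setIntegral_upperCount_pow_le {p B : ℝ} (hp : 1 ≤ p) (hB : 0 ≤ B)
    (h : ∀ A : Set (EuclideanSpace ℝ (Fin n)), Convex ℝ A → MeasurableSet A → 0 < ν.real A →
      ∑ i, √(ν.real (A ∩ {x | t ≤ x i})) ≤ B * (√(ν.real A) * ν.real A ^ (-(1 / (4 * p)))))
    {k : ℕ} (hk : (k : ℝ) ≤ 2 * p) {A : Set (EuclideanSpace ℝ (Fin n))} (hA : Convex ℝ A)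
    (hAm : MeasurableSet A) :
    ∫ x in A, upperCount t x ^ k ∂ν ≤ B ^ k * ν.real A ^ (1 - k / (4 * p)) := by
  have hp0 : 0 < p := by linarith
  induction k generalizing A with
  | zero => simp
  | succ k ih =>
    have hk' : (k : ℝ) + 1 ≤ 2 * p := by exact_mod_cast hk
    have hH : ∀ i, MeasurableSet {x : EuclideanSpace ℝ (Fin n) | t ≤ x i} := fun i =>
      measurableSet_le measurable_const (by fun_prop)
    have hHc : ∀ i, Convex ℝ {x : EuclideanSpace ℝ (Fin n) | t ≤ x i} := fun i =>
      convex_halfSpace_ge (f := fun x : EuclideanSpace ℝ (Fin n) => x i)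
        ⟨fun _ _ => rfl, fun _ _ => rfl⟩ t
    rcases (measureReal_nonneg (μ := ν) (s := A)).eq_or_lt with h0 | hα
    · have h0' : ν A = 0 := by
        rcases (ENNReal.toReal_eq_zero_iff _).1 h0.symm with h1 | h1
        · exact h1
        · exact absurd h1 (measure_ne_top _ _)
      rw [setIntegral_measure_zero _ h0']
      positivity
    rw [setIntegral_upperCount_pow_succ]
    set α := ν.real A
    set e : ℝ := 1 - k / (4 * p) with he
    have he2 : 0 ≤ e - 1 / 2 := by
      have : (k : ℝ) / (4 * p) ≤ 1 / 2 := by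
        rw [div_le_iff₀ (by positivity)]; linarith
      rw [he]; linarith
    have hstep : ∀ i, ∫ x in A ∩ {x | t ≤ x i}, upperCount t x ^ k ∂ν ≤
        B ^ k * (α ^ (e - 1 / 2) * √(ν.real (A ∩ {x | t ≤ x i}))) := by
      intro i
      refine (ih (by linarith) (hA.inter (hHc i)) (hAm.inter (hH i))).trans ?_
      gcongr
      set P := ν.real (A ∩ {x | t ≤ x i})
      have hP : 0 ≤ P := measureReal_nonneg
      calc P ^ e = P ^ (e - 1 / 2) * P ^ (1 / 2 : ℝ) := by
            rw [← Real.rpow_add_of_nonneg hP he2 (by norm_num)]; congr 1; ring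
        _ ≤ α ^ (e - 1 / 2) * √P := by
            rw [Real.sqrt_eq_rpow]
            gcongr
            exact measureReal_mono Set.inter_subset_left
    refine (Finset.sum_le_sum fun i _ => hstep i).trans ?_
    rw [← Finset.mul_sum, ← Finset.mul_sum]
    calc _ ≤ B ^ k * (α ^ (e - 1 / 2) * (B * (√α * α ^ (-(1 / (4 * p)))))) := by
          gcongr
          exact h A hA hAm hα
      _ = B ^ (k + 1) * (α ^ (e - 1 / 2) * α ^ (1 / 2 : ℝ) * α ^ (-(1 / (4 * p)))) := by
          rw [Real.sqrt_eq_rpow]; ring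
      _ = _ := by
          rw [← Real.rpow_add hα, ← Real.rpow_add hα]
          congr 2
          rw [he]; push_cast; field_simp; ring

lemma rpow_le_add_pow {x M p : ℝ} (hx : 0 ≤ x) (hM : 0 < M) {q : ℕ} (hp : 0 ≤ p)
    (hpq : p ≤ q) : x ^ p ≤ M ^ p + M ^ p * (x ^ q / M ^ q) := by
  have h2 : x ^ p = M ^ p * (x / M) ^ p := by
    rw [← Real.mul_rpow hM.le (by positivity)]; congr 1; field_simp
  have h0 : 0 ≤ M ^ p := by positivity
  rw [h2, ← div_pow]
  have h3 : (x / M) ^ p ≤ 1 + (x / M) ^ q := by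
    rcases le_total (x / M) 1 with h | h
    · have := Real.rpow_le_one (by positivity) h hp
      have : 0 ≤ (x / M) ^ q := by positivity
      linarith
    · have := Real.rpow_le_rpow_of_exponent_le h hpq
      rw [Real.rpow_natCast] at this
      linarith
  nlinarith

lemma integral_upperCount_rpow_le {p B : ℝ} (hp : 1 ≤ p) (hB : 0 < B)
    (h : ∀ A : Set (EuclideanSpace ℝ (Fin n)), Convex ℝ A → MeasurableSet A → 0 < ν.real A →
      ∑ i, √(ν.real (A ∩ {x | t ≤ x i})) ≤ B * (√(ν.real A) * ν.real A ^ (-(1 / (4 * p))))) :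
    ∫ x, upperCount t x ^ p ∂ν ≤ 2 * B ^ p := by
  have hk : ((⌈p⌉₊ : ℕ) : ℝ) ≤ 2 * p := by
    linarith [Nat.ceil_lt_add_one (show 0 ≤ p by linarith)]
  have h1 := setIntegral_upperCount_pow_le hp hB.le h hk convex_univ MeasurableSet.univ
  rw [setIntegral_univ, probReal_univ, Real.one_rpow, mul_one] at h1
  calc ∫ x, upperCount t x ^ p ∂ν ≤
        ∫ x, (B ^ p + B ^ p * (upperCount t x ^ ⌈p⌉₊ / B ^ ⌈p⌉₊)) ∂ν := by
        refine integral_mono (integrable_upperCount_rpow (by linarith)) ?_ fun x =>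
          rpow_le_add_pow (upperCount_nonneg x) hB (by linarith) (Nat.le_ceil p)
        exact (integrable_const _).add (((integrable_upperCount_pow _).div_const _).const_mul _)
    _ = B ^ p + B ^ p * ((∫ x, upperCount t x ^ ⌈p⌉₊ ∂ν) / B ^ ⌈p⌉₊) := by
        rw [integral_add (integrable_const _)
          (((integrable_upperCount_pow _).div_const _).const_mul _), integral_const_mul,
          integral_div]
        simp
    _ ≤ B ^ p + B ^ p * 1 := by
        gcongr
        exact div_le_one_of_le₀ h1 (by positivity)
    _ = _ := by ring

end UpperCount

/-- Moments of the number of coordinates of absolute value at least `t`. -/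
lemma LogConcaveMeasure.integral_absCount_rpow_le {n : ℕ}
    {ν : Measure (EuclideanSpace ℝ (Fin n))} [IsProbabilityMeasure ν] (h : LogConcaveMeasure ν)
    (hm : ∀ r : ℕ, Integrable (fun w => ‖w‖ ^ r) ν) (h2 : ∀ i, ∫ x, x i ^ 2 ∂ν = 1)
    {p σ t : ℝ} (hp : 1 ≤ p) (hσ0 : 0 < σ) (ht : 0 < t)
    (hσ : ∀ q : ℕ, p ≤ q → ∀ v, ∫ x, |⟪v, x⟫| ^ q ∂ν ≤ (200 * (q / p) * σ * ‖v‖) ^ q)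
    (hn : n * t ^ 2 ≤ σ ^ 2 * exp (t / (84 * 100663296))) :
    ∫ x, (∑ i, if t ≤ |x i| then (1 : ℝ) else 0) ^ p ∂ν ≤
      (8 * (10 ^ 29 * (σ ^ 2 / t ^ 2))) ^ p := by
  set B := 10 ^ 29 * (σ ^ 2 / t ^ 2) with hB
  have hB0 : 0 < B := by positivity
  have hpos := integral_upperCount_rpow_le (t := t) hp hB0 fun A hAc hAm hA =>
    h.sum_sqrt_le hm h2 hp hσ0 ht hσ hn hAc hAm hA
  set N : EuclideanSpace ℝ (Fin n) →ₗ[ℝ] EuclideanSpace ℝ (Fin n) := -LinearMap.id with hN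
  have hNx : ∀ x, N x = -x := fun x => rfl
  have hNm : Measurable N := measurable_neg
  have : IsProbabilityMeasure (ν.map N) := Measure.isProbabilityMeasure_map hNm.aemeasurable
  have hneg := integral_upperCount_rpow_le (t := t) (ν := ν.map N) hp hB0 fun A hAc hAm hA =>
    (h.map N hNm).sum_sqrt_le (fun r => by
        rw [integrable_map_measure (by fun_prop) hNm.aemeasurable]
        simpa [Function.comp_def, hNx] using hm r) (fun i => by
        rw [integral_map hNm.aemeasurable (by fun_prop)]
        simpa [hNx] using h2 i) hp hσ0 ht (fun q hq v => by
        rw [integral_map hNm.aemeasurable (by fun_prop)]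
        simpa [hNx] using hσ q hq v) hn hAc hAm hA
  have hp0 : 0 ≤ p := by linarith
  have hiN := integrable_upperCount_rpow (t := t) (ν := ν.map N) hp0
  rw [integrable_map_measure (measurable_upperCount.pow_const p).aestronglyMeasurable
    hNm.aemeasurable] at hiN
  rw [integral_map hNm.aemeasurable
    (measurable_upperCount.pow_const p).aestronglyMeasurable] at hneg
  rw [Function.comp_def] at hiN
  have hpt : ∀ x : EuclideanSpace ℝ (Fin n), (∑ i, if t ≤ |x i| then (1 : ℝ) else 0) ^ p ≤
      2 ^ p * (upperCount t x ^ p + upperCount t (N x) ^ p) := by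
    intro x
    have h1 : (∑ i, if t ≤ |x i| then (1 : ℝ) else 0) ≤ upperCount t x + upperCount t (N x) := by
      rw [upperCount, upperCount, ← Finset.sum_add_distrib]
      refine Finset.sum_le_sum fun i _ => ?_
      rw [hNx, PiLp.neg_apply]
      by_cases h3 : t ≤ |x i|
      · rcases le_abs.1 h3 with h4 | h4
        · simp only [if_pos h3, if_pos h4]; split_ifs <;> norm_num
        · simp only [if_pos h3, if_pos h4]; split_ifs <;> norm_num
      · rw [if_neg h3]; split_ifs <;> norm_num
    have h0 := upperCount_nonneg (t := t) x
    have h0' := upperCount_nonneg (t := t) (N x)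
    set a := upperCount t x
    set b := upperCount t (N x)
    have h5 : (a + b) ^ p ≤ (2 * max a b) ^ p :=
      Real.rpow_le_rpow (by positivity) (by linarith [le_max_left a b, le_max_right a b]) hp0
    have h6 : max a b ^ p ≤ a ^ p + b ^ p := by
      have := Real.rpow_nonneg h0 p
      have := Real.rpow_nonneg h0' p
      rcases max_cases a b with ⟨h7, -⟩ | ⟨h7, -⟩ <;> rw [h7] <;> linarith
    rw [Real.mul_rpow (by norm_num) (le_max_of_le_left h0)] at h5
    refine (Real.rpow_le_rpow (Finset.sum_nonneg fun _ _ => by split_ifs <;> norm_num) h1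
      hp0).trans (h5.trans ?_)
    gcongr
  have hi := integrable_upperCount_rpow (t := t) (ν := ν) hp0
  calc _ ≤ ∫ x, 2 ^ p * (upperCount t x ^ p + upperCount t (N x) ^ p) ∂ν :=
        integral_mono_of_nonneg (.of_forall fun x => Real.rpow_nonneg
          (Finset.sum_nonneg fun _ _ => by split_ifs <;> norm_num) p)
          ((hi.add hiN).const_mul _) (.of_forall hpt)
    _ = 2 ^ p * ((∫ x, upperCount t x ^ p ∂ν) + ∫ x, upperCount t (N x) ^ p ∂ν) := by
        rw [integral_const_mul, integral_add hi hiN]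
    _ ≤ 2 ^ p * (2 * B ^ p + 2 * B ^ p) := by gcongr
    _ = 4 * (2 ^ p * B ^ p) := by ring
    _ ≤ 4 ^ p * (2 ^ p * B ^ p) := by
        gcongr
        exact Real.self_le_rpow_of_one_le (by norm_num) hp
    _ = _ := by
        rw [← Real.mul_rpow (by norm_num) hB0.le, ← Real.mul_rpow (by norm_num) (by positivity)]
        congr 1; ring

section Moments

variable {n : ℕ} {ν : Measure (EuclideanSpace ℝ (Fin n))} [IsProbabilityMeasure ν]

lemma LogConcaveMeasure.integrable_norm_pow (h : LogConcaveMeasure ν)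
    (h2 : ∀ i, ∫ x, x i ^ 2 ∂ν = 1) (r : ℕ) : Integrable (fun w => ‖w‖ ^ r) ν := by
  have hq2 : (2 : ℝ) ≤ ((r + 2 : ℕ) : ℝ) := by push_cast; linarith [(r.cast_nonneg : (0 : ℝ) ≤ r)]
  have hi : ∀ i, MemLp (fun x : EuclideanSpace ℝ (Fin n) => x i) ((r + 2 : ℕ) : ℝ≥0∞) ν := by
    intro i
    let T : EuclideanSpace ℝ (Fin n) →ₗ[ℝ] ℝ := PiLp.projₗ 2 (fun _ : Fin n => ℝ) i
    have hT : Measurable T := by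
      change Measurable fun x : EuclideanSpace ℝ (Fin n) => x i
      fun_prop
    have : IsProbabilityMeasure (ν.map T) :=
      Measure.isProbabilityMeasure_map hT.aemeasurable
    have h1 : Integrable (fun x : EuclideanSpace ℝ (Fin n) => x i ^ 2) ν := by
      by_contra hc
      have := h2 i
      rw [integral_undef hc] at this
      exact zero_ne_one this
    have hm' (s : ℝ) : Measurable fun x : ℝ => |x| ^ s := measurable_norm.pow_const s
    have h3 := ((h.map _ hT).integral_rpow_le (p := 2) (by norm_num) hq2 (by
      rw [integrable_map_measure (hm' 2).aestronglyMeasurable hT.aemeasurable]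
      refine h1.congr (.of_forall fun x => ?_)
      change x i ^ 2 = |x i| ^ (2 : ℝ)
      rw [Real.rpow_two, sq_abs])).1
    rw [integrable_map_measure (hm' _).aestronglyMeasurable hT.aemeasurable] at h3
    rw [← integrable_norm_rpow_iff (by fun_prop) (by simp) (by simp)]
    exact h3
  have hid : MemLp (fun x : EuclideanSpace ℝ (Fin n) => x) ((r + 2 : ℕ) : ℝ≥0∞) ν :=
    memLp_piLp_iff.2 hi
  have := (hid.mono_exponent (p := (r : ℝ≥0∞)) (by exact_mod_cast (by omega : r ≤ r + 2)))
  exact this.integrable_norm_pow'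

lemma integrable_abs_inner_rpow (hm : ∀ r : ℕ, Integrable (fun w => ‖w‖ ^ r) ν) {p : ℝ}
    (hp : 0 ≤ p) (v : EuclideanSpace ℝ (Fin n)) : Integrable (fun x => |⟪v, x⟫| ^ p) ν := by
  have hb : ∀ x, |⟪v, x⟫| ^ p ≤ ‖v‖ ^ p * (1 + ‖x‖ ^ ⌈p⌉₊) := by
    intro x
    refine (Real.rpow_le_rpow (abs_nonneg _) (abs_real_inner_le_norm v x) hp).trans ?_
    rw [Real.mul_rpow (norm_nonneg _) (norm_nonneg _)]
    gcongr
    simpa using rpow_le_add_pow (norm_nonneg x) one_pos hp (Nat.le_ceil p)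
  refine (((integrable_const (1 : ℝ)).add (hm ⌈p⌉₊)).const_mul (‖v‖ ^ p)).mono'
    (by fun_prop) (.of_forall fun x => ?_)
  rw [Real.norm_of_nonneg (by positivity)]
  exact hb x

lemma sigmaX_map {Ω : Type*} [MeasurableSpace Ω] {μ : Measure Ω}
    {X : Ω → EuclideanSpace ℝ (Fin n)} (hX : Measurable X) (p : ℝ) :
    sigmaX (μ.map X) (fun x => x) p = sigmaX μ X p := by
  simp only [sigmaX]
  congr 1
  ext v
  rw [integral_map hX.aemeasurable
    ((by fun_prop : Measurable fun x => |⟪v.1, x⟫|).pow_const p).aestronglyMeasurable]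

lemma integral_abs_inner_rpow_le_sigmaX (hm : ∀ r : ℕ, Integrable (fun w => ‖w‖ ^ r) ν) {p : ℝ}
    (hp : 1 ≤ p) {v : EuclideanSpace ℝ (Fin n)} (hv : ‖v‖ = 1) :
    ∫ x, |⟪v, x⟫| ^ p ∂ν ≤ sigmaX ν (fun x => x) p ^ p := by
  have hp0 : 0 < p := by linarith
  have h0 : ∀ v : EuclideanSpace ℝ (Fin n), 0 ≤ ∫ x, |⟪v, x⟫| ^ p ∂ν := fun v =>
    integral_nonneg fun x => by positivity
  have hi : Integrable (fun x => 1 + ‖x‖ ^ ⌈p⌉₊) ν := (integrable_const (1 : ℝ)).add (hm ⌈p⌉₊)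
  have hle : ∀ v : EuclideanSpace ℝ (Fin n), ‖v‖ = 1 →
      ∫ x, |⟪v, x⟫| ^ p ∂ν ≤ ∫ x, (1 + ‖x‖ ^ ⌈p⌉₊) ∂ν := by
    intro v hv
    refine integral_mono (integrable_abs_inner_rpow hm hp0.le v) hi fun x => ?_
    refine (Real.rpow_le_rpow (abs_nonneg _) (abs_real_inner_le_norm v x) hp0.le).trans ?_
    rw [hv, one_mul]
    simpa using rpow_le_add_pow (norm_nonneg x) one_pos hp0.le (Nat.le_ceil p)
  have hbdd : BddAbove (Set.range fun t : {t : EuclideanSpace ℝ (Fin n) // ‖t‖ = 1} =>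
      (∫ x, |⟪t.1, x⟫| ^ p ∂ν) ^ (1 / p)) := by
    refine ⟨(∫ x, (1 + ‖x‖ ^ ⌈p⌉₊) ∂ν) ^ (1 / p), ?_⟩
    rintro _ ⟨t, rfl⟩
    exact Real.rpow_le_rpow (h0 _) (hle _ t.2) (by positivity)
  have := le_ciSup hbdd ⟨v, hv⟩
  have h3 := Real.rpow_le_rpow (Real.rpow_nonneg (h0 v) _) this hp0.le
  rwa [← Real.rpow_mul (h0 v), one_div_mul_cancel hp0.ne', Real.rpow_one] at h3

lemma sigmaX_nonneg {Ω : Type*} [MeasurableSpace Ω] {μ : Measure Ω}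
    {X : Ω → EuclideanSpace ℝ (Fin n)} (p : ℝ) : 0 ≤ sigmaX μ X p :=
  Real.iSup_nonneg fun _ => Real.rpow_nonneg (integral_nonneg fun _ => by positivity) _

lemma sigmaX_pos (hm : ∀ r : ℕ, Integrable (fun w => ‖w‖ ^ r) ν)
    (h2 : ∀ i, ∫ x, x i ^ 2 ∂ν = 1) (hn : 0 < n) {p : ℝ} (hp : 1 ≤ p) :
    0 < sigmaX ν (fun x => x) p := by
  refine (sigmaX_nonneg p).lt_of_ne' fun h0 => ?_
  have h1 := integral_abs_inner_rpow_le_sigmaX hm hp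
    (v := EuclideanSpace.single ⟨0, hn⟩ (1 : ℝ)) (by simp)
  rw [h0, Real.zero_rpow (by linarith)] at h1
  have h3 := (integral_eq_zero_iff_of_nonneg (fun x => by positivity)
    (integrable_abs_inner_rpow hm (by linarith) _)).1
      (h1.antisymm (integral_nonneg fun x => by positivity))
  have h4 : ∫ x : EuclideanSpace ℝ (Fin n), x ⟨0, hn⟩ ^ 2 ∂ν = 0 := by
    refine integral_eq_zero_of_ae ?_
    filter_upwards [h3] with x hx
    have := (Real.rpow_eq_zero (abs_nonneg _) (by linarith)).1 hx
    simpa [EuclideanSpace.inner_single_left] using this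
  rw [h2] at h4
  exact one_ne_zero h4

lemma LogConcaveMeasure.integral_abs_inner_pow_le_sigmaX (h : LogConcaveMeasure ν)
    (hm : ∀ r : ℕ, Integrable (fun w => ‖w‖ ^ r) ν) {p : ℝ} (hp : 1 ≤ p) {q : ℕ}
    (hq : p ≤ q) (v : EuclideanSpace ℝ (Fin n)) :
    ∫ x, |⟪v, x⟫| ^ q ∂ν ≤ (200 * (q / p) * sigmaX ν (fun x => x) p * ‖v‖) ^ q := by
  have hp0 : 0 < p := by linarith
  have hq0 : 0 < q := by
    have : (0 : ℝ) < q := by linarith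
    exact_mod_cast this
  have hσ0 : 0 ≤ sigmaX ν (fun x => x) p := sigmaX_nonneg p
  set σ := sigmaX ν (fun x => x) p
  have hunit : ∀ v : EuclideanSpace ℝ (Fin n), ‖v‖ = 1 →
      ∫ x, |⟪v, x⟫| ^ q ∂ν ≤ (200 * (q / p) * σ) ^ q := by
    intro v hv
    have hT : Measurable (innerSL ℝ v : EuclideanSpace ℝ (Fin n) →ₗ[ℝ] ℝ) :=
      (innerSL ℝ v).measurable
    have : IsProbabilityMeasure (ν.map (innerSL ℝ v : EuclideanSpace ℝ (Fin n) →ₗ[ℝ] ℝ)) :=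
      Measure.isProbabilityMeasure_map hT.aemeasurable
    have hm' (r : ℝ) : Measurable fun x : ℝ => |x| ^ r := measurable_norm.pow_const r
    have h3 := ((h.map _ hT).integral_rpow_le hp hq (by
      rw [integrable_map_measure (hm' p).aestronglyMeasurable hT.aemeasurable]
      exact integrable_abs_inner_rpow hm hp0.le v)).2
    rw [integral_map hT.aemeasurable (hm' _).aestronglyMeasurable,
      integral_map hT.aemeasurable (hm' _).aestronglyMeasurable] at h3
    have h4 : ∫ x, |⟪v, x⟫| ^ (q : ℝ) ∂ν ≤
        (200 * (q / p)) ^ (q : ℝ) * (∫ x, |⟪v, x⟫| ^ p ∂ν) ^ (q / p) := h3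
    simp only [Real.rpow_natCast] at h4
    refine h4.trans ?_
    rw [mul_pow _ σ]
    refine mul_le_mul_of_nonneg_left ?_ (by positivity)
    have h5 := Real.rpow_le_rpow (integral_nonneg fun x => by positivity)
      (integral_abs_inner_rpow_le_sigmaX hm hp hv) (show 0 ≤ q / p by positivity)
    rwa [← Real.rpow_mul hσ0, mul_div_cancel₀ _ hp0.ne', Real.rpow_natCast] at h5
  rcases eq_or_ne v 0 with rfl | hv
  · simp [hq0.ne']
  · have hv' : 0 < ‖v‖ := norm_pos_iff.2 hv
    have h6 := hunit (‖v‖⁻¹ • v) (by simp [norm_smul, hv'.ne'])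
    have h7 : ∀ x, |⟪v, x⟫| ^ q = ‖v‖ ^ q * |⟪‖v‖⁻¹ • v, x⟫| ^ q := by
      intro x
      rw [real_inner_smul_left, abs_mul, ← mul_pow, abs_of_pos (inv_pos.2 hv'),
        mul_inv_cancel_left₀ hv'.ne']
    simp only [h7]
    rw [integral_const_mul, mul_pow _ ‖v‖, mul_comm]
    gcongr

end Moments

lemma sq_le_exp_of_nonneg {s : ℝ} (hs : 0 ≤ s) : s ^ 2 ≤ exp s := by
  have h1 := Real.quadratic_le_exp_of_nonneg (show 0 ≤ s / 2 by positivity)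
  have h2 : s ≤ exp (s / 2) := by nlinarith [sq_nonneg (s - 2)]
  calc s ^ 2 ≤ exp (s / 2) ^ 2 := by gcongr
    _ = exp s := by rw [← Real.exp_nat_mul]; congr 1; push_cast; ring

lemma sq_le_exp_div {t b : ℝ} (hb : 0 < b) (ht : 27 * b ^ 3 ≤ t) : t ^ 2 ≤ exp (t / b) := by
  have ht0 : 0 < t := lt_of_lt_of_le (by positivity) ht
  have h1 : t / (3 * b) ≤ exp (t / (3 * b)) := by linarith [add_one_le_exp (t / (3 * b))]
  calc t ^ 2 ≤ (t / (3 * b)) ^ 3 := by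
        rw [div_pow, le_div_iff₀ (by positivity)]
        nlinarith [sq_nonneg t]
    _ ≤ exp (t / (3 * b)) ^ 3 := by gcongr
    _ = exp (t / b) := by rw [← Real.exp_nat_mul]; congr 1; push_cast; field_simp

lemma integral_count_rpow_le_of_le {n : ℕ} {ν : Measure (EuclideanSpace ℝ (Fin n))}
    [IsProbabilityMeasure ν] {p t B : ℝ} (hp : 1 ≤ p) (hB : t ^ 2 * n ≤ B) :
    ∫ x, (t ^ 2 * ∑ i, if t ≤ |x i| then (1 : ℝ) else 0) ^ p ∂ν ≤ B ^ p := by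
  have hN : ∀ x : EuclideanSpace ℝ (Fin n),
      0 ≤ t ^ 2 * ∑ i, if t ≤ |x i| then (1 : ℝ) else 0 := fun x =>
    mul_nonneg (sq_nonneg t) (Finset.sum_nonneg fun _ _ => by split_ifs <;> norm_num)
  calc _ ≤ ∫ _x : EuclideanSpace ℝ (Fin n), B ^ p ∂ν := by
        refine integral_mono_of_nonneg (.of_forall fun x => Real.rpow_nonneg (hN x) p)
          (integrable_const _) (.of_forall fun x => ?_)
        refine Real.rpow_le_rpow (hN x) (le_trans ?_ hB) (by linarith)
        gcongr
        refine (Finset.sum_le_card_nsmul _ _ 1 fun _ _ => by split_ifs <;> norm_num).trans ?_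
        simp
    _ = B ^ p := by simp

/-- The counting estimate for a log-concave measure with unit coordinate variances. -/
lemma LogConcaveMeasure.integral_count_rpow_le {n : ℕ} {ν : Measure (EuclideanSpace ℝ (Fin n))}
    [IsProbabilityMeasure ν] (h : LogConcaveMeasure ν) (h2 : ∀ i, ∫ x, x i ^ 2 ∂ν = 1)
    {p t : ℝ} (hp : 1 ≤ p)
    (ht : 10 ^ 33 * Real.log (n / sigmaX ν (fun x => x) p ^ 2) ≤ t) :
    ∫ x, (t ^ 2 * ∑ i, if t ≤ |x i| then (1 : ℝ) else 0) ^ p ∂ν ≤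
      (10 ^ 33 * sigmaX ν (fun x => x) p) ^ (2 * p) := by
  have hσ0 : 0 ≤ sigmaX ν (fun x => x) p := sigmaX_nonneg p
  have hm := h.integrable_norm_pow h2
  rw [Real.rpow_mul (by positivity), Real.rpow_two]
  rcases Nat.eq_zero_or_pos n with rfl | hn
  · exact integral_count_rpow_le_of_le hp (by simp; positivity)
  have hσ : 0 < sigmaX ν (fun x => x) p := sigmaX_pos hm h2 hn hp
  have hLq := fun (q : ℕ) (hq : p ≤ q) => h.integral_abs_inner_pow_le_sigmaX hm hp hq
  set σ := sigmaX ν (fun x => x) p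
  have hn0 : (0 : ℝ) < n := by exact_mod_cast hn
  have hnt : n ≤ σ ^ 2 * exp (t / 10 ^ 33) := by
    rw [mul_comm, ← div_le_iff₀ (by positivity), ← Real.log_le_iff_le_exp (by positivity),
      le_div_iff₀ (by positivity), mul_comm]
    exact ht
  rcases le_total t 0 with ht0 | ht0
  · refine integral_count_rpow_le_of_le hp ?_
    have h3 := sq_le_exp_of_nonneg (s := -(t / 10 ^ 33)) (by
      linarith [div_nonpos_of_nonpos_of_nonneg ht0 (show (0 : ℝ) ≤ 10 ^ 33 by positivity)])
    rw [exp_neg, neg_sq, ← one_div, le_div_iff₀ (exp_pos _)] at h3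
    calc t ^ 2 * n ≤ t ^ 2 * (σ ^ 2 * exp (t / 10 ^ 33)) := by gcongr
      _ = (10 ^ 33 * σ) ^ 2 * ((t / 10 ^ 33) ^ 2 * exp (t / 10 ^ 33)) := by ring
      _ ≤ (10 ^ 33 * σ) ^ 2 * 1 := by gcongr
      _ = _ := mul_one _
  rcases le_total (27 * (2 * (84 * 100663296)) ^ 3) t with ht1 | ht1
  · have htp : 0 < t := lt_of_lt_of_le (by norm_num) ht1
    have h3 : t ^ 2 ≤ exp (t / (2 * (84 * 100663296))) := sq_le_exp_div (by norm_num) ht1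
    have h4 : (n : ℝ) ≤ σ ^ 2 * exp (t / (2 * (84 * 100663296))) := by
      refine hnt.trans ?_
      gcongr
      norm_num
    have h5 := h.integral_absCount_rpow_le hm h2 hp hσ htp hLq (by
      calc n * t ^ 2 ≤ (σ ^ 2 * exp (t / (2 * (84 * 100663296)))) *
            exp (t / (2 * (84 * 100663296))) := by gcongr
        _ = σ ^ 2 * exp (t / (84 * 100663296)) := by
          rw [mul_assoc, ← Real.exp_add]; congr 2; ring)
    calc _ = (t ^ 2) ^ p * ∫ x, (∑ i, if t ≤ |x i| then (1 : ℝ) else 0) ^ p ∂ν := by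
          rw [← integral_const_mul]
          congr 1
          ext x
          exact Real.mul_rpow (by positivity)
            (Finset.sum_nonneg fun _ _ => by split_ifs <;> norm_num)
      _ ≤ (t ^ 2) ^ p * (8 * (10 ^ 29 * (σ ^ 2 / t ^ 2))) ^ p := by gcongr
      _ = (8 * 10 ^ 29 * σ ^ 2) ^ p := by
          rw [← Real.mul_rpow (by positivity) (by positivity)]
          congr 1; field_simp
      _ ≤ _ := by
          rw [mul_pow]
          gcongr
          norm_num
  · refine integral_count_rpow_le_of_le hp ?_
    have h3 : exp (t / 10 ^ 33) ≤ 3 := by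
      refine le_trans (exp_le_exp.2 (?_ : _ ≤ (1 : ℝ))) (by linarith [exp_one_lt_d9])
      rw [div_le_one (by positivity)]
      exact ht1.trans (by norm_num)
    calc t ^ 2 * n ≤ (27 * (2 * (84 * 100663296)) ^ 3) ^ 2 * (σ ^ 2 * 3) := by
          gcongr
          exact hnt.trans (by gcongr)
      _ = ((27 * (2 * (84 * 100663296)) ^ 3) ^ 2 * 3) * σ ^ 2 := by ring
      _ ≤ _ := by
          rw [mul_pow (10 ^ 33 : ℝ)]
          gcongr
          norm_num

/-- There is a universal constant `C > 0` such that for every isotropic log-concave random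
vector `X` in `ℝⁿ`, every `p ≥ 1` and every `t ≥ C·log(n/σ_X(p)²)`, one has
`E[(t²·N_X(t))^p] ≤ (C·σ_X(p))^(2p)`, where `N_X(t) = #{i : |Xᵢ| ≥ t}`. -/
theorem counting_paouris :
    ∃ C : ℝ, 0 < C ∧
      ∀ (Ω : Type) (_ : MeasurableSpace Ω) (μ : Measure Ω), IsProbabilityMeasure μ →
      ∀ (n : ℕ) (X : Ω → EuclideanSpace ℝ (Fin n)), Measurable X →
      IsLogConcave μ X → IsIsotropic μ X →
      ∀ p : ℝ, 1 ≤ p →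
      ∀ t : ℝ, C * Real.log ((n : ℝ) / (sigmaX μ X p) ^ 2) ≤ t →
        ∫ ω, (t ^ 2 * ∑ i, if t ≤ |X ω i| then (1 : ℝ) else 0) ^ p ∂μ ≤
          (C * sigmaX μ X p) ^ (2 * p) := by
  refine ⟨10 ^ 33, by norm_num, fun Ω _ μ _ n X hX hlc hiso p hp t ht => ?_⟩
  have : IsProbabilityMeasure (μ.map X) := Measure.isProbabilityMeasure_map hX.aemeasurable
  have h2 : ∀ i, ∫ x, x i ^ 2 ∂μ.map X = 1 := fun i => by
    rw [integral_map hX.aemeasurable (by fun_prop)]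
    simpa [sq] using hiso.2 i i
  have hN : Measurable fun x : EuclideanSpace ℝ (Fin n) =>
      (t ^ 2 * ∑ i, if t ≤ |x i| then (1 : ℝ) else 0) ^ p :=
    ((Finset.measurable_sum _ fun i _ => Measurable.ite
      (measurableSet_le measurable_const (by fun_prop)) measurable_const
      measurable_const).const_mul _).pow_const p
  rw [← sigmaX_map hX] at ht ⊢
  rw [← integral_map hX.aemeasurable hN.aestronglyMeasurable]
  exact (hlc.logConcaveMeasure hX).integral_count_rpow_le h2 hp ht

end
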